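/- arXiv:1411.6097 — 4 statements merged into one kernel-verified Lean document; each statement's English description precedes it below -/
import Mathlib

section
/- Let α be a 1-form on J^k(E) that is locally variationally equivalent to a 1-form L dt with L of order r, where r ≤ k/2, and let σ be a source form in the variational class of dα, i.e. dα − σ = λ + dμ for some holonomic 2-form λ and holonomic 1-form μ. Then a smooth curve γ : I → ℝ^n satisfies the variational principle of α if and only if ι_{(γ^(k))'(t)} σ = 0 for every t ∈ I (equivalently, writing σ = Σ_i σ_i ω^i_(0) ∧ dt, if and only if σ_i(γ^(k)(t)) = 0 for all i and t). -/
open Set Filter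

noncomputable section

/-- The `k`-th order jet space `J^k(E)` of the trivial bundle `E = ℝ × ℝⁿ → ℝ`,
identified with `ℝ × (ℝⁿ)^(k+1)` via the adapted coordinates `(t, y_(0), …, y_(k))`. -/
abbrev Jet (n k : ℕ) : Type := ℝ × (Fin (k + 1) → Fin n → ℝ)

namespace Jet

variable {n k : ℕ}

/-- The 1-form `dt` (coordinate functional `t`). -/
def coT (n k : ℕ) : Jet n k →L[ℝ] ℝ := ContinuousLinearMap.fst ℝ ℝ (Fin (k + 1) → Fin n → ℝ)

/-- The 1-form `dy^i_(a)` (coordinate functional `y^i_(a)`). -/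
def coY (n k : ℕ) (a : Fin (k + 1)) (i : Fin n) : Jet n k →L[ℝ] ℝ :=
  ((ContinuousLinearMap.proj i : (Fin n → ℝ) →L[ℝ] ℝ).comp
      (ContinuousLinearMap.proj a : (Fin (k + 1) → Fin n → ℝ) →L[ℝ] (Fin n → ℝ))).comp
    (ContinuousLinearMap.snd ℝ ℝ (Fin (k + 1) → Fin n → ℝ))

/-- The coordinate tangent vector `∂/∂y^i_(a)`. -/
def eY (n k : ℕ) (a : Fin (k + 1)) (i : Fin n) : Jet n k :=
  (0, fun b j => if b = a ∧ j = i then 1 else 0)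

/-- The total-derivative vector field `d/dt = ∂/∂t + Σ_{a<k} y_(a+1) ∂/∂y_(a)`. -/
def dtVF (n k : ℕ) (u : Jet n k) : Jet n k :=
  (1, fun a i => if h : (a : ℕ) + 1 < k + 1 then u.2 ⟨(a : ℕ) + 1, h⟩ i else 0)

/-- Membership in the holonomic distribution `D` at the point `u`:
`D_u` is spanned by `d/dt|_u` and the top coordinate fields `∂/∂y^i_(k)`. -/
def InD (u v : Jet n k) : Prop :=
  ∃ (c : ℝ) (w : Fin n → ℝ), v = c • dtVF n k u + ∑ i, w i • eY n k (Fin.last k) i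

/-- 1-forms on the jet space. -/
abbrev Form1 (n k : ℕ) := Jet n k → Jet n k →L[ℝ] ℝ

/-- 2-forms on the jet space. -/
abbrev Form2 (n k : ℕ) := Jet n k → Jet n k →L[ℝ] Jet n k →L[ℝ] ℝ

/-- A holonomic 0-form (function) is one vanishing identically. -/
def Hol0 (f : Jet n k → ℝ) (U : Set (Jet n k)) : Prop := ∀ u ∈ U, f u = 0

/-- A holonomic 1-form: its contraction with every `D`-valued vector vanishes. -/
def Hol1 (α : Form1 n k) (U : Set (Jet n k)) : Prop := ∀ u ∈ U, ∀ v, InD u v → α u v = 0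

/-- A holonomic 2-form: its contraction with every `D`-valued vector vanishes. -/
def Hol2 (σ : Form2 n k) (U : Set (Jet n k)) : Prop := ∀ u ∈ U, ∀ v, InD u v → σ u v = 0

/-- Exterior differential of a 1-form: `dα(v,w) = D_vα(w) − D_wα(v)`. -/
def extd (α : Form1 n k) : Form2 n k := fun u => fderiv ℝ α u - (fderiv ℝ α u).flip

/-- Lie bracket of vector fields. -/
def lie (X Y : Jet n k → Jet n k) (u : Jet n k) : Jet n k :=
  fderiv ℝ Y u (X u) - fderiv ℝ X u (Y u)

/-- Lie derivative of a 1-form along a vector field. -/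
def lieD (X : Jet n k → Jet n k) (α : Form1 n k) : Form1 n k :=
  fun u => fderiv ℝ α u (X u) + (α u).comp (fderiv ℝ X u)

/-- Wedge product of two 1-forms. -/
def wedge {E : Type*} [NormedAddCommGroup E] [NormedSpace ℝ E] (β η : E →L[ℝ] ℝ) :
    E →L[ℝ] E →L[ℝ] ℝ :=
  β.smulRight η - η.smulRight β

/-- The contact (holonomic) forms `ω^i_(a) = dy^i_(a) − y^i_(a+1) dt`, `0 ≤ a ≤ k−1`. -/
def contact (n k : ℕ) (a : Fin k) (i : Fin n) (u : Jet n k) : Jet n k →L[ℝ] ℝ :=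
  coY n k a.castSucc i - u.2 a.succ i • coT n k

/-- A source form: an (antisymmetric) 2-form whose contraction with every vector field with
vanishing components along `∂/∂t` and all the `∂/∂y^i_(0)` is zero. -/
def SourceForm (σ : Form2 n k) (U : Set (Jet n k)) : Prop :=
  (∀ u ∈ U, ∀ v w, σ u v w = -σ u w v) ∧
  (∀ u ∈ U, ∀ v : Jet n k, v.1 = 0 → v.2 0 = 0 → σ u v = 0)

/-- The canonical projection `J^k(E) → J^r(E)`, as a continuous linear map. -/
def projL (n : ℕ) {r k : ℕ} (h : r ≤ k) : Jet n k →L[ℝ] Jet n r :=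
  LinearMap.toContinuousLinearMap
    ((LinearMap.id : ℝ →ₗ[ℝ] ℝ).prodMap
      (LinearMap.funLeft ℝ (Fin n → ℝ) (Fin.castLE (Nat.succ_le_succ h))))

/-- Pullback of a 1-form on `J^r(E)` to `J^k(E)`. -/
def pull1 (n : ℕ) {r k : ℕ} (h : r ≤ k) (β : Form1 n r) : Form1 n k :=
  fun u => (β (projL n h u)).comp (projL n h)

/-- Two 1-forms are variationally equivalent on `U` if their difference is
(holonomic 1-form) + d(holonomic 0-form). -/
def VarEquiv1 (α α' : Form1 n k) (U : Set (Jet n k)) : Prop :=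
  ∃ (lam : Form1 n k) (mu : Jet n k → ℝ),
    Hol1 lam U ∧ Hol0 mu U ∧ ∀ u ∈ U, α u - α' u = lam u + fderiv ℝ mu u

/-- Two 2-forms are variationally equivalent on `U` if their difference is
(holonomic 2-form) + d(holonomic 1-form). -/
def VarEquiv2 (σ σ' : Form2 n k) (U : Set (Jet n k)) : Prop :=
  ∃ (lam : Form2 n k) (mu : Form1 n k),
    Hol2 lam U ∧ Hol1 mu U ∧ ∀ u ∈ U, σ u - σ' u = lam u + extd mu u

/-- The `k`-th order lift `γ^(k)(t) = (t, γ(t), γ'(t), …, γ^(k)(t))` of a curve. -/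
def lift (n k : ℕ) (γ : ℝ → Fin n → ℝ) (t : ℝ) : Jet n k :=
  (t, fun a => iteratedDeriv (a : ℕ) γ t)

/-- The action `I_α(γ; a, b) = ∫_a^b α_{γ^(k)(t)}((γ^(k))'(t)) dt`. -/
def action (α : Form1 n k) (γ : ℝ → Fin n → ℝ) (a b : ℝ) : ℝ :=
  ∫ t in a..b, α (lift n k γ t) (deriv (lift n k γ) t)

/-- A smooth variation of `γ` on `[a,b]` with fixed boundary up to order `k`. -/
structure IsVariation (n k : ℕ) (γ : ℝ → Fin n → ℝ) (a b : ℝ) (F : ℝ → ℝ → Fin n → ℝ) :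
    Prop where
  smooth : ContDiff ℝ (⊤ : ℕ∞) (fun p : ℝ × ℝ => F p.1 p.2)
  init : ∀ t, F t 0 = γ t
  fix_a : ∀ s, lift n k (fun t => F t s) a = lift n k γ a
  fix_b : ∀ s, lift n k (fun t => F t s) b = lift n k γ b

/-- `γ` satisfies the variational principle of `α` (a 1-form on `U`) on the interval `I`. -/
def SatisfiesVP (α : Form1 n k) (U : Set (Jet n k)) (γ : ℝ → Fin n → ℝ) (I : Set ℝ) : Prop :=
  ∀ a b : ℝ, a ≤ b → Set.Icc a b ⊆ I → ∀ F, IsVariation n k γ a b F →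
    (∀ s t, t ∈ Set.Icc a b → lift n k (fun t' => F t' s) t ∈ U) →
    deriv (fun s => action α (fun t => F t s) a b) 0 = 0

/-- Total derivative of a function on the jet space. -/
def tderiv (g : Jet n k → ℝ) : Jet n k → ℝ := fun u => fderiv ℝ g u (dtVF n k u)

/-- The vector field `X_v` associated with `v = (v⁰, vⁱ)`:
`X_v = v⁰ d/dt + Σ_{a=0}^{k} (d/dt)^a (vⁱ − y^i_(1) v⁰) ∂/∂y^i_(a)` (with `y_(k+1) = 0`). -/
def Xv (v0 : Jet n k → ℝ) (vi : Jet n k → Fin n → ℝ) (u : Jet n k) : Jet n k :=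
  v0 u • dtVF n k u +
    ∑ a : Fin (k + 1), ∑ i : Fin n,
      (tderiv^[(a : ℕ)] (fun w => vi w i - w.2 1 i * v0 w) u) • eY n k a i

/-- `X` is a `D`-symmetry on `U`: `[X, Y]` is `D`-valued for every `D`-valued `Y`. -/
def IsDSymm (X : Jet n k → Jet n k) (U : Set (Jet n k)) : Prop :=
  ∀ Y : Jet n k → Jet n k, ContDiffOn ℝ (⊤ : ℕ∞) Y U → (∀ u ∈ U, InD u (Y u)) →
    ∀ u ∈ U, InD u (lie X Y u)

/-- `X` is an infinitesimal symmetry for the action of `α` on `U`: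
it is a `D`-symmetry and `L_X α` is holonomic. -/
def IsSymm (α : Form1 n k) (X : Jet n k → Jet n k) (U : Set (Jet n k)) : Prop :=
  IsDSymm X U ∧ Hol1 (lieD X α) U

/-- `f` is a constant of motion (with domain `W`) for the variational principle of `α`
(with domain `Uα`). -/
def IsConstMot (α : Form1 n k) (Uα W : Set (Jet n k)) (f : Jet n k → ℝ) : Prop :=
  ∀ γ : ℝ → Fin n → ℝ, ContDiff ℝ (⊤ : ℕ∞) γ → ∀ I : Set ℝ, IsOpen I → I.OrdConnected →
    (∀ t ∈ I, lift n k γ t ∈ Uα) → (∀ t ∈ I, lift n k γ t ∈ W) →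
    SatisfiesVP α Uα γ I →
    ∀ t₁ ∈ I, ∀ t₂ ∈ I, f (lift n k γ t₁) = f (lift n k γ t₂)

end Jet

section Helpers
open scoped ContDiff Topology
open MeasureTheory

namespace JetAux

section Generic
variable {X P : Type*} [NormedAddCommGroup X] [NormedSpace ℝ X]
  [NormedAddCommGroup P] [NormedSpace ℝ P]

lemma hasDerivAt_left {f : ℝ × P → X} (hf : ContDiff ℝ ∞ f) (t : ℝ) (c : P) :
    HasDerivAt (fun t => f (t, c)) (fderiv ℝ f (t, c) (1, 0)) t := by
  have h1 : HasFDerivAt f (fderiv ℝ f (t, c)) (t, c) :=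
    (hf.differentiable (by simp) (t, c)).hasFDerivAt
  have h2 : HasDerivAt (fun t : ℝ => (t, c)) ((1 : ℝ), (0 : P)) t :=
    (hasDerivAt_id t).prodMk (hasDerivAt_const t c)
  exact h1.comp_hasDerivAt t h2

lemma hasDerivAt_right {f : ℝ × ℝ → X} (hf : ContDiff ℝ ∞ f) (t s : ℝ) :
    HasDerivAt (fun s => f (t, s)) (fderiv ℝ f (t, s) (0, 1)) s := by
  have h1 : HasFDerivAt f (fderiv ℝ f (t, s)) (t, s) :=
    (hf.differentiable (by simp) (t, s)).hasFDerivAt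
  have h2 : HasDerivAt (fun s : ℝ => (t, s)) ((0 : ℝ), (1 : ℝ)) s :=
    (hasDerivAt_const s t).prodMk (hasDerivAt_id s)
  exact h1.comp_hasDerivAt s h2

lemma contDiff_fderiv_apply {f : P → X} (hf : ContDiff ℝ ∞ f) (v : P) :
    ContDiff ℝ ∞ (fun p => fderiv ℝ f p v) :=
  (hf.fderiv_right (m := ∞) (by simp)).clm_apply contDiff_const

lemma param_deriv {f : ℝ × P → X} (hf : ContDiff ℝ ∞ f) :
    ContDiff ℝ ∞ (fun p : ℝ × P => deriv (fun t => f (t, p.2)) p.1) := by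
  have : (fun p : ℝ × P => deriv (fun t => f (t, p.2)) p.1)
      = fun p => fderiv ℝ f p (1, 0) := by
    funext p
    exact (hasDerivAt_left hf p.1 p.2).deriv
  rw [this]
  exact contDiff_fderiv_apply hf _

lemma param_iter (a : ℕ) : ∀ {f : ℝ × P → X}, ContDiff ℝ ∞ f →
    ContDiff ℝ ∞ (fun p : ℝ × P => iteratedDeriv a (fun t => f (t, p.2)) p.1) := by
  induction a with
  | zero => intro f hf; simpa using hf
  | succ a ih =>
    intro f hf
    simp only [iteratedDeriv_succ']
    exact ih (param_deriv hf)

lemma two_le_smooth : minSmoothness ℝ 2 ≤ (∞ : WithTop ℕ∞) := by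
  rw [minSmoothness_of_isRCLikeNormedField]
  exact WithTop.coe_le_coe.2 (le_top : (2 : ℕ∞) ≤ ⊤)

lemma mixed {f : ℝ × ℝ → X} (hf : ContDiff ℝ ∞ f) (t s : ℝ) :
    deriv (fun s => deriv (fun t => f (t, s)) t) s
      = deriv (fun t => deriv (fun s => f (t, s)) s) t := by
  have e1 : (fun s => deriv (fun t => f (t, s)) t) = fun s => fderiv ℝ f (t, s) (1, 0) := by
    funext s; exact (hasDerivAt_left hf t s).deriv
  have e2 : (fun t => deriv (fun s => f (t, s)) s) = fun t => fderiv ℝ f (t, s) (0, 1) := by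
    funext t; exact (hasDerivAt_right hf t s).deriv
  rw [e1, e2]
  have h1 := (hasDerivAt_right (contDiff_fderiv_apply hf (1, 0)) t s).deriv
  have h2 := (hasDerivAt_left (contDiff_fderiv_apply hf (0, 1)) t s).deriv
  rw [h1, h2]
  have hd : DifferentiableAt ℝ (fderiv ℝ f) (t, s) :=
    (hf.fderiv_right (m := ∞) (by simp)).differentiable (by simp) _
  rw [fderiv_clm_apply hd (differentiableAt_const _),
    fderiv_clm_apply hd (differentiableAt_const _)]
  have hs : IsSymmSndFDerivAt ℝ f (t, s) :=
    hf.contDiffAt.isSymmSndFDerivAt two_le_smooth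
  simpa using hs (0, 1) (1, 0)

lemma comm_iter (a : ℕ) : ∀ {f : ℝ × ℝ → X}, ContDiff ℝ ∞ f → ∀ t s : ℝ,
    deriv (fun s => iteratedDeriv a (fun t => f (t, s)) t) s
      = iteratedDeriv a (fun t => deriv (fun s => f (t, s)) s) t := by
  induction a with
  | zero => intro f hf t s; simp
  | succ a ih =>
    intro f hf t s
    simp only [iteratedDeriv_succ']
    rw [ih (param_deriv hf) t s]
    congr 1
    funext t
    exact mixed hf t s

lemma ibp (B : ℝ → X →L[ℝ] ℝ) (hB : ContDiff ℝ ∞ B) {η : ℝ → X} (hη : ContDiff ℝ ∞ η)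
    {a b : ℝ} (ha : η a = 0) (hb : η b = 0) :
    ∫ t in a..b, B t (deriv η t) = - ∫ t in a..b, deriv B t (η t) := by
  have hdB : ContDiff ℝ ∞ (deriv B) := (contDiff_infty_iff_deriv.1 hB).2
  have hdη : ContDiff ℝ ∞ (deriv η) := (contDiff_infty_iff_deriv.1 hη).2
  have hder : ∀ t, HasDerivAt (fun t => B t (η t)) (deriv B t (η t) + B t (deriv η t)) t := by
    intro t
    exact ((hB.differentiable (by simp) t).hasDerivAt).clm_apply
      ((hη.differentiable (by simp) t).hasDerivAt)
  have c1 : Continuous (fun t => deriv B t (η t)) :=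
    hdB.continuous.clm_apply hη.continuous
  have c2 : Continuous (fun t => B t (deriv η t)) :=
    hB.continuous.clm_apply hdη.continuous
  have := intervalIntegral.integral_eq_sub_of_hasDerivAt (fun t _ => hder t)
    ((c1.add c2).intervalIntegrable a b)
  rw [intervalIntegral.integral_add (c1.intervalIntegrable a b) (c2.intervalIntegrable a b)] at this
  simp only [ha, hb, map_zero, sub_zero] at this
  linarith

lemma contDiff_iter {f : ℝ → X} (hf : ContDiff ℝ ∞ f) (a : ℕ) :
    ContDiff ℝ ∞ (iteratedDeriv a f) := by
  induction a with
  | zero => simpa using hf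
  | succ a ih => rw [iteratedDeriv_succ]; exact (contDiff_infty_iff_deriv.1 ih).2

lemma ibp_iter {η : ℝ → X} (hη : ContDiff ℝ ∞ η) {a b : ℝ} (m : ℕ) :
    ∀ (B : ℝ → X →L[ℝ] ℝ), ContDiff ℝ ∞ B →
    (∀ j < m, iteratedDeriv j η a = 0) → (∀ j < m, iteratedDeriv j η b = 0) →
    ∫ t in a..b, B t (iteratedDeriv m η t)
      = (-1 : ℝ) ^ m * ∫ t in a..b, iteratedDeriv m B t (η t) := by
  induction m with
  | zero => intro B hB _ _; simp
  | succ m ih =>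
    intro B hB ha hb
    have h := ibp B hB (contDiff_iter hη m) (ha m (by simp)) (hb m (by simp))
    rw [iteratedDeriv_succ, h, ih (deriv B) ((contDiff_infty_iff_deriv.1 hB).2)
      (fun j hj => ha j (by omega)) (fun j hj => hb j (by omega)), iteratedDeriv_succ', pow_succ]
    ring

/-- fundamental lemma -/
lemma fund {a b : ℝ} (f : ℝ → ℝ) (hf : Continuous f)
    (h : ∀ g : ℝ → ℝ, ContDiff ℝ ∞ g → tsupport g ⊆ Ioo a b →
      ∫ t in a..b, g t * f t = 0) : ∀ t ∈ Ioo a b, f t = 0 := by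
  have h1 : ∀ᵐ x ∂(volume : Measure ℝ), x ∈ Ioo a b → f x = 0 := by
    refine isOpen_Ioo.ae_eq_zero_of_integral_contDiff_smul_eq_zero
      (hf.locallyIntegrable.locallyIntegrableOn _) ?_
    intro g hg hgc hgs
    rw [← h g hg hgs]
    symm
    refine intervalIntegral.integral_eq_integral_of_support_subset ?_
    refine (Function.support_mul_subset_left g f).trans ?_
    exact (subset_tsupport g).trans (hgs.trans Ioo_subset_Ioc_self)
  have h2 : f =ᵐ[volume.restrict (Ioo a b)] (fun _ => 0) :=
    (ae_restrict_iff' measurableSet_Ioo).2 h1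
  exact Measure.eqOn_open_of_ae_eq h2 isOpen_Ioo hf.continuousOn continuousOn_const

lemma integral_deriv_param {G : ℝ × ℝ → ℝ} (hG : ContDiff ℝ ∞ G) (a b : ℝ) :
    HasDerivAt (fun s => ∫ t in a..b, G (t, s))
      (∫ t in a..b, fderiv ℝ G (t, 0) (0, 1)) 0 := by
  have hc : Continuous (fun p => fderiv ℝ G p (0, 1)) := (contDiff_fderiv_apply hG _).continuous
  obtain ⟨C, hC⟩ := ((isCompact_uIcc (a := a) (b := b)).prod
    (isCompact_Icc (a := (-1 : ℝ)) (b := 1))).exists_bound_of_continuousOn hc.continuousOn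
  refine (intervalIntegral.hasDerivAt_integral_of_dominated_loc_of_deriv_le
    (F := fun s t => G (t, s)) (F' := fun s t => fderiv ℝ G (t, s) (0, 1))
    (bound := fun _ => C) (s := Icc (-1) 1) (Icc_mem_nhds (by norm_num) (by norm_num))
    ?_ ?_ ?_ ?_ ?_ ?_).2
  · refine Eventually.of_forall fun s => Continuous.aestronglyMeasurable ?_
    exact hG.continuous.comp (by fun_prop)
  · refine Continuous.intervalIntegrable ?_ _ _
    exact hG.continuous.comp (by fun_prop)
  · refine Continuous.aestronglyMeasurable ?_
    exact hc.comp (by fun_prop : Continuous fun t : ℝ => (t, (0 : ℝ)))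
  · refine Eventually.of_forall fun t ht s hs => ?_
    exact hC (t, s) ⟨uIoc_subset_uIcc ht, hs⟩
  · exact intervalIntegrable_const
  · refine Eventually.of_forall fun t ht s hs => ?_
    exact hasDerivAt_right hG t s

end Generic

variable {n k : ℕ}

/-- Components of the vertical lift of a variation field. -/
def vlift (n k : ℕ) (η : ℝ → Fin n → ℝ) (t : ℝ) : Jet n k :=
  (0, fun a => iteratedDeriv (a : ℕ) η t)

lemma contDiff_lift_param {P : Type*} [NormedAddCommGroup P] [NormedSpace ℝ P]
    {F : ℝ × P → Fin n → ℝ} (hF : ContDiff ℝ ∞ F) :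
    ContDiff ℝ ∞ (fun p : ℝ × P => Jet.lift n k (fun t => F (t, p.2)) p.1) :=
  contDiff_fst.prodMk (contDiff_pi.2 fun a => param_iter a hF)

lemma contDiff_lift {γ : ℝ → Fin n → ℝ} (hγ : ContDiff ℝ ∞ γ) :
    ContDiff ℝ ∞ (Jet.lift n k γ) :=
  contDiff_id.prodMk (contDiff_pi.2 fun a => contDiff_iter hγ a)

lemma contDiff_vlift {γ : ℝ → Fin n → ℝ} (hγ : ContDiff ℝ ∞ γ) :
    ContDiff ℝ ∞ (vlift n k γ) :=
  contDiff_const.prodMk (contDiff_pi.2 fun a => contDiff_iter hγ a)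

lemma hasDerivAt_iter {X : Type*} [NormedAddCommGroup X] [NormedSpace ℝ X]
    {f : ℝ → X} (hf : ContDiff ℝ ∞ f) (a : ℕ) (t : ℝ) :
    HasDerivAt (iteratedDeriv a f) (iteratedDeriv (a + 1) f t) t := by
  rw [iteratedDeriv_succ]
  exact ((contDiff_iter hf a).differentiable (by simp) t).hasDerivAt

lemma hasDerivAt_lift {γ : ℝ → Fin n → ℝ} (hγ : ContDiff ℝ ∞ γ) (t : ℝ) :
    HasDerivAt (Jet.lift n k γ) (1, fun a => iteratedDeriv ((a : ℕ) + 1) γ t) t :=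
  (hasDerivAt_id t).prodMk (hasDerivAt_pi.2 fun a => hasDerivAt_iter hγ a t)

lemma hasDerivAt_vlift {γ : ℝ → Fin n → ℝ} (hγ : ContDiff ℝ ∞ γ) (t : ℝ) :
    HasDerivAt (vlift n k γ) (0, fun a => iteratedDeriv ((a : ℕ) + 1) γ t) t :=
  (hasDerivAt_const t 0).prodMk (hasDerivAt_pi.2 fun a => hasDerivAt_iter hγ a t)

lemma inD_lift {γ : ℝ → Fin n → ℝ} (hγ : ContDiff ℝ ∞ γ) (t : ℝ) :
    Jet.InD (Jet.lift n k γ t) (deriv (Jet.lift n k γ) t) := by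
  refine ⟨1, iteratedDeriv (k + 1) γ t, ?_⟩
  rw [(hasDerivAt_lift hγ t).deriv]
  refine Prod.ext ?_ ?_
  · simp [Jet.dtVF, Jet.eY, Prod.fst_sum]
  · funext a j
    have : ∀ c : Fin n, (if a = Fin.last k ∧ j = c then (1 : ℝ) else 0)
        = if j = c then (if a = Fin.last k then 1 else 0) else 0 := by
      intro c; by_cases h1 : a = Fin.last k <;> by_cases h2 : j = c <;> simp [h1, h2]
    simp only [Jet.dtVF, Jet.eY, Jet.lift, one_smul, Prod.snd_add, Prod.snd_sum, Pi.add_apply,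
      Finset.sum_apply, Prod.smul_snd, Pi.smul_apply, smul_eq_mul, this]
    by_cases h : a = Fin.last k
    · subst h; simp
    · have h2 : (a : ℕ) < k := by
        have := a.2
        have h3 : (a : ℕ) ≠ k := fun h' => h (Fin.ext (by simpa using h'))
        omega
      simp [h, h2]

lemma lift_add_smul {γ η : ℝ → Fin n → ℝ} (hγ : ContDiff ℝ ∞ γ) (hη : ContDiff ℝ ∞ η) (s : ℝ) :
    Jet.lift n k (fun t => γ t + s • η t)
      = fun t => Jet.lift n k γ t + s • vlift n k η t := by
  funext t
  refine Prod.ext ?_ ?_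
  · simp [Jet.lift, vlift]
  · funext a
    have h := iteratedDeriv_add (n := (a : ℕ)) (x := t)
      ((hγ.of_le (by exact mod_cast le_top)).contDiffAt)
      (((contDiff_const (c := s)).smul hη).of_le (by exact mod_cast le_top)).contDiffAt
    have h2 := iteratedDeriv_const_smul_field (n := (a : ℕ)) (x := t) s η
    simp only [Jet.lift, vlift, Prod.snd_add, Prod.smul_snd, Pi.add_apply, Pi.smul_apply]
    exact h.trans (by rw [← h2]; rfl)

lemma extd_anti (α : Jet.Form1 n k) (u v w : Jet n k) :
    Jet.extd α u v w = - Jet.extd α u w v := by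
  simp [Jet.extd]

lemma first_variation (α : Jet.Form1 n k) (hα : ContDiff ℝ ∞ α) {γ : ℝ → Fin n → ℝ}
    {a b : ℝ} {F : ℝ → ℝ → Fin n → ℝ} (hF : Jet.IsVariation n k γ a b F) :
    HasDerivAt (fun s => Jet.action α (fun t => F t s) a b)
      (∫ t in a..b, Jet.extd α (Jet.lift n k γ t)
        (vlift n k (fun t => deriv (fun s => F t s) 0) t) (deriv (Jet.lift n k γ) t)) 0 := by
  have hFs := hF.smooth
  set Λ : ℝ × ℝ → Jet n k := fun p => Jet.lift n k (fun t => F t p.2) p.1 with hΛdef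
  have hΛ : ContDiff ℝ ∞ Λ := contDiff_lift_param hFs
  set G : ℝ × ℝ → ℝ := fun p => α (Λ p) (fderiv ℝ Λ p (1, 0)) with hG
  set H : ℝ × ℝ → ℝ := fun p => α (Λ p) (fderiv ℝ Λ p (0, 1)) with hH
  have hαΛ : ContDiff ℝ ∞ (fun p => α (Λ p)) := hα.comp hΛ
  have hGs : ContDiff ℝ ∞ G := hαΛ.clm_apply (contDiff_fderiv_apply hΛ _)
  have hHs : ContDiff ℝ ∞ H := hαΛ.clm_apply (contDiff_fderiv_apply hΛ _)
  have hact : (fun s => Jet.action α (fun t => F t s) a b) = fun s => ∫ t in a..b, G (t, s) := by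
    funext s
    simp only [Jet.action, hG]
    congr 1
    funext t
    rw [← (hasDerivAt_left hΛ t s).deriv]
  have hγ0 : (fun t => F t 0) = γ := funext hF.init
  have hΛ0 : ∀ t, Λ (t, 0) = Jet.lift n k γ t := by
    intro t; simp only [hΛdef, hγ0]
  have h10 : ∀ t, fderiv ℝ Λ (t, 0) (1, 0) = deriv (Jet.lift n k γ) t := by
    intro t
    rw [← (hasDerivAt_left hΛ t 0).deriv]
    simp only [hΛ0]
  have h01 : ∀ t, fderiv ℝ Λ (t, 0) (0, 1)
      = vlift n k (fun t => deriv (fun s => F t s) 0) t := by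
    intro t
    refine (hasDerivAt_right hΛ t 0).unique ?_
    refine (hasDerivAt_const (0 : ℝ) t).prodMk (hasDerivAt_pi.2 fun c => ?_)
    rw [← comm_iter (c : ℕ) hFs t 0]
    exact (hasDerivAt_right (param_iter (c : ℕ) hFs) t 0).differentiableAt.hasDerivAt
  have key : ∀ p, fderiv ℝ G p (0, 1) = fderiv ℝ H p (1, 0)
      + Jet.extd α (Λ p) (fderiv ℝ Λ p (0, 1)) (fderiv ℝ Λ p (1, 0)) := by
    intro p
    have d1 : DifferentiableAt ℝ (fun p => α (Λ p)) p := hαΛ.differentiable (by simp) p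
    have d2 : ∀ v, DifferentiableAt ℝ (fun p => fderiv ℝ Λ p v) p := fun v =>
      (contDiff_fderiv_apply hΛ v).differentiable (by simp) p
    have hd : DifferentiableAt ℝ (fderiv ℝ Λ) p :=
      (hΛ.fderiv_right (m := ∞) (by simp)).differentiable (by simp) _
    have hcomp : fderiv ℝ (fun p => α (Λ p)) p = (fderiv ℝ α (Λ p)).comp (fderiv ℝ Λ p) :=
      fderiv_comp p (hα.differentiable (by simp) _) (hΛ.differentiable (by simp) _)
    have hs : IsSymmSndFDerivAt ℝ Λ p :=
      hΛ.contDiffAt.isSymmSndFDerivAt two_le_smooth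
    have hs' := hs (0, 1) (1, 0)
    rw [hG, hH, fderiv_clm_apply d1 (d2 _), fderiv_clm_apply d1 (d2 _), hcomp,
      fderiv_clm_apply hd (differentiableAt_const _),
      fderiv_clm_apply hd (differentiableAt_const _)]
    simp [Jet.extd, hs']
  have hder := integral_deriv_param hGs a b
  rw [hact]
  convert hder using 1
  simp only [key, h10, h01, hΛ0]
  have c2 : Continuous (fun t => Jet.extd α (Jet.lift n k γ t)
        (vlift n k (fun t => deriv (fun s => F t s) 0) t) (deriv (Jet.lift n k γ) t)) := by
    have hcont : Continuous (fun p => fderiv ℝ G p (0, 1) - fderiv ℝ H p (1, 0)) :=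
      ((contDiff_fderiv_apply hGs _).sub (contDiff_fderiv_apply hHs _)).continuous
    have := hcont.comp (by fun_prop : Continuous fun t : ℝ => (t, (0 : ℝ)))
    convert this using 1
    funext t
    simp only [Function.comp, key, h10, h01, hΛ0]
    ring
  have c1 : Continuous (fun t : ℝ => fderiv ℝ H (t, 0) (1, 0)) :=
    (contDiff_fderiv_apply hHs _).continuous.comp
      (by fun_prop : Continuous fun t : ℝ => (t, (0 : ℝ)))
  rw [intervalIntegral.integral_add (c1.intervalIntegrable a b) (c2.intervalIntegrable a b)]
  have hFTC := intervalIntegral.integral_eq_sub_of_hasDerivAt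
    (fun t _ => hasDerivAt_left hHs t 0) (c1.intervalIntegrable a b)
  have za : fderiv ℝ Λ (a, 0) (0, 1) = 0 := by
    refine (hasDerivAt_right hΛ a 0).unique ?_
    have : (fun s => Λ (a, s)) = fun _ => Jet.lift n k γ a := funext hF.fix_a
    rw [this]; exact hasDerivAt_const _ _
  have zb : fderiv ℝ Λ (b, 0) (0, 1) = 0 := by
    refine (hasDerivAt_right hΛ b 0).unique ?_
    have : (fun s => Λ (b, s)) = fun _ => Jet.lift n k γ b := funext hF.fix_b
    rw [this]; exact hasDerivAt_const _ _
  rw [hFTC]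
  simp [hH, za, zb]

lemma vlift_variation_zero {γ : ℝ → Fin n → ℝ}
    {a b : ℝ} {F : ℝ → ℝ → Fin n → ℝ} (hF : Jet.IsVariation n k γ a b F) (c : ℕ) (hc : c ≤ k) :
    iteratedDeriv c (fun t => deriv (fun s => F t s) 0) a = 0 ∧
    iteratedDeriv c (fun t => deriv (fun s => F t s) 0) b = 0 := by
  have hFs := hF.smooth
  rw [← comm_iter c hFs a 0, ← comm_iter c hFs b 0]
  have e1 : ∀ s, iteratedDeriv c (fun t => F t s) a = iteratedDeriv c γ a := fun s =>
    congrFun (congrArg Prod.snd (hF.fix_a s)) ⟨c, by omega⟩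
  have e2 : ∀ s, iteratedDeriv c (fun t => F t s) b = iteratedDeriv c γ b := fun s =>
    congrFun (congrArg Prod.snd (hF.fix_b s)) ⟨c, by omega⟩
  simp only [e1, e2, deriv_const, and_self]

/-- The vertical inclusion at level `a`. -/
def inc (n k : ℕ) (a : Fin (k + 1)) : (Fin n → ℝ) →L[ℝ] Jet n k :=
  (ContinuousLinearMap.inr ℝ ℝ (Fin (k + 1) → Fin n → ℝ)).comp
    (ContinuousLinearMap.single ℝ (fun _ : Fin (k + 1) => Fin n → ℝ) a)

lemma vlift_eq_sum (η : ℝ → Fin n → ℝ) (t : ℝ) :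
    vlift n k η t = ∑ a : Fin (k + 1), inc n k a (iteratedDeriv (a : ℕ) η t) := by
  refine Prod.ext ?_ ?_
  · simp [vlift, inc, Prod.fst_sum]
  · funext b
    simp [vlift, inc, Prod.snd_sum, Finset.sum_apply, Pi.single_apply]

/-- Coefficients of the linearised form along a curve. -/
def coef (β : Jet.Form2 n k) (a : Fin (k + 1)) (γ : ℝ → Fin n → ℝ) (t : ℝ) :
    (Fin n → ℝ) →L[ℝ] ℝ :=
  (β (Jet.lift n k γ t) (deriv (Jet.lift n k γ) t)).comp (inc n k a)

/-- Euler operator along a curve. -/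
def euler (β : Jet.Form2 n k) (γ : ℝ → Fin n → ℝ) (t : ℝ) : (Fin n → ℝ) →L[ℝ] ℝ :=
  ∑ a : Fin (k + 1), (-1 : ℝ) ^ (a : ℕ) • iteratedDeriv (a : ℕ) (coef β a γ) t

lemma contDiff_coef_param {P : Type*} [NormedAddCommGroup P] [NormedSpace ℝ P]
    {β : Jet.Form2 n k} (hβ : ContDiff ℝ ∞ β) (a : Fin (k + 1))
    {F : ℝ × P → Fin n → ℝ} (hF : ContDiff ℝ ∞ F) :
    ContDiff ℝ ∞ (fun p : ℝ × P => coef β a (fun t => F (t, p.2)) p.1) := by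
  have h1 := contDiff_lift_param (k := k) hF
  have h2 := param_deriv h1
  exact ((hβ.comp h1).clm_apply h2).clm_comp contDiff_const

lemma contDiff_euler_param {P : Type*} [NormedAddCommGroup P] [NormedSpace ℝ P]
    {β : Jet.Form2 n k} (hβ : ContDiff ℝ ∞ β)
    {F : ℝ × P → Fin n → ℝ} (hF : ContDiff ℝ ∞ F) :
    ContDiff ℝ ∞ (fun p : ℝ × P => euler β (fun t => F (t, p.2)) p.1) := by
  unfold euler
  refine ContDiff.sum fun a _ => contDiff_const.fun_smul ?_
  exact param_iter (a : ℕ) (contDiff_coef_param hβ a hF)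

lemma contDiff_coef {β : Jet.Form2 n k} (hβ : ContDiff ℝ ∞ β) (a : Fin (k + 1))
    {γ : ℝ → Fin n → ℝ} (hγ : ContDiff ℝ ∞ γ) : ContDiff ℝ ∞ (coef β a γ) := by
  have h := contDiff_coef_param hβ a (F := fun p : ℝ × ℝ => γ p.1) (hγ.comp contDiff_fst)
  exact h.comp (contDiff_id.prodMk (contDiff_const (c := (0 : ℝ))))

lemma contDiff_euler {β : Jet.Form2 n k} (hβ : ContDiff ℝ ∞ β)
    {γ : ℝ → Fin n → ℝ} (hγ : ContDiff ℝ ∞ γ) : ContDiff ℝ ∞ (euler β γ) := by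
  have h := contDiff_euler_param hβ (F := fun p : ℝ × ℝ => γ p.1) (hγ.comp contDiff_fst)
  exact h.comp (contDiff_id.prodMk (contDiff_const (c := (0 : ℝ))))

lemma euler_ibp {β : Jet.Form2 n k} (hβ : ContDiff ℝ ∞ β)
    {γ : ℝ → Fin n → ℝ} (hγ : ContDiff ℝ ∞ γ) {η : ℝ → Fin n → ℝ} (hη : ContDiff ℝ ∞ η)
    {a b : ℝ} (ha : ∀ j ≤ k, iteratedDeriv j η a = 0) (hb : ∀ j ≤ k, iteratedDeriv j η b = 0) :
    ∫ t in a..b, β (Jet.lift n k γ t) (deriv (Jet.lift n k γ) t) (vlift n k η t)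
      = ∫ t in a..b, euler β γ t (η t) := by
  have h1 : ∀ t, β (Jet.lift n k γ t) (deriv (Jet.lift n k γ) t) (vlift n k η t)
      = ∑ c : Fin (k + 1), coef β c γ t (iteratedDeriv (c : ℕ) η t) := by
    intro t; rw [vlift_eq_sum, map_sum]; rfl
  simp only [h1]
  rw [intervalIntegral.integral_finsetSum]
  swap
  · intro c _
    exact ((contDiff_coef hβ c hγ).continuous.clm_apply
      (contDiff_iter hη c).continuous).intervalIntegrable _ _
  have h2 : ∀ t, euler β γ t (η t)
      = ∑ c : Fin (k + 1), (-1 : ℝ) ^ (c : ℕ) * iteratedDeriv (c : ℕ) (coef β c γ) t (η t) := by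
    intro t; simp [euler]
  simp only [h2]
  rw [intervalIntegral.integral_finsetSum]
  swap
  · intro c _
    exact (continuous_const.mul ((contDiff_iter (contDiff_coef hβ c hγ) c).continuous.clm_apply
      hη.continuous)).intervalIntegrable _ _
  refine Finset.sum_congr rfl fun c _ => ?_
  rw [ibp_iter hη (c : ℕ) _ (contDiff_coef hβ c hγ) (fun j hj => ha j (by omega))
    (fun j hj => hb j (by omega)), intervalIntegral.integral_const_mul]

lemma iter_zero_of_support {X : Type*} [NormedAddCommGroup X] [NormedSpace ℝ X]
    {η : ℝ → X} {a b c : ℝ} (h : tsupport η ⊆ Ioo a b) (hc : c ∉ Ioo a b) (j : ℕ) :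
    iteratedDeriv j η c = 0 := by
  have h1 : η =ᶠ[𝓝 c] (0 : ℝ → X) :=
    notMem_tsupport_iff_eventuallyEq.1 (fun h' => hc (h h'))
  rw [h1.iteratedDeriv_eq j]
  simp

lemma pairing {E : Type*} [NormedAddCommGroup E] [NormedSpace ℝ E] {mu : E → E →L[ℝ] ℝ}
    {x v x' v' : E} (hd : DifferentiableAt ℝ mu x)
    (hz : ∀ s : ℝ, mu (x + s • v) (x' + s • v') = 0) :
    fderiv ℝ mu x v x' + mu x v' = 0 := by
  have hline : ∀ x v : E, HasDerivAt (fun s : ℝ => x + s • v) v 0 := by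
    intro x v
    simpa using ((hasDerivAt_id (0 : ℝ)).smul_const v).const_add x
  have hm' : HasFDerivAt mu (fderiv ℝ mu x) (x + (0 : ℝ) • v) := by
    simpa using hd.hasFDerivAt
  have h1 : HasDerivAt (fun s : ℝ => mu (x + s • v)) (fderiv ℝ mu x v) 0 :=
    hm'.comp_hasDerivAt (0 : ℝ) (hline x v)
  have h2 := h1.clm_apply (hline x' v')
  have h3 : HasDerivAt (fun s : ℝ => mu (x + s • v) (x' + s • v')) 0 0 := by
    simp only [hz]; exact hasDerivAt_const _ _
  have h4 := h2.unique h3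
  simpa using h4

/-- local vanishing where the holonomic potential is differentiable -/
lemma local_int {β : Jet.Form2 n k} (hβ : ContDiff ℝ ∞ β) {mu : Jet.Form1 n k}
    (hmu : Jet.Hol1 mu Set.univ)
    {γ : ℝ → Fin n → ℝ} (hγ : ContDiff ℝ ∞ γ) {η : ℝ → Fin n → ℝ} (hη : ContDiff ℝ ∞ η)
    {a b : ℝ} (hab : a ≤ b)
    (ha : ∀ j ≤ k, iteratedDeriv j η a = 0) (hb : ∀ j ≤ k, iteratedDeriv j η b = 0)
    (hd : ∀ t ∈ Icc a b, DifferentiableAt ℝ mu (Jet.lift n k γ t))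
    (heq : ∀ t ∈ Icc a b, ∀ v w, Jet.InD (Jet.lift n k γ t) v →
      β (Jet.lift n k γ t) v w = Jet.extd mu (Jet.lift n k γ t) v w) :
    ∫ t in a..b, β (Jet.lift n k γ t) (deriv (Jet.lift n k γ) t) (vlift n k η t) = 0 := by
  have hL := contDiff_lift (k := k) hγ
  have hV := contDiff_vlift (k := k) hη
  have hder : ∀ t ∈ uIcc a b, HasDerivAt (fun t => mu (Jet.lift n k γ t) (vlift n k η t))
      (β (Jet.lift n k γ t) (deriv (Jet.lift n k γ) t) (vlift n k η t)) t := by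
    intro t ht
    rw [uIcc_of_le hab] at ht
    have hLt : HasDerivAt (Jet.lift n k γ) (deriv (Jet.lift n k γ) t) t :=
      (hL.differentiable (by simp) t).hasDerivAt
    have hVt : HasDerivAt (vlift n k η) (deriv (vlift n k η) t) t :=
      (hV.differentiable (by simp) t).hasDerivAt
    have hm := (hd t ht).hasFDerivAt
    have h0 : HasDerivAt (fun t => mu (Jet.lift n k γ t))
        (fderiv ℝ mu (Jet.lift n k γ t) (deriv (Jet.lift n k γ) t)) t :=
      hm.comp_hasDerivAt t hLt
    have h1 := h0.clm_apply hVt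
    -- derivative in the variation parameter
    have hz : ∀ s : ℝ, mu (Jet.lift n k γ t + s • vlift n k η t)
        (deriv (Jet.lift n k γ) t + s • deriv (vlift n k η) t) = 0 := by
      intro s
      have hc : ContDiff ℝ ∞ (fun t => γ t + s • η t) := hγ.add (contDiff_const.fun_smul hη)
      have := inD_lift (k := k) hc t
      rw [lift_add_smul hγ hη s] at this
      have hdd : deriv (fun t => Jet.lift n k γ t + s • vlift n k η t) t
          = deriv (Jet.lift n k γ) t + s • deriv (vlift n k η) t :=
        (hLt.add (hVt.const_smul s)).deriv
      rw [hdd] at this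
      exact hmu _ (mem_univ _) _ this
    have h4 := pairing (hd t ht) hz
    rw [heq t ht _ _ (inD_lift hγ t)]
    have e : ∀ v w, Jet.extd mu (Jet.lift n k γ t) v w
        = fderiv ℝ mu (Jet.lift n k γ t) v w - fderiv ℝ mu (Jet.lift n k γ t) w v := by
      intro v w; simp [Jet.extd]
    have e2 : Jet.extd mu (Jet.lift n k γ t) (deriv (Jet.lift n k γ) t) (vlift n k η t)
        = fderiv ℝ mu (Jet.lift n k γ t) (deriv (Jet.lift n k γ) t) (vlift n k η t)
          + mu (Jet.lift n k γ t) (deriv (vlift n k η) t) := by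
      rw [e]
      linarith
    rw [e2]
    exact h1
  have hcont : Continuous
      (fun t => β (Jet.lift n k γ t) (deriv (Jet.lift n k γ) t) (vlift n k η t)) :=
    (((hβ.comp hL).clm_apply ((contDiff_infty_iff_deriv.1 hL).2)).clm_apply hV).continuous
  rw [intervalIntegral.integral_eq_sub_of_hasDerivAt hder (hcont.intervalIntegrable _ _)]
  have za : vlift n k η a = 0 := Prod.ext rfl (funext fun c => ha c (by omega))
  have zb : vlift n k η b = 0 := Prod.ext rfl (funext fun c => hb c (by omega))
  simp [za, zb]

/-- the perturbed curve through the jet `u` -/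
def pert (γ : ℝ → Fin n → ℝ) (u : Jet n k) (τ : ℝ) : Fin n → ℝ :=
  γ τ + ∑ a : Fin (k + 1), (((a : ℕ).factorial : ℝ)⁻¹ * (τ - u.1) ^ (a : ℕ)) •
    (u.2 a - iteratedDeriv (a : ℕ) γ u.1)

lemma contDiff_pert {γ : ℝ → Fin n → ℝ} (hγ : ContDiff ℝ ∞ γ) :
    ContDiff ℝ ∞ (fun p : ℝ × Jet n k => pert γ p.2 p.1) := by
  unfold pert
  refine (hγ.comp contDiff_fst).add (ContDiff.sum fun a _ => ContDiff.fun_smul ?_ (ContDiff.sub ?_ ?_))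
  · fun_prop
  · fun_prop
  · exact (contDiff_iter hγ a).comp (by fun_prop)

lemma pert_lift (γ : ℝ → Fin n → ℝ) (t : ℝ) : pert γ (Jet.lift n k γ t) = γ := by
  funext τ; simp [pert, Jet.lift]

lemma lift_pert {γ : ℝ → Fin n → ℝ} (hγ : ContDiff ℝ ∞ γ) (u : Jet n k) :
    Jet.lift n k (pert γ u) u.1 = u := by
  refine Prod.ext rfl ?_
  funext b
  have hp : ∀ a : Fin (k + 1), ContDiff ℝ ∞ (fun τ : ℝ =>
      (((a : ℕ).factorial : ℝ)⁻¹ * (τ - u.1) ^ (a : ℕ)) •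
        (u.2 a - iteratedDeriv (a : ℕ) γ u.1)) := by
    intro a; fun_prop
  have hle : ((b : ℕ) : WithTop ℕ∞) ≤ ∞ := by exact mod_cast le_top
  have h1 := iteratedDeriv_add (n := (b : ℕ)) (x := u.1) ((hγ.of_le hle).contDiffAt)
    (((ContDiff.sum (s := Finset.univ) fun a _ => hp a).of_le hle).contDiffAt)
  have h2 := iteratedDeriv_fun_sum (n := (b : ℕ)) (x := u.1) (I := Finset.univ)
    (fun a _ => ((hp a).of_le hle).contDiffAt)
  have h3 : ∀ a : Fin (k + 1), iteratedDeriv (b : ℕ) (fun τ : ℝ =>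
      (((a : ℕ).factorial : ℝ)⁻¹ * (τ - u.1) ^ (a : ℕ)) •
        (u.2 a - iteratedDeriv (a : ℕ) γ u.1)) u.1
      = if a = b then (u.2 a - iteratedDeriv (a : ℕ) γ u.1) else 0 := by
    intro a
    have e := iteratedDeriv_comp_sub_const (n := (b : ℕ)) (f := fun τ : ℝ =>
      (((a : ℕ).factorial : ℝ)⁻¹ * τ ^ (a : ℕ)) •
        (u.2 a - iteratedDeriv (a : ℕ) γ u.1)) u.1
    have e' := congrFun e u.1
    have e2 : iteratedDeriv (b : ℕ) (fun τ : ℝ => (((a : ℕ).factorial : ℝ)⁻¹ * τ ^ (a : ℕ)) •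
        (u.2 a - iteratedDeriv (a : ℕ) γ u.1)) 0
        = (iteratedDeriv (b : ℕ) (fun τ : ℝ => ((a : ℕ).factorial : ℝ)⁻¹ * τ ^ (a : ℕ)) 0) •
          (u.2 a - iteratedDeriv (a : ℕ) γ u.1) :=
      iteratedDeriv_smul_const (ContDiff.contDiffAt (by fun_prop)) _
    have e3 : iteratedDeriv (b : ℕ) (fun τ : ℝ => ((a : ℕ).factorial : ℝ)⁻¹ * τ ^ (a : ℕ)) 0
        = ((a : ℕ).factorial : ℝ)⁻¹ * iteratedDeriv (b : ℕ) (fun τ : ℝ => τ ^ (a : ℕ)) 0 :=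
      iteratedDeriv_const_smul_field (n := (b : ℕ)) (x := (0 : ℝ)) ((a : ℕ).factorial : ℝ)⁻¹
        (fun τ : ℝ => τ ^ (a : ℕ))
    refine e'.trans ?_
    rw [sub_self, e2, e3, iteratedDeriv_fun_pow_zero]
    by_cases hab : a = b
    · subst hab
      simp [Nat.factorial_ne_zero]
    · have : (b : ℕ) ≠ (a : ℕ) := fun h => hab (Fin.ext h.symm)
      simp [hab, this]
  have h4 : iteratedDeriv (b : ℕ) (pert γ u) u.1 = iteratedDeriv (b : ℕ) γ u.1 +
      ∑ a : Fin (k + 1), (if a = b then (u.2 a - iteratedDeriv (a : ℕ) γ u.1) else 0) := by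
    refine h1.trans ?_
    rw [h2]
    simp only [h3]
  change iteratedDeriv (b : ℕ) (pert γ u) u.1 = u.2 b
  rw [h4]
  simp

/-- Points where `β` is not holonomic. -/
def badSet (β : Jet.Form2 n k) : Set (Jet n k) := {u | ∃ v, Jet.InD u v ∧ β u v ≠ 0}

lemma isOpen_badSet {β : Jet.Form2 n k} (hβ : ContDiff ℝ ∞ β) : IsOpen (badSet β) := by
  have hdt : Continuous (Jet.dtVF n k) := by
    unfold Jet.dtVF
    refine continuous_const.prodMk (continuous_pi fun a => continuous_pi fun i => ?_)
    by_cases h : (a : ℕ) + 1 < k + 1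
    · simp only [h, dif_pos]; fun_prop
    · simp only [h, dif_neg, not_false_eq_true]; fun_prop
  have : badSet β = ⋃ (c : ℝ) (w : Fin n → ℝ),
      {u | β u (c • Jet.dtVF n k u + ∑ i, w i • Jet.eY n k (Fin.last k) i) ≠ 0} := by
    ext u
    simp only [badSet, Jet.InD, mem_ofPred_eq, mem_iUnion]
    constructor
    · rintro ⟨v, ⟨c, w, rfl⟩, h⟩
      exact ⟨c, w, h⟩
    · rintro ⟨c, w, h⟩
      exact ⟨_, ⟨c, w, rfl⟩, h⟩
  rw [this]
  refine isOpen_iUnion fun c => isOpen_iUnion fun w => ?_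
  refine isOpen_ne_fun ?_ continuous_const
  have hc : Continuous (fun u => c • Jet.dtVF n k u
      + ∑ i, w i • Jet.eY n k (Fin.last k) i) := by fun_prop
  exact hβ.continuous.clm_apply hc

lemma euler_zero_local {β : Jet.Form2 n k} (hβ : ContDiff ℝ ∞ β) {mu : Jet.Form1 n k}
    (hmu : Jet.Hol1 mu Set.univ)
    (heq : ∀ u v w, Jet.InD u v → β u v w = Jet.extd mu u v w)
    {γ : ℝ → Fin n → ℝ} (hγ : ContDiff ℝ ∞ γ) (t₀ : ℝ)
    (h : (∀ᶠ t in 𝓝 t₀, Jet.lift n k γ t ∈ badSet β) ∨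
      (∀ᶠ t in 𝓝 t₀, Jet.lift n k γ t ∉ badSet β)) : euler β γ t₀ = 0 := by
  have hdiff : ∀ u ∈ badSet β, DifferentiableAt ℝ mu u := by
    rintro u ⟨v, hv, hne⟩
    by_contra hnd
    apply hne
    refine ContinuousLinearMap.ext fun w => ?_
    rw [heq u v w hv]
    simp [Jet.extd, fderiv_zero_of_not_differentiableAt hnd]
  have main : ∃ ε > 0, ∀ η : ℝ → Fin n → ℝ, ContDiff ℝ ∞ η →
      tsupport η ⊆ Ioo (t₀ - ε) (t₀ + ε) →
      ∫ t in (t₀ - ε)..(t₀ + ε),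
        β (Jet.lift n k γ t) (deriv (Jet.lift n k γ) t) (vlift n k η t) = 0 := by
    have hIcc : ∀ δ : ℝ, 0 < δ → ∀ t ∈ Icc (t₀ - δ / 2) (t₀ + δ / 2), dist t t₀ < δ := by
      intro δ hδ t ht
      rw [Real.dist_eq, abs_lt]
      constructor <;> linarith [ht.1, ht.2]
    rcases h with h | h
    · obtain ⟨δ, hδ, hb⟩ := Metric.eventually_nhds_iff.1 h
      refine ⟨δ / 2, by positivity, fun η hη hs => ?_⟩
      refine local_int hβ hmu hγ hη (by linarith)
        (fun j _ => iter_zero_of_support hs (by simp) j)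
        (fun j _ => iter_zero_of_support hs (by simp) j) ?_ ?_
      · intro t ht
        exact hdiff _ (hb (hIcc δ hδ t ht))
      · intro t _ v w hv
        exact heq _ v w hv
    · obtain ⟨δ, hδ, hb⟩ := Metric.eventually_nhds_iff.1 h
      refine ⟨δ / 2, by positivity, fun η hη hs => ?_⟩
      rw [← intervalIntegral.integral_zero (a := t₀ - δ / 2) (b := t₀ + δ / 2) (E := ℝ)]
      refine intervalIntegral.integral_congr fun t ht => ?_
      rw [uIcc_of_le (by linarith)] at ht
      have h1 := hb (hIcc δ hδ t ht)
      have h2 : β (Jet.lift n k γ t) (deriv (Jet.lift n k γ) t) = 0 := by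
        by_contra hne
        exact h1 ⟨_, inD_lift hγ t, hne⟩
      simp [h2]
  obtain ⟨ε, hε, hint⟩ := main
  refine ContinuousLinearMap.ext fun v => ?_
  have hcont : Continuous (fun t => euler β γ t v) :=
    (contDiff_euler hβ hγ).continuous.clm_apply continuous_const
  refine fund (a := t₀ - ε) (b := t₀ + ε) _ hcont ?_ t₀ ⟨by linarith, by linarith⟩
  intro g hg hgs
  have hη : ContDiff ℝ ∞ (fun t => g t • v) := hg.fun_smul contDiff_const
  have hs : tsupport (fun t => g t • v) ⊆ Ioo (t₀ - ε) (t₀ + ε) :=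
    (closure_mono (Function.support_smul_subset_left g (fun _ => v))).trans hgs
  have h1 := hint _ hη hs
  rw [euler_ibp hβ hγ hη (fun j _ => iter_zero_of_support hs (by simp) j)
        (fun j _ => iter_zero_of_support hs (by simp) j)] at h1
  simpa using h1

lemma euler_zero {β : Jet.Form2 n k} (hβ : ContDiff ℝ ∞ β) {mu : Jet.Form1 n k}
    (hmu : Jet.Hol1 mu Set.univ)
    (heq : ∀ u v w, Jet.InD u v → β u v w = Jet.extd mu u v w)
    {γ : ℝ → Fin n → ℝ} (hγ : ContDiff ℝ ∞ γ) (t₀ : ℝ) : euler β γ t₀ = 0 := by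
  have hc1 : Continuous (fun p : ℝ × Jet n k => euler β (pert γ p.2) p.1) :=
    (contDiff_euler_param hβ (F := fun p : ℝ × Jet n k => pert γ p.2 p.1)
      (contDiff_pert (k := k) hγ)).continuous
  have hc2 : Continuous fun u : Jet n k => ((u.1, u) : ℝ × Jet n k) := by fun_prop
  have hcont : Continuous (fun u : Jet n k => euler β (pert γ u) u.1) := by
    have h3 := hc1.comp hc2
    simpa only [Function.comp_def] using h3
  have hopen := isOpen_badSet hβ
  have hdense : Dense (badSet β ∪ interior (badSet β)ᶜ) := by
    rw [interior_compl]
    intro u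
    by_cases hu : u ∈ closure (badSet β)
    · exact closure_mono subset_union_left hu
    · exact subset_closure (Or.inr hu)
  have hps : ∀ u : Jet n k, ContDiff ℝ ∞ (pert γ u) := fun u =>
    (contDiff_pert (k := k) hγ).comp (contDiff_id.prodMk contDiff_const)
  have hz : EqOn (fun u : Jet n k => euler β (pert γ u) u.1) (fun _ => 0)
      (badSet β ∪ interior (badSet β)ᶜ) := by
    intro u hu
    have hct : ContinuousAt (Jet.lift n k (pert γ u)) u.1 :=
      (contDiff_lift (hps u)).continuous.continuousAt
    refine euler_zero_local hβ hmu heq (hps u) u.1 ?_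
    rcases hu with hu | hu
    · left
      refine hct.eventually_mem (hopen.mem_nhds ?_)
      rw [lift_pert hγ]; exact hu
    · right
      have : ∀ᶠ t in 𝓝 u.1, Jet.lift n k (pert γ u) t ∈ interior (badSet β)ᶜ := by
        refine hct.eventually_mem (isOpen_interior.mem_nhds ?_)
        rw [lift_pert hγ]; exact hu
      exact this.mono fun t ht => interior_subset ht
  have hall := Continuous.ext_on hdense hcont continuous_const hz
  have := congrFun hall (Jet.lift n k γ t₀)
  simpa [pert_lift, Jet.lift] using (by simpa only [pert_lift] using this :
    euler β γ (Jet.lift n k γ t₀).1 = 0)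

theorem main (α : Jet.Form1 n k) (hα : ContDiff ℝ ∞ α)
    (σ : Jet.Form2 n k) (hσ : ContDiff ℝ ∞ σ)
    (hsrc : Jet.SourceForm σ Set.univ)
    (hclass : ∃ (lam : Jet.Form2 n k) (mu : Jet.Form1 n k),
      Jet.Hol2 lam Set.univ ∧ Jet.Hol1 mu Set.univ ∧
      ∀ u : Jet n k, Jet.extd α u - σ u = lam u + Jet.extd mu u)
    (γ : ℝ → Fin n → ℝ) (hγ : ContDiff ℝ ∞ γ)
    (I : Set ℝ) (hIo : IsOpen I) :
    Jet.SatisfiesVP α Set.univ γ I ↔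
      ∀ t ∈ I, σ (Jet.lift n k γ t) (deriv (Jet.lift n k γ) t) = 0 := by
  obtain ⟨lam, mu, hlam, hmu, hE⟩ := hclass
  have hL := contDiff_lift (k := k) hγ
  have hL' : ContDiff ℝ ∞ (deriv (Jet.lift n k γ)) := (contDiff_infty_iff_deriv.1 hL).2
  set β : Jet.Form2 n k := fun u => Jet.extd α u - σ u with hβdef
  have hβ : ContDiff ℝ ∞ β := by
    have hd : ContDiff ℝ ∞ (fderiv ℝ α) := hα.fderiv_right (m := ∞) (by simp)
    have hfl : ContDiff ℝ ∞ (fun u => (fderiv ℝ α u).flip) :=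
      contDiff_clm_apply_iff.2 fun v => contDiff_clm_apply_iff.2 fun w =>
        (hd.clm_apply (contDiff_const (c := w))).clm_apply (contDiff_const (c := v))
    exact (hd.sub hfl).sub hσ
  have heq : ∀ u v w, Jet.InD u v → β u v w = Jet.extd mu u v w := by
    intro u v w hv
    have h1 : β u = lam u + Jet.extd mu u := hE u
    have h2 := hlam u (mem_univ _) v hv
    rw [h1]
    simp [h2]
  have hEul := fun t => euler_zero hβ hmu heq hγ t
  -- the first variation
  have hfv : ∀ a b F, Jet.IsVariation n k γ a b F →
      deriv (fun s => Jet.action α (fun t => F t s) a b) 0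
        = - ∫ t in a..b, σ (Jet.lift n k γ t) (deriv (Jet.lift n k γ) t)
          (vlift n k (fun t => deriv (fun s => F t s) 0) t) := by
    intro a b F hF
    rw [(first_variation α hα hF).deriv]
    set η : ℝ → Fin n → ℝ := fun t => deriv (fun s => F t s) 0 with hηdef
    have hη : ContDiff ℝ ∞ η := by
      have h := contDiff_fderiv_apply hF.smooth (0, 1)
      have h2 := h.comp (contDiff_id.prodMk (contDiff_const (c := (0 : ℝ))))
      convert h2 using 1
      funext t
      exact (hasDerivAt_right hF.smooth t 0).deriv
    have hV := contDiff_vlift (k := k) hη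
    have hib := euler_ibp hβ hγ hη (fun j hj => (vlift_variation_zero hF j hj).1)
      (fun j hj => (vlift_variation_zero hF j hj).2)
    simp only [hEul, zero_apply, intervalIntegral.integral_zero] at hib
    have cσ : Continuous fun t => σ (Jet.lift n k γ t) (deriv (Jet.lift n k γ) t)
        (vlift n k η t) := (((hσ.comp hL).clm_apply hL').clm_apply hV).continuous
    have cβ : Continuous fun t => β (Jet.lift n k γ t) (deriv (Jet.lift n k γ) t)
        (vlift n k η t) := (((hβ.comp hL).clm_apply hL').clm_apply hV).continuous
    have hpt : ∀ t, Jet.extd α (Jet.lift n k γ t) (vlift n k η t) (deriv (Jet.lift n k γ) t)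
        = - (β (Jet.lift n k γ t) (deriv (Jet.lift n k γ) t) (vlift n k η t)
          + σ (Jet.lift n k γ t) (deriv (Jet.lift n k γ) t) (vlift n k η t)) := by
      intro t
      rw [extd_anti]
      simp [hβdef]
    simp only [hpt]
    rw [intervalIntegral.integral_neg, intervalIntegral.integral_add
      (cβ.intervalIntegrable _ _) (cσ.intervalIntegrable _ _), hib, zero_add]
  constructor
  · intro hVP t₀ ht₀
    obtain ⟨δ, hδ, hb⟩ := Metric.isOpen_iff.1 hIo t₀ ht₀
    have hsub : Icc (t₀ - δ / 2) (t₀ + δ / 2) ⊆ I := by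
      intro t ht
      apply hb
      rw [Metric.mem_ball, Real.dist_eq, abs_lt]
      constructor <;> linarith [ht.1, ht.2]
    have hfst : (deriv (Jet.lift n k γ) t₀).1 = 1 := by rw [(hasDerivAt_lift hγ t₀).deriv]
    have hinc : ∀ v, σ (Jet.lift n k γ t₀) (deriv (Jet.lift n k γ) t₀) (inc n k 0 v) = 0 := by
      intro v
      have hcont : Continuous (fun t => σ (Jet.lift n k γ t) (deriv (Jet.lift n k γ) t)
          (inc n k 0 v)) :=
        (((hσ.comp hL).clm_apply hL').clm_apply contDiff_const).continuous
      refine fund (a := t₀ - δ / 2) (b := t₀ + δ / 2) _ hcont ?_ t₀ ⟨by linarith, by linarith⟩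
      intro g hg hgs
      set η : ℝ → Fin n → ℝ := fun t => g t • v with hηdef
      have hη : ContDiff ℝ ∞ η := hg.fun_smul contDiff_const
      have hs : tsupport η ⊆ Ioo (t₀ - δ / 2) (t₀ + δ / 2) :=
        (closure_mono (Function.support_smul_subset_left g (fun _ => v))).trans hgs
      have hz : ∀ c, c ∉ Ioo (t₀ - δ / 2) (t₀ + δ / 2) → vlift n k η c = 0 := fun c hc =>
        Prod.ext rfl (funext fun j => iter_zero_of_support hs hc j)
      have hF : Jet.IsVariation n k γ (t₀ - δ / 2) (t₀ + δ / 2) (fun t s => γ t + s • η t) := by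
        refine ⟨?_, ?_, ?_, ?_⟩
        · exact (hγ.comp contDiff_fst).add (contDiff_snd.fun_smul (hη.comp contDiff_fst))
        · intro t; simp
        · intro s
          rw [lift_add_smul hγ hη s]
          simp [hz (t₀ - δ / 2) (by simp)]
        · intro s
          rw [lift_add_smul hγ hη s]
          simp [hz (t₀ + δ / 2) (by simp)]
      have h0 := hVP _ _ (by linarith) hsub _ hF (fun _ _ _ => mem_univ _)
      rw [hfv _ _ _ hF, neg_eq_zero] at h0
      rw [← h0]
      refine intervalIntegral.integral_congr fun t _ => ?_
      have hηd : (fun t => deriv (fun s : ℝ => γ t + s • η t) 0) = η := by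
        funext t
        have := ((hasDerivAt_id (0 : ℝ)).smul_const (η t)).const_add (γ t)
        simpa using this.deriv
      simp only [hηd]
      have hk : σ (Jet.lift n k γ t) (vlift n k η t - inc n k 0 (η t)) = 0 := by
        refine hsrc.2 _ (mem_univ _) _ ?_ ?_
        · simp [vlift, inc]
        · simp [vlift, inc]
      have hk2 : σ (Jet.lift n k γ t) (deriv (Jet.lift n k γ) t)
          (vlift n k η t - inc n k 0 (η t)) = 0 := by
        rw [hsrc.1 _ (mem_univ _), hk]; simp
      rw [map_sub, sub_eq_zero] at hk2
      rw [hk2, hηdef]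
      simp
    refine ContinuousLinearMap.ext fun w => ?_
    set d := deriv (Jet.lift n k γ) t₀ with hd
    have hself : σ (Jet.lift n k γ t₀) d d = 0 := by
      have := hsrc.1 (Jet.lift n k γ t₀) (mem_univ _) d d
      linarith
    set w' : Jet n k := w - w.1 • d with hw'
    have hk : σ (Jet.lift n k γ t₀) (w' - inc n k 0 (w'.2 0)) = 0 := by
      refine hsrc.2 _ (mem_univ _) _ ?_ ?_
      · simp [hw', inc, hfst]
      · simp [inc]
    have hk2 : σ (Jet.lift n k γ t₀) d (w' - inc n k 0 (w'.2 0)) = 0 := by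
      rw [hsrc.1 _ (mem_univ _), hk]; simp
    rw [map_sub, hinc, sub_zero, hw', map_sub, map_smul, hself] at hk2
    simpa using hk2
  · intro h a b hab hsub F hF _
    rw [hfv a b F hF, neg_eq_zero,
      ← intervalIntegral.integral_zero (a := a) (b := b) (E := ℝ)]
    refine intervalIntegral.integral_congr fun t ht => ?_
    rw [uIcc_of_le hab] at ht
    simp [h t (hsub ht)]

end JetAux
end Helpers

/-- If `α` is locally variationally equivalent to a 1-form `L dt` of order
`r ≤ k/2` and `σ` is a source form in the variational class `[dα]`, then a curve `γ`
satisfies the variational principle of `α` iff `ι_{(γ^(k))'(t)} σ = 0` for every `t`. -/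
theorem stmt3 (n k r : ℕ) (hr : 2 * r ≤ k)
    (α : Jet.Form1 n k) (hα : ContDiff ℝ (⊤ : ℕ∞) α)
    (hloc : ∀ u : Jet n k, ∃ U : Set (Jet n k), IsOpen U ∧ u ∈ U ∧
      ∃ L : Jet n r → ℝ, ContDiff ℝ (⊤ : ℕ∞) L ∧
        Jet.VarEquiv1 α
          (fun w => L (Jet.projL n (show r ≤ k by omega) w) • Jet.coT n k) U)
    (σ : Jet.Form2 n k) (hσ : ContDiff ℝ (⊤ : ℕ∞) σ)
    (hsrc : Jet.SourceForm σ Set.univ)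
    (hclass : ∃ (lam : Jet.Form2 n k) (mu : Jet.Form1 n k),
      Jet.Hol2 lam Set.univ ∧ Jet.Hol1 mu Set.univ ∧
      ∀ u : Jet n k, Jet.extd α u - σ u = lam u + Jet.extd mu u)
    (γ : ℝ → Fin n → ℝ) (hγ : ContDiff ℝ (⊤ : ℕ∞) γ)
    (I : Set ℝ) (hIo : IsOpen I) (hIc : I.OrdConnected) :
    Jet.SatisfiesVP α Set.univ γ I ↔
      ∀ t ∈ I, σ (Jet.lift n k γ t) (deriv (Jet.lift n k γ) t) = 0 := by
  exact JetAux.main α hα σ hσ hsrc hclass γ hγ I hIo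
end
end

section
/- (Noether Theorem, first part.) Let α_o be a 1-form of Poincaré–Cartan type on an open set U ⊆ J^k(E), variationally equivalent to a 1-form L dt of order r with r ≤ k/2, and write dα_o = σ + λ with σ a source form and λ a holonomic 2-form. If X is a vector field on U that is an infinitesimal symmetry for the action of α_o (i.e. X is a D-symmetry and L_X α_o is holonomic), then the function f^(X) := ι_X α_o = α_o(X) is a constant of motion: for every smooth curve γ satisfying the variational principle of α_o whose k-th lift lies in U, the function t ↦ f^(X)(γ^(k)(t)) is constant. -/
open Set Filter

noncomputable section

open MeasureTheory in
theorem aux_hasDerivAt_J {E : Type*} [NormedAddCommGroup E] [NormedSpace ℝ E]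
    (U : Set E) (hU : IsOpen U) (α : E → E →L[ℝ] ℝ) (hα : ContDiffOn ℝ (⊤ : ℕ∞) α U)
    (u d W W' : ℝ → E) (hu : Continuous u) (hd : Continuous d) (hW : Continuous W)
    (hW' : Continuous W') (a b ε : ℝ) (hε : 0 < ε)
    (hmem : ∀ c ∈ Icc (-ε) ε, ∀ t ∈ uIcc a b, u t + c • W t ∈ U) :
    HasDerivAt (fun c : ℝ => ∫ t in a..b, α (u t + c • W t) (d t + c • W' t))
      (∫ t in a..b, (fderiv ℝ α (u t) (W t) (d t) + α (u t) (W' t))) 0 := by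
  have hdα : ContinuousOn (fderiv ℝ α) U :=
    hα.continuousOn_fderiv_of_isOpen hU (by simp)
  have hmap : ∀ c ∈ Icc (-ε) ε, MapsTo (fun t => u t + c • W t) (uIcc a b) U :=
    fun c hc t ht => hmem c hc t ht
  have hmap2 : MapsTo (fun p : ℝ × ℝ => u p.2 + p.1 • W p.2) (Icc (-ε) ε ×ˢ uIcc a b) U :=
    fun p hp => hmem _ hp.1 _ hp.2
  set G' : ℝ → ℝ → ℝ := fun c t =>
    fderiv ℝ α (u t + c • W t) (W t) (d t + c • W' t) + α (u t + c • W t) (W' t) with hG'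
  have hcont2 : ContinuousOn (fun p : ℝ × ℝ => G' p.1 p.2) (Icc (-ε) ε ×ˢ uIcc a b) := by
    have h1 : ContinuousOn (fun p : ℝ × ℝ => fderiv ℝ α (u p.2 + p.1 • W p.2))
        (Icc (-ε) ε ×ˢ uIcc a b) := hdα.comp (by fun_prop) hmap2
    have h2 : ContinuousOn (fun p : ℝ × ℝ => α (u p.2 + p.1 • W p.2))
        (Icc (-ε) ε ×ˢ uIcc a b) := hα.continuousOn.comp (by fun_prop) hmap2
    exact ((h1.clm_apply (by fun_prop)).clm_apply (by fun_prop)).add (h2.clm_apply (by fun_prop))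
  obtain ⟨C, hC⟩ := (isCompact_Icc.prod isCompact_uIcc).exists_bound_of_continuousOn hcont2
  have hG : ∀ c ∈ Icc (-ε) ε, ContinuousOn (fun t => α (u t + c • W t) (d t + c • W' t))
      (uIcc a b) := fun c hc =>
    (hα.continuousOn.comp (by fun_prop) (hmap c hc)).clm_apply (by fun_prop)
  have h0 : (0:ℝ) ∈ Icc (-ε) ε := ⟨by linarith, hε.le⟩
  have hG'0 : ContinuousOn (G' 0) (uIcc a b) :=
    hcont2.comp (f := fun t => ((0:ℝ), t)) (by fun_prop) (fun t ht => ⟨h0, ht⟩)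
  have hsub : Set.uIoc a b ⊆ uIcc a b := uIoc_subset_uIcc
  have hnh : Icc (-ε) ε ∈ nhds (0:ℝ) := Icc_mem_nhds (by linarith) hε
  have := (intervalIntegral.hasDerivAt_integral_of_dominated_loc_of_deriv_le (μ := volume)
    (a := a) (b := b) (bound := fun _ => C)
    (F := fun c t => α (u t + c • W t) (d t + c • W' t)) (F' := G') (x₀ := (0:ℝ))
    (s := Icc (-ε) ε) hnh ?_ ?_ ?_ ?_ ?_ ?_).2
  · simpa [hG'] using this
  · filter_upwards [hnh] with c hc
    exact ((hG c hc).mono hsub).aestronglyMeasurable measurableSet_uIoc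
  · exact (hG 0 h0).intervalIntegrable
  · exact (hG'0.mono hsub).aestronglyMeasurable measurableSet_uIoc
  · exact Eventually.of_forall fun t ht c hc => hC (c, t) ⟨hc, hsub ht⟩
  · exact (continuous_const (y := C)).intervalIntegrable a b
  · refine Eventually.of_forall fun t ht c hc => ?_
    have hin := hmem c hc t (hsub ht)
    have hα' : HasFDerivAt α (fderiv ℝ α (u t + c • W t)) (u t + c • W t) :=
      ((hα.contDiffAt (hU.mem_nhds hin)).differentiableAt (by simp)).hasFDerivAt
    have l1 : HasDerivAt (fun c : ℝ => u t + c • W t) (W t) c := by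
      simpa using ((hasDerivAt_id c).smul_const (W t)).const_add (u t)
    have l2 : HasDerivAt (fun c : ℝ => d t + c • W' t) (W' t) c := by
      simpa using ((hasDerivAt_id c).smul_const (W' t)).const_add (d t)
    have l3 : HasDerivAt (fun c : ℝ => α (u t + c • W t))
        (fderiv ℝ α (u t + c • W t) (W t)) c := hα'.comp_hasDerivAt c l1
    have l4 := l3.clm_apply l2
    exact l4

/-- derivative of the lift -/
def auxDl (n k : ℕ) (γ : ℝ → Fin n → ℝ) (t : ℝ) : Jet n k :=
  (1, fun a => iteratedDeriv ((a : ℕ) + 1) γ t)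

/-- lift of a variation field -/
def auxW (n k m : ℕ) (η : ℝ → Fin n → ℝ) (t : ℝ) : Jet n k :=
  (0, fun a => iteratedDeriv ((a : ℕ) + m) η t)

theorem aux_hasDerivAt_iter {n : ℕ} (γ : ℝ → Fin n → ℝ) (hγ : ContDiff ℝ (⊤ : ℕ∞) γ)
    (m : ℕ) (t : ℝ) : HasDerivAt (iteratedDeriv m γ) (iteratedDeriv (m + 1) γ t) t := by
  have h := hγ.differentiable_iteratedDeriv m (by exact_mod_cast ENat.coe_lt_top m)
  rw [iteratedDeriv_succ]
  exact (h t).hasDerivAt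

theorem aux_cont_iter {n : ℕ} (γ : ℝ → Fin n → ℝ) (hγ : ContDiff ℝ (⊤ : ℕ∞) γ)
    (m : ℕ) : Continuous (iteratedDeriv m γ) :=
  continuous_iff_continuousAt.2 fun t => (aux_hasDerivAt_iter γ hγ m t).continuousAt

theorem aux_lift_deriv {n k : ℕ} (γ : ℝ → Fin n → ℝ) (hγ : ContDiff ℝ (⊤ : ℕ∞) γ) (t : ℝ) :
    HasDerivAt (Jet.lift n k γ) (auxDl n k γ t) t :=
  (hasDerivAt_id t).prodMk (hasDerivAt_pi.2 fun a => aux_hasDerivAt_iter γ hγ a t)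

theorem aux_W_deriv {n k : ℕ} (η : ℝ → Fin n → ℝ) (hη : ContDiff ℝ (⊤ : ℕ∞) η) (t : ℝ) :
    HasDerivAt (auxW n k 0 η) (auxW n k 1 η t) t :=
  (hasDerivAt_const t (0:ℝ)).prodMk (hasDerivAt_pi.2 fun a => aux_hasDerivAt_iter η hη a t)

theorem aux_cont_Dl {n k : ℕ} (γ : ℝ → Fin n → ℝ) (hγ : ContDiff ℝ (⊤ : ℕ∞) γ) :
    Continuous (auxDl n k γ) :=
  continuous_const.prodMk (continuous_pi fun a => aux_cont_iter γ hγ _)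

theorem aux_cont_W {n k : ℕ} (m : ℕ) (γ : ℝ → Fin n → ℝ) (hγ : ContDiff ℝ (⊤ : ℕ∞) γ) :
    Continuous (auxW n k m γ) :=
  continuous_const.prodMk (continuous_pi fun a => aux_cont_iter γ hγ _)

theorem aux_inD {n k : ℕ} (γ : ℝ → Fin n → ℝ) (t : ℝ) :
    Jet.InD (Jet.lift n k γ t) (auxDl n k γ t) := by
  refine ⟨1, iteratedDeriv (k + 1) γ t, ?_⟩
  ext a i
  · simp [auxDl, Jet.dtVF, Jet.eY, Prod.fst_sum]
  · rw [one_smul, Prod.snd_add, Prod.snd_sum, Pi.add_apply, Pi.add_apply, Finset.sum_apply,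
      Finset.sum_apply]
    by_cases h : (a : ℕ) + 1 < k + 1
    · have : a ≠ Fin.last k := by rintro rfl; simp at h
      simp [auxDl, Jet.dtVF, Jet.eY, Jet.lift, this]
      omega
    · have : a = Fin.last k := by ext; simp; omega
      subst this
      simp [auxDl, Jet.dtVF, Jet.eY, Jet.lift]

theorem aux_lift_add {n k : ℕ} (γ η : ℝ → Fin n → ℝ) (hγ : ContDiff ℝ (⊤ : ℕ∞) γ)
    (hη : ContDiff ℝ (⊤ : ℕ∞) η) (c t : ℝ) :
    Jet.lift n k (fun t => γ t + c • η t) t = Jet.lift n k γ t + c • auxW n k 0 η t := by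
  ext a i
  · simp [Jet.lift, auxW]
  · have h1 : ContDiffAt ℝ (a : ℕ) γ t := (hγ.of_le (by exact_mod_cast le_top)).contDiffAt
    have h2 : ContDiffAt ℝ (a : ℕ) η t := (hη.of_le (by exact_mod_cast le_top)).contDiffAt
    have := iteratedDeriv_add (n := (a:ℕ)) (x := t) (f := γ) (g := c • η) h1 (h2.const_smul c)
    have e : (fun t => γ t + c • η t) = γ + c • η := rfl
    simp only [Jet.lift, auxW, e, this, iteratedDeriv_const_smul c h2]
    simp

theorem aux_W_zero {n k : ℕ} (η : ℝ → Fin n → ℝ) (t : ℝ) (h : t ∉ tsupport η) (m : ℕ) :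
    auxW n k m η t = 0 := by
  have h0 : η =ᶠ[nhds t] fun _ => 0 := notMem_tsupport_iff_eventuallyEq.1 h
  ext a i
  · simp [auxW]
  · simp [auxW, h0.iteratedDeriv_eq]

theorem aux_extd_swap {n k : ℕ} (α : Jet.Form1 n k) (u v w : Jet n k) :
    Jet.extd α u v w = - Jet.extd α u w v := by
  simp [Jet.extd]

/-- vertical vector at level 0 -/
def auxE (n k : ℕ) (v : Fin n → ℝ) : Jet n k := (0, Pi.single 0 v)

theorem aux_extd_red {n k : ℕ} (U : Set (Jet n k)) (αo : Jet.Form1 n k)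
    (σ lam : Jet.Form2 n k)
    (hsrc : Jet.SourceForm σ U) (hlam : Jet.Hol2 lam U)
    (hdec : ∀ u ∈ U, Jet.extd αo u = σ u + lam u) (u : Jet n k) (hu : u ∈ U) (d Z : Jet n k)
    (hd : Jet.InD u d) (hZ : Z.1 = 0) :
    Jet.extd αo u d Z = Jet.extd αo u d (auxE n k (Z.2 0)) := by
  rw [← sub_eq_zero, ← map_sub, hdec u hu]
  have h1 := hsrc.2 u hu (Z - auxE n k (Z.2 0)) (by simp [auxE, hZ]) (by simp [auxE])
  have h2 := hlam u hu d hd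
  rw [ContinuousLinearMap.add_apply, h2, add_zero, hsrc.1 u hu, h1]
  simp

open MeasureTheory in
theorem aux_EL {n k : ℕ} (U : Set (Jet n k)) (hU : IsOpen U)
    (αo : Jet.Form1 n k) (hαo : ContDiffOn ℝ (⊤ : ℕ∞) αo U)
    (σ lam : Jet.Form2 n k)
    (hsrc : Jet.SourceForm σ U) (hlam : Jet.Hol2 lam U)
    (hdec : ∀ u ∈ U, Jet.extd αo u = σ u + lam u)
    (γ : ℝ → Fin n → ℝ) (hγ : ContDiff ℝ (⊤ : ℕ∞) γ)
    (I : Set ℝ)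
    (hlift : ∀ t ∈ I, Jet.lift n k γ t ∈ U)
    (hVP : Jet.SatisfiesVP αo U γ I) (a b : ℝ) (hab : a < b) (hI : Icc a b ⊆ I)
    (v : Fin n → ℝ) : ∀ t ∈ Ioo a b,
      Jet.extd αo (Jet.lift n k γ t) (auxDl n k γ t) (auxE n k v) = 0 := by
  set u := Jet.lift n k γ with hu_def
  set d := auxDl n k γ with hd_def
  have hud : ∀ t, HasDerivAt u (d t) t := aux_lift_deriv γ hγ
  have hu : Continuous u := continuous_iff_continuousAt.2 fun t => (hud t).continuousAt
  have hd : Continuous d := aux_cont_Dl γ hγ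
  have hdα : ContinuousOn (fderiv ℝ αo) U :=
    hαo.continuousOn_fderiv_of_isOpen hU (by simp)
  have hmapU : MapsTo u (Icc a b) U := fun t ht => hlift t (hI ht)
  have hdαu : ContinuousOn (fun t => fderiv ℝ αo (u t)) (Icc a b) :=
    hdα.comp hu.continuousOn hmapU
  have hαu : ContinuousOn (fun t => αo (u t)) (Icc a b) :=
    hαo.continuousOn.comp hu.continuousOn hmapU
  set E : ℝ → ℝ := fun t => Jet.extd αo (u t) (d t) (auxE n k v) with hE
  have hEc : ContinuousOn E (Icc a b) := by
    have : E = fun t => fderiv ℝ αo (u t) (d t) (auxE n k v)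
        - fderiv ℝ αo (u t) (auxE n k v) (d t) := by
      funext t; simp [hE, Jet.extd]
    rw [this]
    exact ((hdαu.clm_apply hd.continuousOn).clm_apply continuousOn_const).sub
      ((hdαu.clm_apply continuousOn_const).clm_apply hd.continuousOn)
  have hEo : ContinuousOn E (Ioo a b) := hEc.mono Ioo_subset_Icc_self
  have key : ∀ᵐ t ∂(volume : Measure ℝ), t ∈ Ioo a b → E t = 0 := by
    refine isOpen_Ioo.ae_eq_zero_of_integral_contDiff_smul_eq_zero
      (hEo.locallyIntegrableOn measurableSet_Ioo) ?_
    intro ψ hψ hψc hψs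
    set η : ℝ → Fin n → ℝ := fun t => ψ t • v with hη_def
    have hη : ContDiff ℝ (⊤ : ℕ∞) η := hψ.smul contDiff_const
    have hηs : tsupport η ⊆ Ioo a b :=
      (closure_mono (Function.support_smul_subset_left ψ (fun _ => v))).trans hψs
    set W := auxW n k 0 η with hW_def
    set W' := auxW n k 1 η with hW'_def
    have hWd : ∀ t, HasDerivAt W (W' t) t := aux_W_deriv η hη
    have hW : Continuous W := aux_cont_W 0 η hη
    have hW' : Continuous W' := aux_cont_W 1 η hη
    have hWa : W a = 0 := aux_W_zero η a (fun h => (hηs h).1.false) 0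
    have hWb : W b = 0 := aux_W_zero η b (fun h => (hηs h).2.false) 0
    have huIcc : uIcc a b = Icc a b := uIcc_of_le hab.le
    obtain ⟨ε, hε, hmem⟩ : ∃ ε : ℝ, 0 < ε ∧ ∀ c ∈ Icc (-ε) ε, ∀ t ∈ uIcc a b, u t + c • W t ∈ U := by
      obtain ⟨s, s', hs, hs', h0s, hss', hsub⟩ := generalized_tube_lemma
        (isCompact_singleton (x := (0:ℝ))) (isCompact_Icc (a := a) (b := b))
        (n := (fun p : ℝ × ℝ => u p.2 + p.1 • W p.2) ⁻¹' U)
        (hU.preimage (by fun_prop)) (by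
          rintro ⟨c, t⟩ ⟨hc, ht⟩
          have hc' : c = 0 := hc
          subst hc'
          simpa using hmapU ht)
      obtain ⟨ε, hε, hball⟩ := Metric.isOpen_iff.1 hs 0 (h0s rfl)
      refine ⟨ε / 2, by positivity, fun c hc t ht => ?_⟩
      refine hsub (a := (c, t)) ⟨hball ?_, hss' (huIcc ▸ ht)⟩
      rw [mem_ball_zero_iff, Real.norm_eq_abs]
      exact lt_of_le_of_lt (abs_le.2 hc) (by linarith)
    have hJ := aux_hasDerivAt_J U hU αo hαo u d W W' hu hd hW hW' a b ε hε hmem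
    set φ : ℝ → ℝ := fun s => ε * Real.sin s with hφ
    have hφmem : ∀ s, φ s ∈ Icc (-ε) ε := fun s =>
      ⟨by simp only [hφ]; nlinarith [Real.neg_one_le_sin s],
       by simp only [hφ]; nlinarith [Real.sin_le_one s]⟩
    have hlF : ∀ s, Jet.lift n k (fun t => γ t + φ s • η t) = fun t => u t + φ s • W t :=
      fun s => funext fun t => aux_lift_add γ η hγ hη (φ s) t
    have hvp := hVP a b hab.le hI (fun t s => γ t + φ s • η t)
      { smooth := by
          have h1 : ContDiff ℝ (⊤ : ℕ∞) (fun p : ℝ × ℝ => φ p.2) :=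
            contDiff_const.mul (Real.contDiff_sin.comp contDiff_snd)
          exact (hγ.comp contDiff_fst).add (h1.smul (hη.comp contDiff_fst))
        init := fun t => by simp [hφ]
        fix_a := fun s => by
          show Jet.lift n k (fun t => γ t + φ s • η t) a = _
          rw [hlF]; simp [hWa, hu_def]
        fix_b := fun s => by
          show Jet.lift n k (fun t => γ t + φ s • η t) b = _
          rw [hlF]; simp [hWb, hu_def] }
      (fun s t ht => by
        show Jet.lift n k (fun t => γ t + φ s • η t) t ∈ U
        rw [hlF]; exact hmem _ (hφmem s) t (huIcc ▸ ht))
    have hact : (fun s => Jet.action αo (fun t => γ t + φ s • η t) a b) =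
        fun s => (fun c : ℝ => ∫ t in a..b, αo (u t + c • W t) (d t + c • W' t)) (φ s) := by
      funext s
      unfold Jet.action
      rw [hlF]
      refine intervalIntegral.integral_congr fun t _ => ?_
      have : HasDerivAt (fun t => u t + φ s • W t) (d t + φ s • W' t) t :=
        (hud t).add ((hWd t).const_smul (φ s))
      simp only [this.deriv]
    rw [hact] at hvp
    have hφd : HasDerivAt φ ε 0 := by
      simpa using (Real.hasDerivAt_sin 0).const_mul ε
    have hφ0 : φ 0 = 0 := by simp [hφ]
    rw [← hφ0] at hJ
    have h3 := (HasDerivAt.comp (0:ℝ) hJ hφd).deriv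
    have h4 : (∫ t in a..b, (fderiv ℝ αo (u t) (W t) (d t) + αo (u t) (W' t))) * ε = 0 :=
      h3.symm.trans hvp
    have h5 : (∫ t in a..b, (fderiv ℝ αo (u t) (W t) (d t) + αo (u t) (W' t))) = 0 :=
      (mul_eq_zero.1 h4).resolve_right hε.ne'
    have hBc : ContinuousOn (fun t => fderiv ℝ αo (u t) (d t) (W t) + αo (u t) (W' t))
        (uIcc a b) := by
      rw [huIcc]
      exact ((hdαu.clm_apply hd.continuousOn).clm_apply hW.continuousOn).add
        (hαu.clm_apply hW'.continuousOn)
    have hCc : ContinuousOn (fun t => fderiv ℝ αo (u t) (W t) (d t) + αo (u t) (W' t))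
        (uIcc a b) := by
      rw [huIcc]
      exact ((hdαu.clm_apply hW.continuousOn).clm_apply hd.continuousOn).add
        (hαu.clm_apply hW'.continuousOn)
    have h6 : ∫ t in a..b, (fderiv ℝ αo (u t) (d t) (W t) + αo (u t) (W' t)) = 0 := by
      rw [intervalIntegral.integral_eq_sub_of_hasDerivAt (f := fun t => αo (u t) (W t)) ?_
        hBc.intervalIntegrable]
      · simp [hWa, hWb]
      · intro t ht
        have hα' : HasFDerivAt αo (fderiv ℝ αo (u t)) (u t) :=
          ((hαo.contDiffAt (hU.mem_nhds (hmapU (huIcc ▸ ht)))).differentiableAt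
            (by simp)).hasFDerivAt
        exact (hα'.comp_hasDerivAt t (hud t)).clm_apply (hWd t)
    have h7 : ∫ t in a..b, ψ t • E t = 0 := by
      have := intervalIntegral.integral_sub hBc.intervalIntegrable
        (hCc.intervalIntegrable (μ := volume))
      rw [h5, h6, sub_zero] at this
      rw [← this]
      refine intervalIntegral.integral_congr fun t ht => ?_
      have hr := aux_extd_red U αo σ lam hsrc hlam hdec (u t) (hmapU (huIcc ▸ ht)) (d t) (W t)
        (aux_inD γ t) rfl
      have hW0 : auxE n k ((W t).2 0) = ψ t • auxE n k v := by
        ext c i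
        · simp [auxE]
        · rcases eq_or_ne c 0 with rfl | hc
          · simp [auxE, hW_def, auxW, hη_def]
          · simp [auxE, hc]
      rw [hW0, map_smul] at hr
      show ψ t • E t = _
      rw [hE]
      simp only
      rw [← hr]
      simp [Jet.extd]
    rw [← h7, intervalIntegral.integral_eq_integral_of_support_subset]
    intro t ht
    have : t ∈ tsupport ψ := subset_tsupport _ (Function.support_smul_subset_left ψ E ht)
    exact Ioo_subset_Ioc_self (hψs this)
  have := Measure.eqOn_open_of_ae_eq (μ := (volume : Measure ℝ)) (U := Ioo a b) (f := E)
    (g := fun _ => 0) ((ae_restrict_iff' measurableSet_Ioo).2 key) isOpen_Ioo hEo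
    continuousOn_const
  exact this

/-- **Noether Theorem, first part.** Let `α_o` be a 1-form of
Poincaré–Cartan type on `U ⊆ J^k(E)`, variationally equivalent to a 1-form `L dt` of order
`r ≤ k/2`, with `dα_o = σ + λ` (`σ` a source form, `λ` holonomic). If `X` is an
infinitesimal symmetry for the action of `α_o` on `U`, then `f^(X) = ι_X α_o` is constant
along (the `k`-lift of) every solution of the variational principle of `α_o` lying in `U`. -/
theorem stmt9 (n k r : ℕ) (hr : 2 * r ≤ k)
    (U : Set (Jet n k)) (hU : IsOpen U)
    (αo : Jet.Form1 n k) (hαo : ContDiffOn ℝ (⊤ : ℕ∞) αo U)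
    (hvar : ∃ L : Jet n r → ℝ, ContDiff ℝ (⊤ : ℕ∞) L ∧
      Jet.VarEquiv1 αo
        (fun w => L (Jet.projL n (show r ≤ k by omega) w) • Jet.coT n k) U)
    (σ lam : Jet.Form2 n k)
    (hsrc : Jet.SourceForm σ U) (hlam : Jet.Hol2 lam U)
    (hdec : ∀ u ∈ U, Jet.extd αo u = σ u + lam u)
    (X : Jet n k → Jet n k) (hX : ContDiffOn ℝ (⊤ : ℕ∞) X U)
    (hsymm : Jet.IsSymm αo X U)
    (γ : ℝ → Fin n → ℝ) (hγ : ContDiff ℝ (⊤ : ℕ∞) γ)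
    (I : Set ℝ) (hIo : IsOpen I) (hIc : I.OrdConnected)
    (hlift : ∀ t ∈ I, Jet.lift n k γ t ∈ U)
    (hVP : Jet.SatisfiesVP αo U γ I) :
    ∀ t₁ ∈ I, ∀ t₂ ∈ I,
      αo (Jet.lift n k γ t₁) (X (Jet.lift n k γ t₁))
        = αo (Jet.lift n k γ t₂) (X (Jet.lift n k γ t₂)) := by
  have main : ∀ t ∈ I, HasDerivAt (fun t => αo (Jet.lift n k γ t) (X (Jet.lift n k γ t))) 0 t := by
    intro t ht
    have htU := hlift t ht
    have hnU := hU.mem_nhds htU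
    have hα' : HasFDerivAt αo (fderiv ℝ αo (Jet.lift n k γ t)) (Jet.lift n k γ t) :=
      ((hαo.contDiffAt hnU).differentiableAt (by simp)).hasFDerivAt
    have hX' : HasFDerivAt X (fderiv ℝ X (Jet.lift n k γ t)) (Jet.lift n k γ t) :=
      ((hX.contDiffAt hnU).differentiableAt (by simp)).hasFDerivAt
    have hu := aux_lift_deriv (k := k) γ hγ t
    have hder := (hα'.comp_hasDerivAt t hu).clm_apply (hX'.comp_hasDerivAt t hu)
    obtain ⟨δ, hδ, hball⟩ := Metric.isOpen_iff.1 hIo t ht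
    have hIcc : Icc (t - δ / 2) (t + δ / 2) ⊆ I := fun s hs => hball (by
      rw [Metric.mem_ball, Real.dist_eq]
      exact lt_of_le_of_lt (abs_le.2 ⟨by linarith [hs.1], by linarith [hs.2]⟩)
        (show δ / 2 < δ by linarith))
    have hD := aux_inD (k := k) γ t
    have hEL := fun v => aux_EL U hU αo hαo σ lam hsrc hlam hdec γ hγ I hlift hVP
      (t - δ / 2) (t + δ / 2) (by linarith) hIcc v t ⟨by linarith, by linarith⟩
    have hsym := hsymm.2 _ htU _ hD
    have hself : Jet.extd αo (Jet.lift n k γ t) (auxDl n k γ t) (auxDl n k γ t) = 0 := by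
      simp [Jet.extd]
    have hred := aux_extd_red U αo σ lam hsrc hlam hdec _ htU (auxDl n k γ t)
      (X (Jet.lift n k γ t) - (X (Jet.lift n k γ t)).1 • auxDl n k γ t) hD (by simp [auxDl])
    rw [hEL, map_sub, map_smul, hself, smul_zero, sub_zero] at hred
    simp only [Function.comp_apply] at hder
    simp only [Jet.extd, Jet.lieD, ContinuousLinearMap.sub_apply, ContinuousLinearMap.flip_apply,
      ContinuousLinearMap.add_apply, ContinuousLinearMap.comp_apply] at hred hsym
    rw [← sub_eq_zero.1 hred] at hsym
    exact hder.congr_deriv hsym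
  intro t₁ h₁ t₂ h₂
  exact hIo.is_const_of_deriv_eq_zero hIc.isPreconnected
    (fun t ht => (main t ht).differentiableAt.differentiableWithinAt)
    (fun t ht => (main t ht).deriv) h₁ h₂
end
end

section
/- Let H : U ⊆ ℝ^(2n) → ℝ be smooth, k ≥ 2, and α^H = Σ_i p_i dq^i − H dt the Poincaré–Cartan 1-form of H regarded as a 1-form on J^k(E). A smooth curve γ(t) = (q(t), p(t)) in U satisfies the variational principle of α^H if and only if it satisfies Hamilton's equations: for all t and all i, dq^i/dt = ∂H/∂p_i(q(t), p(t)) and dp_i/dt = −∂H/∂q^i(q(t), p(t)). -/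
open Set Filter

noncomputable section

/-- The phase space `T*ℝⁿ = ℝ^(2n)` with coordinates `(qⁱ, pᵢ)`. -/
abbrev Phase (n : ℕ) : Type := (Fin n → ℝ) × (Fin n → ℝ)

/-- The `k`-th order jet space of the trivial bundle `E = T*ℝⁿ × ℝ → ℝ`, identified with
`ℝ × (ℝ^(2n))^(k+1)` via the adapted coordinates `(t, qⁱ_(a), p_(a)ᵢ)`. -/
abbrev JetP (n k : ℕ) : Type := ℝ × (Fin (k + 1) → Phase n)

namespace JetP

variable {n k : ℕ}

/-- The 1-form `dt`. -/
def coT (n k : ℕ) : JetP n k →L[ℝ] ℝ := ContinuousLinearMap.fst ℝ ℝ (Fin (k + 1) → Phase n)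

/-- The 1-form `dqⁱ_(a)`. -/
def coQ (n k : ℕ) (a : Fin (k + 1)) (i : Fin n) : JetP n k →L[ℝ] ℝ :=
  ((ContinuousLinearMap.proj i : (Fin n → ℝ) →L[ℝ] ℝ).comp
      ((ContinuousLinearMap.fst ℝ (Fin n → ℝ) (Fin n → ℝ)).comp
        (ContinuousLinearMap.proj a : (Fin (k + 1) → Phase n) →L[ℝ] Phase n))).comp
    (ContinuousLinearMap.snd ℝ ℝ (Fin (k + 1) → Phase n))

/-- The 1-form `dp_(a)ᵢ`. -/
def coP (n k : ℕ) (a : Fin (k + 1)) (i : Fin n) : JetP n k →L[ℝ] ℝ :=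
  ((ContinuousLinearMap.proj i : (Fin n → ℝ) →L[ℝ] ℝ).comp
      ((ContinuousLinearMap.snd ℝ (Fin n → ℝ) (Fin n → ℝ)).comp
        (ContinuousLinearMap.proj a : (Fin (k + 1) → Phase n) →L[ℝ] Phase n))).comp
    (ContinuousLinearMap.snd ℝ ℝ (Fin (k + 1) → Phase n))

/-- The coordinate tangent vector `∂/∂qⁱ_(a)`. -/
def eQ (n k : ℕ) (a : Fin (k + 1)) (i : Fin n) : JetP n k :=
  (0, Pi.single a (Pi.single i 1, 0))

/-- The coordinate tangent vector `∂/∂p_(a)ᵢ`. -/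
def eP (n k : ℕ) (a : Fin (k + 1)) (i : Fin n) : JetP n k :=
  (0, Pi.single a (0, Pi.single i 1))

/-- The total-derivative vector field `d/dt`. -/
def dtVF (n k : ℕ) (u : JetP n k) : JetP n k :=
  (1, fun a => if h : (a : ℕ) + 1 < k + 1 then u.2 ⟨(a : ℕ) + 1, h⟩ else 0)

/-- Membership in the holonomic distribution `D` at `u`: spanned by `d/dt|_u` and the top
coordinate fields `∂/∂qⁱ_(k)`, `∂/∂p_(k)ᵢ`. -/
def InD (u v : JetP n k) : Prop :=
  ∃ (c : ℝ) (w : Phase n), v = c • dtVF n k u + (0, Pi.single (Fin.last k) w)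

/-- 1-forms. -/
abbrev Form1 (n k : ℕ) := JetP n k → JetP n k →L[ℝ] ℝ

/-- 2-forms. -/
abbrev Form2 (n k : ℕ) := JetP n k → JetP n k →L[ℝ] JetP n k →L[ℝ] ℝ

/-- Holonomic 1-forms. -/
def Hol1 (α : Form1 n k) (U : Set (JetP n k)) : Prop := ∀ u ∈ U, ∀ v, InD u v → α u v = 0

/-- Holonomic 2-forms. -/
def Hol2 (σ : Form2 n k) (U : Set (JetP n k)) : Prop := ∀ u ∈ U, ∀ v, InD u v → σ u v = 0

/-- Exterior differential of a 1-form. -/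
def extd (α : Form1 n k) : Form2 n k := fun u => fderiv ℝ α u - (fderiv ℝ α u).flip

/-- Lie bracket of vector fields. -/
def lie (X Y : JetP n k → JetP n k) (u : JetP n k) : JetP n k :=
  fderiv ℝ Y u (X u) - fderiv ℝ X u (Y u)

/-- Lie derivative of a 1-form. -/
def lieD (X : JetP n k → JetP n k) (α : Form1 n k) : Form1 n k :=
  fun u => fderiv ℝ α u (X u) + (α u).comp (fderiv ℝ X u)

/-- Wedge product of two 1-forms. -/
def wedge {E : Type*} [NormedAddCommGroup E] [NormedSpace ℝ E] (β η : E →L[ℝ] ℝ) :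
    E →L[ℝ] E →L[ℝ] ℝ :=
  β.smulRight η - η.smulRight β

/-- Contact forms `ω^i_(a) = dqⁱ_(a) − qⁱ_(a+1) dt`. -/
def contactQ (n k : ℕ) (a : Fin k) (i : Fin n) (u : JetP n k) : JetP n k →L[ℝ] ℝ :=
  coQ n k a.castSucc i - (u.2 a.succ).1 i • coT n k

/-- Contact forms `ω_(a)i = dp_(a)ᵢ − p_(a+1)ᵢ dt`. -/
def contactP (n k : ℕ) (a : Fin k) (i : Fin n) (u : JetP n k) : JetP n k →L[ℝ] ℝ :=
  coP n k a.castSucc i - (u.2 a.succ).2 i • coT n k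

/-- A source form: an (antisymmetric) 2-form killed by contraction with every vector field
whose components along `∂/∂t` and all the zero-order fields `∂/∂qⁱ`, `∂/∂pᵢ` vanish. -/
def SourceForm (σ : Form2 n k) (U : Set (JetP n k)) : Prop :=
  (∀ u ∈ U, ∀ v w, σ u v w = -σ u w v) ∧
  (∀ u ∈ U, ∀ v : JetP n k, v.1 = 0 → v.2 0 = 0 → σ u v = 0)

/-- The Poincaré–Cartan 1-form `α^H = Σᵢ pᵢ dqⁱ − H dt` of a Hamiltonian `H`,
regarded (via pullback) as a 1-form on `J^k(E)`. -/
def alphaH (n k : ℕ) (H : Phase n → ℝ) : Form1 n k :=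
  fun u => (∑ i : Fin n, (u.2 0).2 i • coQ n k 0 i) - H (u.2 0) • coT n k

/-- `k`-th order lift of a curve in phase space. -/
def lift (n k : ℕ) (γ : ℝ → Phase n) (t : ℝ) : JetP n k :=
  (t, fun a => iteratedDeriv (a : ℕ) γ t)

/-- The action of a 1-form along a curve. -/
def action (α : Form1 n k) (γ : ℝ → Phase n) (a b : ℝ) : ℝ :=
  ∫ t in a..b, α (lift n k γ t) (deriv (lift n k γ) t)

/-- A smooth variation of `γ` on `[a,b]` with fixed boundary up to order `k`. -/
structure IsVariation (n k : ℕ) (γ : ℝ → Phase n) (a b : ℝ) (F : ℝ → ℝ → Phase n) :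
    Prop where
  smooth : ContDiff ℝ (⊤ : ℕ∞) (fun p : ℝ × ℝ => F p.1 p.2)
  init : ∀ t, F t 0 = γ t
  fix_a : ∀ s, lift n k (fun t => F t s) a = lift n k γ a
  fix_b : ∀ s, lift n k (fun t => F t s) b = lift n k γ b

/-- `γ` satisfies the variational principle of `α` (1-form on `U`) on the interval `I`. -/
def SatisfiesVP (α : Form1 n k) (U : Set (JetP n k)) (γ : ℝ → Phase n) (I : Set ℝ) : Prop :=
  ∀ a b : ℝ, a ≤ b → Set.Icc a b ⊆ I → ∀ F, IsVariation n k γ a b F →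
    (∀ s t, t ∈ Set.Icc a b → lift n k (fun t' => F t' s) t ∈ U) →
    deriv (fun s => action α (fun t => F t s) a b) 0 = 0

/-- Total derivative of a function on the jet space. -/
def tderiv (g : JetP n k → ℝ) : JetP n k → ℝ := fun u => fderiv ℝ g u (dtVF n k u)

/-- `X` is a `D`-symmetry on `U`. -/
def IsDSymm (X : JetP n k → JetP n k) (U : Set (JetP n k)) : Prop :=
  ∀ Y : JetP n k → JetP n k, ContDiffOn ℝ (⊤ : ℕ∞) Y U → (∀ u ∈ U, InD u (Y u)) →
    ∀ u ∈ U, InD u (lie X Y u)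

/-- `X` is an infinitesimal symmetry for the action of `α` on `U`. -/
def IsSymm (α : Form1 n k) (X : JetP n k → JetP n k) (U : Set (JetP n k)) : Prop :=
  IsDSymm X U ∧ Hol1 (lieD X α) U

end JetP

namespace JetP

open MeasureTheory Topology

/-- The Euler–Lagrange expression of `α^H` along `γ`. -/
def elH {n : ℕ} (H : Phase n → ℝ) (γ : ℝ → Phase n) (t : ℝ) (v : Phase n) : ℝ :=
  ∑ i, (v.2 i * (deriv γ t).1 i - v.1 i * (deriv γ t).2 i) - fderiv ℝ H (γ t) v

lemma hasDerivAt_lift {n k : ℕ} {γ : ℝ → Phase n} (hγ : ContDiff ℝ (⊤ : ℕ∞) γ) (t : ℝ) :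
    HasDerivAt (lift n k γ) (1, fun a => deriv (iteratedDeriv (a : ℕ) γ) t) t := by
  unfold lift
  refine (hasDerivAt_id t).prodMk (hasDerivAt_pi.2 fun a => ?_)
  refine ((hγ.differentiable_iteratedDeriv a ?_) t).hasDerivAt
  exact_mod_cast WithTop.coe_lt_top _

lemma action_alphaH {n k : ℕ} (H : Phase n → ℝ) {γ : ℝ → Phase n}
    (hγ : ContDiff ℝ (⊤ : ℕ∞) γ) (a b : ℝ) :
    action (alphaH n k H) γ a b =
      ∫ t in a..b, ((∑ i, (γ t).2 i * (deriv γ t).1 i) - H (γ t)) := by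
  unfold action
  congr 1
  ext t
  rw [(hasDerivAt_lift hγ t).deriv]
  simp [alphaH, lift, coQ, coT]

lemma hasDerivAt_dot {n : ℕ} {x y : ℝ → Phase n} {x' y' : Phase n} {s : ℝ}
    (hx : HasDerivAt x x' s) (hy : HasDerivAt y y' s) :
    HasDerivAt (fun s => ∑ i, (x s).2 i * (y s).1 i)
      (∑ i, (x'.2 i * (y s).1 i + (x s).2 i * y'.1 i)) s := by
  refine HasDerivAt.fun_sum fun i _ => ?_
  have h1 : HasDerivAt (fun s => (x s).2 i) (x'.2 i) s := hasDerivAt_pi.1 hx.snd i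
  have h2 : HasDerivAt (fun s => (y s).1 i) (y'.1 i) s := hasDerivAt_pi.1 hy.fst i
  exact h1.mul h2

lemma hasDerivAt_param {a b : ℝ} (hab : a ≤ b) {L L' : ℝ → ℝ → ℝ}
    (hL : ContinuousOn (fun p : ℝ × ℝ => L p.1 p.2) (Icc a b ×ˢ univ))
    (hL' : ContinuousOn (fun p : ℝ × ℝ => L' p.1 p.2) (Icc a b ×ˢ univ))
    (hd : ∀ t ∈ Icc a b, ∀ s, HasDerivAt (fun s => L t s) (L' t s) s) :
    HasDerivAt (fun s => ∫ t in a..b, L t s) (∫ t in a..b, L' t 0) 0 := by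
  have hsl : ∀ {M : ℝ → ℝ → ℝ}, ContinuousOn (fun p : ℝ × ℝ => M p.1 p.2) (Icc a b ×ˢ univ) →
      ∀ s, ContinuousOn (fun t => M t s) (Icc a b) := by
    intro M hM s
    exact hM.comp (f := fun t => (t, s)) (by fun_prop) (fun t ht => ⟨ht, mem_univ _⟩)
  have hii : ∀ {M : ℝ → ℝ → ℝ}, ContinuousOn (fun p : ℝ × ℝ => M p.1 p.2) (Icc a b ×ˢ univ) →
      ∀ s, IntervalIntegrable (fun t => M t s) volume a b := by
    intro M hM s
    exact ((hsl hM s).mono (by rw [uIcc_of_le hab])).intervalIntegrable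
  obtain ⟨C, hC⟩ := ((isCompact_Icc (a := a) (b := b)).prod
    (isCompact_closedBall (0 : ℝ) 1)).exists_bound_of_continuousOn
      (hL'.mono (prod_mono_right (subset_univ _)))
  have hsub : uIoc a b ⊆ Icc a b := by rw [uIoc_of_le hab]; exact Ioc_subset_Icc_self
  refine (intervalIntegral.hasDerivAt_integral_of_dominated_loc_of_deriv_le
    (F := fun s t => L t s) (F' := fun s t => L' t s) (bound := fun _ => C)
    (Metric.closedBall_mem_nhds (0 : ℝ) one_pos) ?_ (hii hL 0) ?_ ?_ ?_ ?_).2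
  · exact .of_forall fun s => (hii hL s).aestronglyMeasurable_restrict_uIoc
  · exact (hii hL' 0).aestronglyMeasurable_restrict_uIoc
  · exact .of_forall fun t ht s hs => hC (t, s) ⟨hsub ht, hs⟩
  · simp
  · exact .of_forall fun t ht s _ => hd t (hsub ht) s

section Partial

variable {E : Type*} [NormedAddCommGroup E] [NormedSpace ℝ E] {G : ℝ × ℝ → E}

lemma partial_fst (hG : ContDiff ℝ (⊤ : ℕ∞) G) (t s : ℝ) :
    HasDerivAt (fun t => G (t, s)) (fderiv ℝ G (t, s) (1, 0)) t := by
  have h1 : HasFDerivAt G (fderiv ℝ G (t, s)) (t, s) :=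
    ((hG.differentiable (by simp)) (t, s)).hasFDerivAt
  have h2 : HasDerivAt (fun t : ℝ => (t, s)) ((1 : ℝ), (0 : ℝ)) t :=
    (hasDerivAt_id t).prodMk (hasDerivAt_const t s)
  exact HasFDerivAt.comp_hasDerivAt (f := fun t : ℝ => (t, s)) t h1 h2

lemma partial_snd (hG : ContDiff ℝ (⊤ : ℕ∞) G) (t s : ℝ) :
    HasDerivAt (fun s => G (t, s)) (fderiv ℝ G (t, s) (0, 1)) s := by
  have h1 : HasFDerivAt G (fderiv ℝ G (t, s)) (t, s) :=
    ((hG.differentiable (by simp)) (t, s)).hasFDerivAt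
  have h2 : HasDerivAt (fun s : ℝ => (t, s)) ((0 : ℝ), (1 : ℝ)) s :=
    (hasDerivAt_const s t).prodMk (hasDerivAt_id s)
  exact HasFDerivAt.comp_hasDerivAt (f := fun s : ℝ => (t, s)) s h1 h2

lemma partial_fst_snd (hG : ContDiff ℝ (⊤ : ℕ∞) G) (t s : ℝ) :
    HasDerivAt (fun s => fderiv ℝ G (t, s) (1, 0))
      (fderiv ℝ (fderiv ℝ G) (t, s) (0, 1) (1, 0)) s := by
  have hdG : ContDiff ℝ (⊤ : ℕ∞) (fderiv ℝ G) := hG.fderiv_right (by simp)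
  have := (partial_snd hdG t s).clm_apply (hasDerivAt_const s ((1 : ℝ), (0 : ℝ)))
  rwa [map_zero, add_zero] at this

lemma partial_snd_fst (hG : ContDiff ℝ (⊤ : ℕ∞) G) (t s : ℝ) :
    HasDerivAt (fun t => fderiv ℝ G (t, s) (0, 1))
      (fderiv ℝ (fderiv ℝ G) (t, s) (0, 1) (1, 0)) t := by
  have hdG : ContDiff ℝ (⊤ : ℕ∞) (fderiv ℝ G) := hG.fderiv_right (by simp)
  have := (partial_fst hdG t s).clm_apply (hasDerivAt_const t ((0 : ℝ), (1 : ℝ)))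
  have sy : IsSymmSndFDerivAt ℝ G (t, s) := 
    hG.contDiffAt.isSymmSndFDerivAt (by
      rw [minSmoothness_of_isRCLikeNormedField]
      exact WithTop.coe_le_coe.2 (le_top : (2 : ℕ∞) ≤ ⊤))
  rw [sy (0, 1) (1, 0)]
  rwa [map_zero, add_zero] at this

end Partial

set_option maxHeartbeats 1000000 in
lemma deriv_action {n k : ℕ} {U₀ : Set (Phase n)} (hU₀ : IsOpen U₀)
    {H : Phase n → ℝ} (hH : ContDiffOn ℝ (⊤ : ℕ∞) H U₀)
    {γ : ℝ → Phase n} (hγ : ContDiff ℝ (⊤ : ℕ∞) γ) {a b : ℝ} (hab : a ≤ b)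
    {F : ℝ → ℝ → Phase n} (hF : IsVariation n k γ a b F)
    (hFU : ∀ s t, t ∈ Icc a b → F t s ∈ U₀) :
    deriv (fun s => action (alphaH n k H) (fun t => F t s) a b) 0 =
      ∫ t in a..b, elH H γ t (deriv (fun s => F t s) 0) := by
  set G : ℝ × ℝ → Phase n := fun p => F p.1 p.2 with hG
  have hGs : ContDiff ℝ (⊤ : ℕ∞) G := hF.smooth
  have hdG : ContDiff ℝ (⊤ : ℕ∞) (fderiv ℝ G) := hGs.fderiv_right (by simp)
  have hddG : ContDiff ℝ (⊤ : ℕ∞) (fderiv ℝ (fderiv ℝ G)) := hdG.fderiv_right (by simp)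
  -- partial derivatives
  have g1 : ∀ t s, HasDerivAt (fun t => F t s) (fderiv ℝ G (t, s) (1, 0)) t := partial_fst hGs
  have g2 : ∀ t s, HasDerivAt (fun s => F t s) (fderiv ℝ G (t, s) (0, 1)) s := partial_snd hGs
  have g12 : ∀ t s, HasDerivAt (fun s => fderiv ℝ G (t, s) (1, 0))
      (fderiv ℝ (fderiv ℝ G) (t, s) (0, 1) (1, 0)) s := partial_fst_snd hGs
  have g21 : ∀ t s, HasDerivAt (fun t => fderiv ℝ G (t, s) (0, 1))
      (fderiv ℝ (fderiv ℝ G) (t, s) (0, 1) (1, 0)) t := partial_snd_fst hGs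
  have hact : (fun s => action (alphaH n k H) (fun t => F t s) a b) = fun s =>
      ∫ t in a..b, ((∑ i, (F t s).2 i * (fderiv ℝ G (t, s) (1, 0)).1 i) - H (F t s)) := by
    funext s
    have hs : ContDiff ℝ (⊤ : ℕ∞) (fun t => F t s) :=
      hGs.comp (f := fun t : ℝ => (t, s)) (by fun_prop)
    rw [action_alphaH H hs]
    congr 1
    ext t
    rw [(g1 t s).deriv]
  have hmaps : MapsTo G (Icc a b ×ˢ univ) U₀ := fun p hp => hFU p.2 p.1 hp.1
  have cG : Continuous G := hGs.continuous
  have cdG : Continuous (fderiv ℝ G) := hdG.continuous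
  have cddG : Continuous (fderiv ℝ (fderiv ℝ G)) := hddG.continuous
  have cHG : ContinuousOn (fun p => H (G p)) (Icc a b ×ˢ univ) :=
    hH.continuousOn.comp cG.continuousOn hmaps
  have cdH : ContinuousOn (fderiv ℝ H) U₀ := hH.continuousOn_fderiv_of_isOpen hU₀ (by simp)
  have cdHG : ContinuousOn (fun p => fderiv ℝ H (G p)) (Icc a b ×ˢ univ) :=
    cdH.comp cG.continuousOn hmaps
  have key := hasDerivAt_param hab
    (L := fun t s => (∑ i, (F t s).2 i * (fderiv ℝ G (t, s) (1, 0)).1 i) - H (F t s))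
    (L' := fun t s => (∑ i, ((fderiv ℝ G (t, s) (0, 1)).2 i * (fderiv ℝ G (t, s) (1, 0)).1 i +
      (F t s).2 i * (fderiv ℝ (fderiv ℝ G) (t, s) (0, 1) (1, 0)).1 i)) -
      fderiv ℝ H (F t s) (fderiv ℝ G (t, s) (0, 1)))
    (by
      refine ContinuousOn.sub (Continuous.continuousOn ?_) cHG
      change Continuous fun p : ℝ × ℝ => ∑ i, (G p).2 i * (fderiv ℝ G p (1, 0)).1 i
      fun_prop)
    (by
      refine ContinuousOn.sub (Continuous.continuousOn ?_) (cdHG.clm_apply ?_)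
      · change Continuous fun p : ℝ × ℝ => ∑ i,
          ((fderiv ℝ G p (0, 1)).2 i * (fderiv ℝ G p (1, 0)).1 i +
            (G p).2 i * (fderiv ℝ (fderiv ℝ G) p (0, 1) (1, 0)).1 i)
        fun_prop
      · exact (cdG.clm_apply continuous_const).continuousOn)
    (by
      intro t ht s
      refine (hasDerivAt_dot (g2 t s) (g12 t s)).sub ?_
      have hHd : HasFDerivAt H (fderiv ℝ H (F t s)) (F t s) :=
        ((hH.contDiffAt (hU₀.mem_nhds (hFU s t ht))).differentiableAt (by simp)).hasFDerivAt
      exact hHd.comp_hasDerivAt s (g2 t s))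
  rw [hact, key.deriv]
  -- integrate by parts
  have hγd : ∀ t, HasDerivAt γ (deriv γ t) t := fun t =>
    ((hγ.differentiable (by simp)) t).hasDerivAt
  have hF0 : (fun t => F t 0) = γ := funext hF.init
  have hd1 : ∀ t, fderiv ℝ G (t, 0) (1, 0) = deriv γ t := fun t => by
    rw [← (g1 t 0).deriv, hF0]
  have hend : ∀ c, (∀ s, lift n k (fun t => F t s) c = lift n k γ c) →
      fderiv ℝ G (c, 0) (0, 1) = 0 := by
    intro c hc
    have : (fun s => F c s) = fun _ => γ c := by
      funext s
      have := congrFun (congrArg Prod.snd (hc s)) 0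
      simpa [lift] using this
    rw [← (g2 c 0).deriv, this, deriv_const]
  have cγ' : Continuous (deriv γ) := hγ.continuous_deriv (by simp)
  have cγ : Continuous γ := hγ.continuous
  have cW : Continuous fun t : ℝ =>
      ∑ i, ((deriv γ t).2 i * (fderiv ℝ G (t, 0) (0, 1)).1 i +
        (γ t).2 i * (fderiv ℝ (fderiv ℝ G) (t, 0) (0, 1) (1, 0)).1 i) := by fun_prop
  have ftc := intervalIntegral.integral_eq_sub_of_hasDerivAt (a := a) (b := b)
    (fun t _ => hasDerivAt_dot (hγd t) (g21 t 0)) (cW.intervalIntegrable a b)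
  rw [hend a hF.fix_a, hend b hF.fix_b] at ftc
  have cE : ContinuousOn (fun t => elH H γ t (deriv (fun s => F t s) 0)) (uIcc a b) := by
    rw [uIcc_of_le hab]
    simp only [(g2 _ 0).deriv, elH]
    refine ContinuousOn.sub (Continuous.continuousOn (by fun_prop)) (ContinuousOn.clm_apply ?_ ?_)
    · refine cdH.comp cγ.continuousOn fun t ht => ?_
      rw [← hF.init t]; exact hFU 0 t ht
    · exact (Continuous.clm_apply (by fun_prop) continuous_const).continuousOn
  have := intervalIntegral.integral_add
    (cE.intervalIntegrable (μ := volume)) (cW.intervalIntegrable a b)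
  rw [ftc] at this
  simp only [Prod.fst_zero, Pi.zero_apply, mul_zero, Finset.sum_const_zero, sub_zero, add_zero]
    at this
  rw [← this]
  congr 1
  ext t
  rw [hd1, hF.init, (g2 t 0).deriv, elH, sub_add_eq_add_sub, ← Finset.sum_add_distrib]
  congr 1
  refine Finset.sum_congr rfl fun i _ => ?_
  ring

lemma elH_smul {n : ℕ} (H : Phase n → ℝ) (γ : ℝ → Phase n) (t c : ℝ) (v : Phase n) :
    elH H γ t (c • v) = c * elH H γ t v := by
  simp only [elH, map_smul, mul_sub, Finset.mul_sum, smul_eq_mul, Prod.smul_fst, Prod.smul_snd,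
    Pi.smul_apply]
  congr 1
  refine Finset.sum_congr rfl fun i _ => ?_
  ring

lemma clm_basis {n : ℕ} (A : Phase n →L[ℝ] ℝ) (v : Phase n) :
    A v = ∑ i, (v.1 i * A (Pi.single i 1, 0) + v.2 i * A (0, Pi.single i 1)) := by
  have hv : v = ∑ i, (v.1 i • ((Pi.single i 1, 0) : Phase n) +
      v.2 i • ((0, Pi.single i 1) : Phase n)) := by
    ext j
    · simp [Prod.fst_sum, Finset.sum_apply, Pi.single_apply]
    · simp [Prod.snd_sum, Finset.sum_apply, Pi.single_apply]
  conv_lhs => rw [hv]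
  simp only [map_sum, map_add, map_smul, smul_eq_mul]

lemma deriv_coord {n : ℕ} {γ : ℝ → Phase n} (hγ : ContDiff ℝ (⊤ : ℕ∞) γ) (t : ℝ) (i : Fin n) :
    deriv (fun s => (γ s).1 i) t = (deriv γ t).1 i ∧
      deriv (fun s => (γ s).2 i) t = (deriv γ t).2 i := by
  have h : HasDerivAt γ (deriv γ t) t := ((hγ.differentiable (by simp)) t).hasDerivAt
  exact ⟨(hasDerivAt_pi.1 h.fst i).deriv, (hasDerivAt_pi.1 h.snd i).deriv⟩

lemma vanish_of_vp {n k : ℕ} {U₀ : Set (Phase n)} (hU₀ : IsOpen U₀)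
    {H : Phase n → ℝ} (hH : ContDiffOn ℝ (⊤ : ℕ∞) H U₀)
    {γ : ℝ → Phase n} (hγ : ContDiff ℝ (⊤ : ℕ∞) γ)
    {I : Set ℝ} (hIo : IsOpen I) (hγU : ∀ t ∈ I, γ t ∈ U₀)
    (hvp : SatisfiesVP (alphaH n k H) {u : JetP n k | u.2 0 ∈ U₀} γ I)
    {t₀ : ℝ} (ht₀ : t₀ ∈ I) (v : Phase n) : elH H γ t₀ v = 0 := by
  obtain ⟨r, hr, hrI⟩ := Metric.nhds_basis_closedBall.mem_iff.1 (hIo.mem_nhds ht₀)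
  rw [Real.closedBall_eq_Icc] at hrI
  set a := t₀ - r
  set b := t₀ + r
  have hab : a ≤ b := by simp only [a, b]; linarith
  have cγ : Continuous γ := hγ.continuous
  have cγ' : Continuous (deriv γ) := hγ.continuous_deriv (by simp)
  have cdH : ContinuousOn (fderiv ℝ H) U₀ := hH.continuousOn_fderiv_of_isOpen hU₀ (by simp)
  have cE : ContinuousOn (fun t => elH H γ t v) (Icc a b) := by
    simp only [elH]
    refine ContinuousOn.sub (Continuous.continuousOn (by fun_prop))
      (ContinuousOn.clm_apply ?_ continuousOn_const)
    exact cdH.comp cγ.continuousOn fun t ht => hγU t (hrI ht)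
  have hae : ∀ᵐ t ∂(volume : Measure ℝ), t ∈ Ioo a b → elH H γ t v = 0 := by
    refine isOpen_Ioo.ae_eq_zero_of_integral_contDiff_smul_eq_zero
      ((cE.mono Ioo_subset_Icc_self).locallyIntegrableOn measurableSet_Ioo) ?_
    intro g hg hgc hgs
    have himg : γ '' Icc a b ⊆ U₀ := by
      rintro _ ⟨t, ht, rfl⟩; exact hγU t (hrI ht)
    obtain ⟨δ, hδ, hthick⟩ := (isCompact_Icc.image cγ).exists_thickening_subset_open hU₀ himg
    obtain ⟨C, hC⟩ := hg.continuous.bounded_above_of_compact_support hgc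
    have hC0 : 0 ≤ C := (norm_nonneg _).trans (hC 0)
    obtain ⟨ε, hε, hεδ⟩ : ∃ ε : ℝ, 0 < ε ∧ ε * (C * ‖v‖) < δ := by
      refine ⟨δ / (C * ‖v‖ + 1), by positivity, ?_⟩
      have : 0 ≤ C * ‖v‖ := by positivity
      rw [div_mul_eq_mul_div, div_lt_iff₀ (by positivity)]
      nlinarith
    set F : ℝ → ℝ → Phase n := fun t s => γ t + (Real.sin s * (ε * g t)) • v with hFdef
    have hout : ∀ c, c ∉ Ioo a b → ∀ s, lift n k (fun t => F t s) c = lift n k γ c := by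
      intro c hc s
      have hc' : c ∉ tsupport g := fun h => hc (hgs h)
      have hev : (fun t => F t s) =ᶠ[𝓝 c] γ := by
        filter_upwards [notMem_tsupport_iff_eventuallyEq.1 hc'] with t ht
        simp [hFdef, ht]
      simp only [lift]
      congr 1
      funext j
      exact hev.iteratedDeriv_eq _
    have hvar : IsVariation n k γ a b F := by
      refine ⟨?_, ?_, hout a (by simp), hout b (by simp)⟩
      · simp only [hFdef]
        have h1 : ContDiff ℝ (⊤ : ℕ∞) (fun p : ℝ × ℝ => γ p.1) := hγ.comp contDiff_fst
        have h2 : ContDiff ℝ (⊤ : ℕ∞) (fun p : ℝ × ℝ => g p.1) := hg.comp contDiff_fst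
        have h3 : ContDiff ℝ (⊤ : ℕ∞) (fun p : ℝ × ℝ => Real.sin p.2) :=
          Real.contDiff_sin.comp contDiff_snd
        exact h1.add ((h3.mul (contDiff_const.mul h2)).smul contDiff_const)
      · intro t; simp [hFdef]
    have hFU : ∀ s t, t ∈ Icc a b → F t s ∈ U₀ := by
      intro s t ht
      refine hthick (Metric.mem_thickening_iff.2 ⟨γ t, ⟨t, ht, rfl⟩, ?_⟩)
      rw [dist_eq_norm, hFdef]
      simp only [add_sub_cancel_left]
      rw [norm_smul, norm_mul, norm_mul, Real.norm_of_nonneg hε.le]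
      refine lt_of_le_of_lt ?_ hεδ
      have h1 : ‖Real.sin s‖ ≤ 1 := Real.abs_sin_le_one s
      calc ‖Real.sin s‖ * (ε * ‖g t‖) * ‖v‖ ≤ 1 * (ε * C) * ‖v‖ := by
            gcongr
            exact hC t
        _ = ε * (C * ‖v‖) := by ring
    have h0 := hvp a b hab hrI F hvar (fun s t ht => by simpa [lift] using hFU s t ht)
    rw [deriv_action hU₀ hH hγ hab hvar hFU] at h0
    have hδF : ∀ t, deriv (fun s => F t s) 0 = (ε * g t) • v := by
      intro t
      have := (((Real.hasDerivAt_sin 0).mul_const (ε * g t)).smul_const v).const_add (γ t)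
      simpa [hFdef] using this.deriv
    simp only [hδF, elH_smul, mul_assoc] at h0
    rw [intervalIntegral.integral_const_mul, mul_eq_zero] at h0
    have h0 := h0.resolve_left hε.ne'
    rw [intervalIntegral.integral_of_le hab] at h0
    rw [← h0]
    symm
    simp only [smul_eq_mul]
    refine setIntegral_eq_integral_of_forall_compl_eq_zero fun t ht => ?_
    have : g t = 0 := by
      refine image_eq_zero_of_notMem_tsupport fun h => ht (Ioo_subset_Ioc_self (hgs h))
    simp [this]
  have heq := Measure.eqOn_open_of_ae_eq (μ := (volume : Measure ℝ)) (U := Ioo a b)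
    (f := fun t => elH H γ t v) (g := fun _ => 0)
    ((ae_restrict_iff' measurableSet_Ioo).2 hae) isOpen_Ioo (cE.mono Ioo_subset_Icc_self)
    continuousOn_const
  exact heq (show t₀ ∈ Ioo a b by constructor <;> simp only [a, b] <;> linarith)

end JetP

/-- A curve `γ(t) = (q(t), p(t))` in `U₀` satisfies the variational
principle of the Poincaré–Cartan form `α^H` on `J^k(E)` (`k ≥ 2`) iff it satisfies
Hamilton's equations `q' = ∂H/∂p`, `p' = −∂H/∂q`. -/
theorem stmt15 (n k : ℕ) (hk : 2 ≤ k)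
    (U₀ : Set (Phase n)) (hU₀ : IsOpen U₀)
    (H : Phase n → ℝ) (hH : ContDiffOn ℝ (⊤ : ℕ∞) H U₀)
    (γ : ℝ → Phase n) (hγ : ContDiff ℝ (⊤ : ℕ∞) γ)
    (I : Set ℝ) (hIo : IsOpen I) (hIc : I.OrdConnected)
    (hγU : ∀ t ∈ I, γ t ∈ U₀) :
    JetP.SatisfiesVP (JetP.alphaH n k H) {u : JetP n k | u.2 0 ∈ U₀} γ I ↔
      ∀ t ∈ I, ∀ i : Fin n,
        deriv (fun s => (γ s).1 i) t = fderiv ℝ H (γ t) (0, Pi.single i 1) ∧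
        deriv (fun s => (γ s).2 i) t = -fderiv ℝ H (γ t) (Pi.single i 1, 0) := by
  constructor
  · intro hvp t ht i
    obtain ⟨e1, e2⟩ := JetP.deriv_coord hγ t i
    have h1 := JetP.vanish_of_vp hU₀ hH hγ hIo hγU hvp ht (0, Pi.single i 1)
    have h2 := JetP.vanish_of_vp hU₀ hH hγ hIo hγU hvp ht (Pi.single i 1, 0)
    simp [JetP.elH, Pi.single_apply] at h1 h2
    rw [e1, e2]
    constructor <;> linarith
  · intro hh a b hab hsub F hF hFU
    have hFU' : ∀ s t, t ∈ Icc a b → F t s ∈ U₀ := fun s t ht => by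
      simpa [JetP.lift] using hFU s t ht
    rw [JetP.deriv_action hU₀ hH hγ hab hF hFU']
    rw [intervalIntegral.integral_congr (g := fun _ => (0 : ℝ)), intervalIntegral.integral_zero]
    intro t ht
    rw [uIcc_of_le hab] at ht
    simp only [JetP.elH]
    rw [JetP.clm_basis, ← Finset.sum_sub_distrib]
    refine Finset.sum_eq_zero fun i _ => ?_
    obtain ⟨e1, e2⟩ := JetP.deriv_coord hγ t i
    obtain ⟨d1, d2⟩ := hh t (hsub ht) i
    rw [← e1, ← e2, d1, d2]
    ring
end
end

section
/- Let H : U ⊆ ℝ^(2n) → ℝ and H′ : U′ ⊆ ℝ^(2n) → ℝ be smooth Hamiltonians, and let u ∈ U, u′ ∈ U′ be points of non-degeneracy, i.e. dH_u ≠ 0 and dH′_{u′} ≠ 0. Then for every (finite- or infinite-dimensional) Lie subalgebra g of the Lie algebra sp^H of germs at u of H-symplectic symmetries, there exists a Lie subalgebra g′ of the Lie algebra sp^{H′} of germs at u′ of H′-symplectic symmetries such that g′ is isomorphic to g as a real Lie algebra. -/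
open Set Filter Topology

noncomputable section

/-- The standard symplectic form `Ω = Σᵢ dpᵢ ∧ dqⁱ` on `T*ℝⁿ`. -/
def OmegaStd (n : ℕ) (v w : Phase n) : ℝ :=
  ∑ i : Fin n, (v.2 i * w.1 i - w.2 i * v.1 i)

/-- Lie bracket on germs at a point of vector fields, induced by the Lie bracket
`[X,Y](u) = DY_u(X(u)) − DX_u(Y(u))` of representatives. -/
def germBracket {E : Type*} [NormedAddCommGroup E] [NormedSpace ℝ E] {x : E} :
    (𝓝 x).Germ E → (𝓝 x).Germ E → (𝓝 x).Germ E :=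
  Quotient.map₂ (fun X Y u => fderiv ℝ Y u (X u) - fderiv ℝ X u (Y u))
    (by
      intro X X' hX Y Y' hY
      have hX' : X =ᶠ[𝓝 x] X' := hX
      have hY' : Y =ᶠ[𝓝 x] Y' := hY
      have h1 : fderiv ℝ X =ᶠ[𝓝 x] fderiv ℝ X' := hX'.fderiv
      have h2 : fderiv ℝ Y =ᶠ[𝓝 x] fderiv ℝ Y' := hY'.fderiv
      filter_upwards [hX', hY', h1, h2] with u e1 e2 e3 e4
      simp [e1, e2, e3, e4])

/-- The Lie algebra `sp^H`: germs at `u` of `H`-symplectic symmetries, i.e. of smooth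
vector fields `Y` defined near `u` (inside the domain `U` of `H`) with `L_Y Ω = 0`
(for the constant symplectic form `Ω` this reads `Ω(DY v, v') + Ω(v, DY v') = 0`)
and `ι_Y dH = 0`. -/
def spH (n : ℕ) (H : Phase n → ℝ) (U : Set (Phase n)) (u : Phase n) :
    Set ((𝓝 u).Germ (Phase n)) :=
  {g | ∃ (Y : Phase n → Phase n) (V : Set (Phase n)), IsOpen V ∧ u ∈ V ∧ V ⊆ U ∧
    ContDiffOn ℝ (⊤ : ℕ∞) Y V ∧
    (∀ w ∈ V, ∀ v v' : Phase n,
      OmegaStd n (fderiv ℝ Y w v) v' + OmegaStd n v (fderiv ℝ Y w v') = 0) ∧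
    (∀ w ∈ V, fderiv ℝ H w (Y w) = 0) ∧
    g = (Y : (𝓝 u).Germ (Phase n))}


set_option linter.unusedSectionVars false

section Superposition

variable {K : Type} [TopologicalSpace K] [CompactSpace K]
  {E F : Type} [NormedAddCommGroup E] [NormedSpace ℝ E] [NormedAddCommGroup F] [NormedSpace ℝ F]

/-- Pointwise application as a bounded bilinear map. -/
def pwApply (K : Type) [TopologicalSpace K] [CompactSpace K]
    (E F : Type) [NormedAddCommGroup E] [NormedSpace ℝ E] [NormedAddCommGroup F]
    [NormedSpace ℝ F] : C(K, E →L[ℝ] F) →L[ℝ] C(K, E) →L[ℝ] C(K, F) :=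
  LinearMap.mkContinuous₂
    (LinearMap.mk₂ ℝ (fun (A : C(K, E →L[ℝ] F)) (h : C(K, E)) =>
        (⟨fun t => A t (h t), by fun_prop⟩ : C(K, F)))
      (by intros; ext; simp) (by intros; ext; simp) (by intros; ext; simp)
      (by intros; ext; simp)) 1
    (by
      intro A h
      rw [ContinuousMap.norm_le _ (by positivity)]
      intro t
      simp only [LinearMap.mk₂_apply, ContinuousMap.coe_mk, one_mul]
      exact ((A t).le_opNorm _).trans (mul_le_mul (A.norm_coe_le_norm t) (h.norm_coe_le_norm t)
        (norm_nonneg _) (norm_nonneg A)))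

theorem pwApply_apply (A : C(K, E →L[ℝ] F)) (h : C(K, E)) (t : K) :
    pwApply K E F A h t = A t (h t) := rfl

theorem hasFDerivAt_postcomp (X : C(E, F)) (X' : C(E, E →L[ℝ] F))
    (hX : ∀ x, HasFDerivAt X (X' x) x) (γ : C(K, E)) :
    HasFDerivAt (fun γ : C(K, E) => X.comp γ) (pwApply K E F (X'.comp γ)) γ := by
  rw [hasFDerivAt_iff_isLittleO_nhds_zero, Asymptotics.isLittleO_iff]
  intro c hc
  have hcont : Continuous (fun γ : C(K, E) => X'.comp γ) := X'.continuous_postcomp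
  obtain ⟨δ, hδ, hball⟩ := (Metric.continuousAt_iff
    (f := fun γ : C(K, E) => X'.comp γ) (a := γ)).1 hcont.continuousAt c hc
  have key : ∀ t : K, ∀ y ∈ Metric.ball (γ t) δ, ‖X' y - X' (γ t)‖ ≤ c := by
    intro t y hy
    have h1 : dist (γ + ContinuousMap.const K (y - γ t)) γ < δ := by
      rw [dist_eq_norm, add_sub_cancel_left]
      refine lt_of_le_of_lt ?_ (mem_ball_iff_norm.1 hy)
      rw [ContinuousMap.norm_le _ (norm_nonneg _)]
      intro _; simp
    have h2 := hball h1
    have h3 := (ContinuousMap.dist_apply_le_dist t).trans h2.le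
    simpa [dist_eq_norm] using h3
  filter_upwards [Metric.ball_mem_nhds (0 : C(K, E)) hδ] with h hh
  have hh' : ‖h‖ < δ := by simpa using hh
  rw [ContinuousMap.norm_le _ (by positivity)]
  intro t
  have ht : ‖h t‖ ≤ ‖h‖ := h.norm_coe_le_norm t
  have := (convex_ball (γ t) δ).norm_image_sub_le_of_norm_hasFDerivWithin_le'
    (f := X) (f' := X') (φ := X' (γ t)) (C := c) (x := γ t) (y := γ t + h t)
    (fun y _ => (hX y).hasFDerivWithinAt) (key t) (Metric.mem_ball_self hδ)
    (by simpa using lt_of_le_of_lt ht hh')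
  simp only [add_sub_cancel_left] at this
  refine this.trans ?_
  gcongr

theorem contDiff_postcomp_nat (n : ℕ) :
    ∀ {F : Type} [NormedAddCommGroup F] [NormedSpace ℝ F] (X : C(E, F)),
      ContDiff ℝ n X → ContDiff ℝ n (fun γ : C(K, E) => X.comp γ) := by
  induction n with
  | zero =>
    intro F _ _ X _
    simpa using X.continuous_postcomp
  | succ n ih =>
    intro F _ _ X hX
    have hX' : ContDiff ℝ ((n : ℕ∞) + 1) X := by exact_mod_cast hX
    have hX2 := contDiff_succ_iff_fderiv.1 hX'
    have := contDiff_succ_iff_hasFDerivAt (𝕜 := ℝ) (n := n)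
      (f := fun γ : C(K, E) => X.comp γ)
    have hpw : ContDiff ℝ n (pwApply K E F) := by
      exact ContinuousLinearMap.contDiff (𝕜 := ℝ) (E := C(K, E →L[ℝ] F))
        (F := C(K, E) →L[ℝ] C(K, F)) (pwApply K E F)
    have goal := this.2 ⟨fun γ => pwApply K E F
      ((⟨fderiv ℝ X, hX2.2.2.continuous⟩ : C(E, E →L[ℝ] F)).comp γ),
      ContDiff.comp (g := pwApply K E F) hpw (ih ⟨fderiv ℝ X, hX2.2.2.continuous⟩ hX2.2.2),
      fun γ => hasFDerivAt_postcomp X _ (fun x => (hX2.1 x).hasFDerivAt) γ⟩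
    exact_mod_cast goal

theorem contDiff_postcomp (X : C(E, F)) (hX : ContDiff ℝ (⊤ : ℕ∞) X) :
    ContDiff ℝ (⊤ : ℕ∞) (fun γ : C(K, E) => X.comp γ) := by
  rw [contDiff_infty]
  intro n
  exact contDiff_postcomp_nat n X (hX.of_le (by exact_mod_cast le_top))

end Superposition

section Implicit

variable {E₁ E₂ F : Type} [NormedAddCommGroup E₁] [NormedSpace ℝ E₁] [CompleteSpace E₁]
  [NormedAddCommGroup E₂] [NormedSpace ℝ E₂] [CompleteSpace E₂]
  [NormedAddCommGroup F] [NormedSpace ℝ F] [CompleteSpace F]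

theorem eventually_contDiffAt_implicit {u : E₁ × E₂} {f : E₁ × E₂ → F}
    (hf : ContDiff ℝ (⊤ : ℕ∞) f) (cdf : ContDiffAt ℝ (⊤ : ℕ∞) f u)
    (pn : ((⊤ : ℕ∞) : WithTop ℕ∞) ≠ 0)
    (if₂ : (fderiv ℝ f u ∘L .inr ℝ E₁ E₂).IsInvertible) :
    ∀ᶠ x in 𝓝 u.1, ContDiffAt ℝ (⊤ : ℕ∞) (cdf.implicitFunction pn if₂) x := by
  set ψ := cdf.implicitFunction pn if₂ with hψ
  have h0 : ψ u.1 = u.2 := cdf.implicitFunction_apply_self pn if₂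
  have hc : ContinuousAt ψ u.1 := (cdf.contDiffAt_implicitFunction pn if₂).continuousAt
  have hc2 : Tendsto (fun x => (x, ψ x)) (𝓝 u.1) (𝓝 u) := by
    have h : ContinuousAt (fun x => (x, ψ x)) u.1 := continuousAt_id.prodMk hc
    have h' := h.tendsto
    simp only [h0] at h'
    exact h'
  have hinv : ∀ᶠ v in 𝓝 u, (fderiv ℝ f v ∘L .inr ℝ E₁ E₂).IsInvertible := by
    have hcont : Continuous (fun v => fderiv ℝ f v ∘L .inr ℝ E₁ E₂) :=
      (hf.continuous_fderiv (by simp)).clm_comp continuous_const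
    obtain ⟨e, he⟩ := if₂
    have := hcont.continuousAt (x := u)
    have h2 := this.eventually (p := fun A => A.IsInvertible) (by
      simp only
      rw [← he]
      filter_upwards [ContinuousLinearEquiv.nhds e] with A hA
      obtain ⟨e', he'⟩ := hA
      exact ⟨e', he'⟩)
    exact h2
  have hiff := (cdf.eventually_apply_eq_iff_implicitFunction pn if₂).eventually_nhds
  filter_upwards [hc2.eventually hinv, hc2.eventually hiff,
    cdf.eventually_apply_implicitFunction pn if₂] with x hx1 hx2 hx3
  have cdf1 : ContDiffAt ℝ (⊤ : ℕ∞) f (x, ψ x) := hf.contDiffAt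
  set ψ₁ := cdf1.implicitFunction pn hx1
  have h1 : ContDiffAt ℝ (⊤ : ℕ∞) ψ₁ x := cdf1.contDiffAt_implicitFunction pn hx1
  have h10 : ψ₁ x = ψ x := cdf1.implicitFunction_apply_self pn hx1
  refine h1.congr_of_eventuallyEq ?_
  have h3 : Tendsto (fun y => (y, ψ₁ y)) (𝓝 x) (𝓝 (x, ψ x)) := by
    have h : ContinuousAt (fun y => (y, ψ₁ y)) x := continuousAt_id.prodMk h1.continuousAt
    have h' := h.tendsto
    simp only [h10] at h'
    exact h'
  filter_upwards [h3.eventually hx2, cdf1.eventually_apply_implicitFunction pn hx1] with y hy1 hy2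
  exact hy1.1 (hy2.trans hx3)

end Implicit

section Flow

variable {E : Type} [NormedAddCommGroup E] [NormedSpace ℝ E] [CompleteSpace E]

abbrev II : Type := Icc (0 : ℝ) 1

def extI (γ : C(II, E)) (ρ : ℝ) : E := γ (projIcc 0 1 zero_le_one ρ)

theorem continuous_extI (γ : C(II, E)) : Continuous (extI γ) :=
  γ.continuous.comp continuous_projIcc

/-- Integration from `0`. -/
def intOp (E : Type) [NormedAddCommGroup E] [NormedSpace ℝ E] [CompleteSpace E] :
    C(II, E) →L[ℝ] C(II, E) :=
  LinearMap.mkContinuous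
    { toFun := fun γ => ⟨fun r => ∫ ρ in (0 : ℝ)..r, extI γ ρ,
        (intervalIntegral.continuous_primitive
          (fun a b => (continuous_extI γ).intervalIntegrable a b) 0).comp continuous_subtype_val⟩
      map_add' := by
        intro γ η; ext r
        exact intervalIntegral.integral_add ((continuous_extI γ).intervalIntegrable _ _)
          ((continuous_extI η).intervalIntegrable _ _)
      map_smul' := by
        intro c γ; ext r
        exact intervalIntegral.integral_smul c _ } 1
    (by
      intro γ
      rw [ContinuousMap.norm_le _ (by positivity)]
      intro r
      have := intervalIntegral.norm_integral_le_of_norm_le_const (a := 0) (b := (r : ℝ))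
        (f := extI γ) (C := ‖γ‖) (fun x _ => γ.norm_coe_le_norm _)
      refine this.trans ?_
      have h0 := r.2.1
      have h1 := r.2.2
      rw [sub_zero, abs_of_nonneg h0, one_mul]
      exact mul_le_of_le_one_right (norm_nonneg _) h1)

theorem intOp_apply (γ : C(II, E)) (r : II) : intOp E γ r = ∫ ρ in (0 : ℝ)..r, extI γ ρ := rfl

/-- constant paths -/
def constOp (E : Type) [NormedAddCommGroup E] [NormedSpace ℝ E] : E →L[ℝ] C(II, E) :=
  LinearMap.mkContinuous
    { toFun := fun x => ContinuousMap.const II x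
      map_add' := by intros; ext; simp
      map_smul' := by intros; ext; simp } 1
    (by
      intro x
      rw [ContinuousMap.norm_le _ (by positivity)]
      intro r; simp)

theorem constOp_apply (x : E) (r : II) : constOp E x r = x := rfl

/-- scaling of the unit interval -/
def scaleI (r : II) : C(II, II) := ⟨fun ρ => r * ρ, by fun_prop⟩

def flowEq (X : C(E, E)) (p : (ℝ × E) × C(II, E)) : C(II, E) :=
  p.2 - constOp E p.1.2 - p.1.1 • intOp E (X.comp p.2)

theorem contDiff_flowEq (X : C(E, E)) (hX : ContDiff ℝ (⊤ : ℕ∞) X) :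
    ContDiff ℝ (⊤ : ℕ∞) (flowEq X) := by
  have h := contDiff_postcomp (K := II) X hX
  have h1 : ContDiff ℝ (⊤ : ℕ∞) (fun p : (ℝ × E) × C(II, E) => intOp E (X.comp p.2)) :=
    (intOp E).contDiff.comp (h.comp contDiff_snd)
  have h2 : ContDiff ℝ (⊤ : ℕ∞) (fun p : (ℝ × E) × C(II, E) => constOp E p.1.2) :=
    (constOp E).contDiff.comp (contDiff_snd.comp contDiff_fst)
  exact (contDiff_snd.sub h2).sub ((contDiff_fst.comp contDiff_fst).smul h1)

theorem flowEq_scale (X : C(E, E)) (s : ℝ) (x : E) (γ : C(II, E)) (h : flowEq X ((s, x), γ) = 0)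
    (r : II) : flowEq X ((r * s, x), γ.comp (scaleI r)) = 0 := by
  ext ρ
  have h1 := congrArg (fun f : C(II, E) => f (scaleI r ρ)) h
  simp only [flowEq, ContinuousMap.sub_apply, ContinuousMap.smul_apply, constOp_apply,
    intOp_apply, ContinuousMap.zero_apply, ContinuousMap.comp_apply] at h1 ⊢
  rw [← h1, mul_comm, mul_smul]
  congr 2
  have h2 : EqOn (extI (X.comp (γ.comp (scaleI r)))) (fun τ => extI (X.comp γ) (r * τ))
      (uIcc 0 (ρ : ℝ)) := by
    intro τ hτ
    rw [uIcc_of_le ρ.2.1] at hτ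
    have hτ' : τ ∈ Icc (0 : ℝ) 1 := ⟨hτ.1, hτ.2.trans ρ.2.2⟩
    have hrτ : (r : ℝ) * τ ∈ Icc (0 : ℝ) 1 := (r * ⟨τ, hτ'⟩ : II).2
    simp only [extI, projIcc_of_mem _ hτ', projIcc_of_mem _ hrτ, ContinuousMap.comp_apply]
    rfl
  rw [intervalIntegral.integral_congr h2, intervalIntegral.smul_integral_comp_mul_left]
  simp [scaleI]

theorem exists_flow (X : E → E) (hX : ContDiff ℝ (⊤ : ℕ∞) X) (u : E) :
    ∃ φ : ℝ × E → E, (∀ᶠ p in 𝓝 ((0 : ℝ), u), ContDiffAt ℝ (⊤ : ℕ∞) φ p) ∧ (∀ᶠ x in 𝓝 u, φ (0, x) = x) ∧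
      ∀ᶠ p in 𝓝 ((0 : ℝ), u), HasDerivAt (fun t => φ (t, p.2)) (X (φ p)) p.1 := by
  set Xc : C(E, E) := ⟨X, hX.continuous⟩
  set b : (ℝ × E) × C(II, E) := ((0, u), constOp E u)
  have hG := contDiff_flowEq Xc hX
  have hb : flowEq Xc b = 0 := by simp [flowEq, b]
  have hinv : (fderiv ℝ (flowEq Xc) b ∘L .inr ℝ (ℝ × E) C(II, E)).IsInvertible := by
    have : fderiv ℝ (flowEq Xc) b ∘L .inr ℝ (ℝ × E) C(II, E) = ContinuousLinearMap.id ℝ _ := by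
      have h1 : HasFDerivAt (fun γ : C(II, E) => flowEq Xc ((0, u), γ))
          (fderiv ℝ (flowEq Xc) b ∘L .inr ℝ (ℝ × E) C(II, E)) (constOp E u) :=
        ((hG.differentiable (by simp)) b).hasFDerivAt.comp (constOp E u)
          (hasFDerivAt_prodMk_right (0, u) (constOp E u))
      have h2 : HasFDerivAt (fun γ : C(II, E) => flowEq Xc ((0, u), γ))
          (ContinuousLinearMap.id ℝ _) (constOp E u) := by
        simp only [flowEq, zero_smul, sub_zero]
        exact (hasFDerivAt_id _).sub_const _
      exact h1.unique h2
    rw [this]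
    exact ⟨ContinuousLinearEquiv.refl ℝ _, rfl⟩
  have cda : ContDiffAt ℝ (⊤ : ℕ∞) (flowEq Xc) b := hG.contDiffAt
  have pn : ((⊤ : ℕ∞) : WithTop ℕ∞) ≠ 0 := by simp
  set ψ := cda.implicitFunction pn hinv
  have hψ0 : ψ (0, u) = constOp E u := cda.implicitFunction_apply_self pn hinv
  have hψc : ContDiffAt ℝ (⊤ : ℕ∞) ψ (0, u) := cda.contDiffAt_implicitFunction pn hinv
  have hψe : ∀ᶠ p in 𝓝 ((0 : ℝ), u), flowEq Xc (p, ψ p) = 0 := by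
    have := cda.eventually_apply_implicitFunction pn hinv
    rwa [hb] at this
  have hψi : ∀ᶠ v in 𝓝 b, flowEq Xc v = 0 ↔ ψ v.1 = v.2 := by
    have := cda.eventually_apply_eq_iff_implicitFunction pn hinv
    rwa [hb] at this
  let one : II := ⟨1, by simp⟩
  have hψt : Tendsto ψ (𝓝 (0, u)) (𝓝 (constOp E u)) := hψ0 ▸ hψc.continuousAt
  -- a product neighbourhood
  obtain ⟨ε, hε, hball⟩ := Metric.eventually_nhds_iff_ball.1 hψi
  have hN : ∀ᶠ p in 𝓝 ((0 : ℝ), u), p ∈ Metric.ball ((0 : ℝ), u) ε ∧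
      ψ p ∈ Metric.ball (constOp E u) ε ∧ flowEq Xc (p, ψ p) = 0 :=
    Filter.Eventually.and (Metric.ball_mem_nhds _ hε)
      (Filter.Eventually.and (hψt (Metric.ball_mem_nhds _ hε)) hψe)
  obtain ⟨δ, hδ, hδb⟩ := Metric.eventually_nhds_iff_ball.1 hN
  have hscale : ∀ s x, (s, x) ∈ Metric.ball ((0 : ℝ), u) δ → ∀ r : II,
      ψ (r * s, x) one = ψ (s, x) r := by
    intro s x hp r
    obtain ⟨h1, h2, h3⟩ := hδb _ hp
    have h4 := flowEq_scale Xc s x _ h3 r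
    have h5 : ((r * s, x), (ψ (s, x)).comp (scaleI r)) ∈ Metric.ball b ε := by
      rw [Metric.mem_ball, Prod.dist_eq, max_lt_iff, Prod.dist_eq, max_lt_iff]
      rw [Metric.mem_ball, Prod.dist_eq, max_lt_iff] at h1
      refine ⟨⟨?_, h1.2⟩, ?_⟩
      · refine lt_of_le_of_lt ?_ h1.1
        simp only [b, dist_zero_right, norm_mul, Real.norm_eq_abs, abs_of_nonneg r.2.1]
        exact mul_le_of_le_one_left (abs_nonneg _) r.2.2
      · refine lt_of_le_of_lt ?_ h2
        rw [ContinuousMap.dist_le dist_nonneg]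
        intro ρ
        exact ContinuousMap.dist_apply_le_dist (f := ψ (s, x)) (g := constOp E u) (scaleI r ρ)
    have h6 := (hball _ h5).1 h4
    simp only at h6
    rw [h6]
    simp [scaleI, one]
  have hint : ∀ s x, (s, x) ∈ Metric.ball ((0 : ℝ), u) δ →
      ψ (s, x) one = x + ∫ τ in (0 : ℝ)..s, X (ψ (τ, x) one) := by
    intro s x hp
    have h3 := (hδb _ hp).2.2
    have h1 := congrArg (fun f : C(II, E) => f one) h3
    simp only [flowEq, ContinuousMap.sub_apply, ContinuousMap.smul_apply, constOp_apply,
      intOp_apply, ContinuousMap.zero_apply] at h1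
    have h2 : EqOn (extI (Xc.comp (ψ (s, x)))) (fun τ => X (ψ (τ * s, x) one))
        (uIcc 0 (one : ℝ)) := by
      intro τ hτ
      rw [uIcc_of_le one.2.1] at hτ
      have hτ' : τ ∈ Icc (0 : ℝ) 1 := hτ
      simp only [extI, projIcc_of_mem _ hτ', ContinuousMap.comp_apply]
      rw [← hscale s x hp ⟨τ, hτ'⟩]
      rfl
    rw [intervalIntegral.integral_congr h2,
      intervalIntegral.smul_integral_comp_mul_right (fun τ => X (ψ (τ, x) one))] at h1
    rw [sub_sub, sub_eq_zero] at h1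
    simpa [one] using h1
  refine ⟨fun p => ψ p one, ?_, ?_, ?_⟩
  · filter_upwards [eventually_contDiffAt_implicit hG cda pn hinv] with p hp
    exact (ContinuousMap.evalCLM ℝ one).contDiff.contDiffAt.comp _ hp
  · have : ∀ᶠ x in 𝓝 u, ((0 : ℝ), x) ∈ Metric.ball ((0 : ℝ), u) δ :=
      (Continuous.prodMk_right (0 : ℝ)).continuousAt.eventually (Metric.ball_mem_nhds _ hδ)
    filter_upwards [this] with x hx
    simpa using hint 0 x hx
  · have hc : ∀ᶠ p in 𝓝 ((0 : ℝ), u), ContinuousAt ψ p :=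
      ((hψc.of_le (m := 1) (by exact_mod_cast le_top)).eventually (by simp)).mono fun p hp => hp.continuousAt
    obtain ⟨δ', hδ', hc'⟩ := Metric.eventually_nhds_iff_ball.1 hc
    have hmin : 0 < min δ δ' := lt_min hδ hδ'
    filter_upwards [Metric.ball_mem_nhds _ hmin] with p hp
    obtain ⟨s, x⟩ := p
    have hmem : ∀ t : ℝ, |t| < min δ δ' → (t, x) ∈ Metric.ball ((0 : ℝ), u) (min δ δ') := by
      intro t ht
      rw [Metric.mem_ball, Prod.dist_eq, max_lt_iff] at hp ⊢
      exact ⟨by simpa using ht, hp.2⟩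
    have hs : |s| < min δ δ' := by
      rw [Metric.mem_ball, Prod.dist_eq, max_lt_iff] at hp
      simpa using hp.1
    have hca : ∀ t : ℝ, |t| < min δ δ' → ContinuousAt (fun τ => X (ψ (τ, x) one)) t := by
      intro t ht
      have h1 := hc' _ (Metric.ball_subset_ball (min_le_right _ _) (hmem t ht))
      have h2 : ContinuousAt (fun τ : ℝ => ψ (τ, x)) t :=
        ContinuousAt.comp (f := fun τ : ℝ => (τ, x)) h1 (by fun_prop)
      exact hX.continuous.continuousAt.comp
        ((ContinuousMap.evalCLM ℝ one).continuous.continuousAt.comp h2)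
    have hsub : ∀ t ∈ uIcc 0 s, |t| < min δ δ' := by
      intro t ht
      refine lt_of_le_of_lt ?_ hs
      have := abs_sub_left_of_mem_uIcc ht
      simpa using this
    have hder : HasDerivAt (fun t => x + ∫ τ in (0 : ℝ)..t, X (ψ (τ, x) one))
        (X (ψ (s, x) one)) s := by
      refine HasDerivAt.const_add x ?_
      refine intervalIntegral.integral_hasDerivAt_right ?_ ?_ (hca s hs)
      · exact ContinuousOn.intervalIntegrable
          (fun t ht => (hca t (hsub t ht)).continuousWithinAt)
      · have hop : IsOpen {t : ℝ | |t| < min δ δ'} := isOpen_lt continuous_abs continuous_const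
        exact ContinuousOn.stronglyMeasurableAtFilter hop
          (fun t ht => (hca t ht).continuousWithinAt) s hs
    refine hder.congr_of_eventuallyEq ?_
    have hop : IsOpen {t : ℝ | |t| < min δ δ'} := isOpen_lt continuous_abs continuous_const
    filter_upwards [hop.mem_nhds hs] with t ht
    exact hint t x (Metric.ball_subset_ball (min_le_left _ _) (hmem t ht))

end Flow

section Straighten

variable {E : Type} [NormedAddCommGroup E] [NormedSpace ℝ E] [CompleteSpace E]

theorem two_le_smooth : (2 : WithTop ℕ∞) ≤ ((⊤ : ℕ∞) : WithTop ℕ∞) := by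
  exact WithTop.coe_le_coe.2 (le_top : (2 : ℕ∞) ≤ ⊤)

theorem const_on_interval {f : ℝ → ℝ} {δ s : ℝ} (hs : |s| < δ)
    (h : ∀ t, |t| < δ → HasDerivAt f 0 t) : f s = f 0 := by
  have hδ : 0 < δ := lt_of_le_of_lt (abs_nonneg _) hs
  have hmem : ∀ t, t ∈ Metric.ball (0 : ℝ) δ ↔ |t| < δ := by intro t; simp
  refine (Metric.isOpen_ball (x := (0 : ℝ)) (ε := δ)).is_const_of_deriv_eq_zero
    (convex_ball (0 : ℝ) δ).isPreconnected
    (fun t ht => (h t ((hmem t).1 ht)).differentiableAt.differentiableWithinAt)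
    (fun t ht => (h t ((hmem t).1 ht)).deriv) ((hmem s).2 hs) (by simpa using hδ)

theorem flow_symplectic (ω : E →L[ℝ] E →L[ℝ] ℝ) (hω : ∀ v w, ω v w = - ω w v)
    (J : (E →L[ℝ] ℝ) →L[ℝ] E) (hJ : ∀ α y, ω (J α) y = - α y)
    (H : E → ℝ) (hH : ContDiff ℝ (⊤ : ℕ∞) H) (u : E) :
    ∃ φ : ℝ × E → E, (∀ᶠ p in 𝓝 ((0 : ℝ), u), ContDiffAt ℝ (⊤ : ℕ∞) φ p) ∧ φ (0, u) = u ∧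
      ∀ᶠ p in 𝓝 ((0 : ℝ), u), H (φ p) = H p.2 ∧
        fderiv ℝ φ p (1, 0) = J (fderiv ℝ H (φ p)) ∧
        ∀ v w, ω (fderiv ℝ φ p (0, v)) (fderiv ℝ φ p (0, w)) = ω v w := by
  set X : E → E := fun x => J (fderiv ℝ H x) with hXdef
  have hdH : ContDiff ℝ (⊤ : ℕ∞) (fderiv ℝ H) := hH.fderiv_right (by simp)
  have hX : ContDiff ℝ (⊤ : ℕ∞) X := J.contDiff.comp hdH
  have hDX : ∀ x v, fderiv ℝ X x v = J (fderiv ℝ (fderiv ℝ H) x v) := by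
    intro x v
    have h1 : HasFDerivAt X (J ∘L fderiv ℝ (fderiv ℝ H) x) x :=
      J.hasFDerivAt.comp x ((hdH.differentiable (by simp)) x).hasFDerivAt
    rw [h1.fderiv]; rfl
  have hDXs : ∀ x v w, ω (fderiv ℝ X x v) w + ω v (fderiv ℝ X x w) = 0 := by
    intro x v w
    have hs : IsSymmSndFDerivAt ℝ H x :=
      (hH.contDiffAt (x := x)).isSymmSndFDerivAt (by simpa using two_le_smooth)
    rw [hω v, hDX, hDX, hJ, hJ, hs.eq v w]
    ring
  obtain ⟨φ, hφ, hφ0, hφt⟩ := exists_flow X hX u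
  refine ⟨φ, hφ, hφ0.self_of_nhds, ?_⟩
  have hφ0' : ∀ᶠ p in 𝓝 ((0 : ℝ), u), ∀ᶠ x in 𝓝 p.2, φ (0, x) = x :=
    (continuous_snd.continuousAt (x := ((0 : ℝ), u))).eventually hφ0.eventually_nhds
  obtain ⟨δ, hδ, hball⟩ := Metric.eventually_nhds_iff_ball.1
    ((hφ.eventually_nhds.and hφt.eventually_nhds).and hφ0')
  have hcd : ∀ p ∈ Metric.ball ((0 : ℝ), u) δ, ContDiffAt ℝ (⊤ : ℕ∞) φ p := fun p hp =>
    (hball p hp).1.1.self_of_nhds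
  have hd1 : ∀ p, p ∈ Metric.ball ((0 : ℝ), u) δ → HasFDerivAt φ (fderiv ℝ φ p) p :=
    fun p hp => ((hcd p hp).differentiableAt (by simp)).hasFDerivAt
  have hline : ∀ t x, HasFDerivAt (fun y : E => ((t : ℝ), y)) (ContinuousLinearMap.inr ℝ ℝ E) x :=
    fun t x => hasFDerivAt_prodMk_right t x
  have hlt : ∀ (t : ℝ) (x : E), HasDerivAt (fun τ : ℝ => (τ, x)) ((1 : ℝ), (0 : E)) t :=
    fun t x => (hasDerivAt_id t).prodMk (hasDerivAt_const t x)
  have hvel : ∀ q, ContDiffAt ℝ (⊤ : ℕ∞) φ q →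
      HasDerivAt (fun t => φ (t, q.2)) (X (φ q)) q.1 → fderiv ℝ φ q (1, 0) = X (φ q) := by
    intro q hq hq2
    have h1 : HasFDerivAt φ (fderiv ℝ φ q) (q.1, q.2) :=
      (hq.differentiableAt (by simp)).hasFDerivAt
    exact (h1.comp_hasDerivAt q.1 (hlt q.1 q.2)).unique hq2
  filter_upwards [Metric.ball_mem_nhds _ hδ] with p hp
  obtain ⟨s, x⟩ := p
  have hmem : ∀ t : ℝ, |t| < δ → (t, x) ∈ Metric.ball ((0 : ℝ), u) δ := by
    intro t ht
    rw [Metric.mem_ball, Prod.dist_eq, max_lt_iff] at hp ⊢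
    exact ⟨by simpa using ht, hp.2⟩
  have hs : |s| < δ := by
    rw [Metric.mem_ball, Prod.dist_eq, max_lt_iff] at hp
    simpa using hp.1
  have h0 : φ (0, x) = x := (hball _ hp).2.self_of_nhds
  have h0' : ∀ v, fderiv ℝ φ (0, x) (0, v) = v := by
    intro v
    have hm := hmem 0 (by simpa using hδ)
    have h1 : HasFDerivAt (fun y => φ (0, y)) (fderiv ℝ φ (0, x) ∘L .inr ℝ ℝ E) x :=
      HasFDerivAt.comp x (hd1 _ hm) (hline 0 x)
    have h2 : HasFDerivAt (fun y => φ (0, y)) (ContinuousLinearMap.id ℝ E) x :=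
      (hasFDerivAt_id x).congr_of_eventuallyEq (hball _ hp).2
    have := h1.unique h2
    simpa using congrArg (fun A : E →L[ℝ] E => A v) this
  refine ⟨?_, ?_, ?_⟩
  · -- conservation of energy
    have := const_on_interval (f := fun t => H (φ (t, x))) hs (by
      intro t ht
      have h1 : HasDerivAt (fun τ => φ (τ, x)) (X (φ (t, x))) t :=
        (hball _ (hmem t ht)).1.2.self_of_nhds
      have h2 := ((hH.differentiable (by simp)) (φ (t, x))).hasFDerivAt.comp_hasDerivAt t h1
      have h3 := hJ (fderiv ℝ H (φ (t, x))) (X (φ (t, x)))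
      have h4 := hω (X (φ (t, x))) (X (φ (t, x)))
      have h5 : ω (X (φ (t, x))) (X (φ (t, x))) = 0 := by linarith
      have h6 : ω (J (fderiv ℝ H (φ (t, x)))) (X (φ (t, x))) = 0 := h5
      have h7 : fderiv ℝ H (φ (t, x)) (X (φ (t, x))) = 0 := by linarith
      rw [h7] at h2
      exact h2)
    simpa [h0] using this
  · exact hvel _ (hcd _ hp) (hball _ hp).1.2.self_of_nhds
  · intro v w
    have hder : ∀ t, |t| < δ → ∀ v, HasDerivAt (fun τ => fderiv ℝ φ (τ, x) (0, v))
        (fderiv ℝ X (φ (t, x)) (fderiv ℝ φ (t, x) (0, v))) t := by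
      intro t ht v
      have hm := hmem t ht
      have hc := hcd _ hm
      have hsym : IsSymmSndFDerivAt ℝ φ (t, x) := hc.isSymmSndFDerivAt (by simpa using two_le_smooth)
      have hdd : HasFDerivAt (fderiv ℝ φ) (fderiv ℝ (fderiv ℝ φ) (t, x)) (t, x) :=
        ((hc.fderiv_right (m := (⊤ : ℕ∞)) (by simp)).differentiableAt (by simp)).hasFDerivAt
      have h1 : HasDerivAt (fun τ => fderiv ℝ φ (τ, x)) (fderiv ℝ (fderiv ℝ φ) (t, x) (1, 0)) t :=
        HasFDerivAt.comp_hasDerivAt t hdd (hlt t x)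
      have h2 : HasDerivAt (fun τ => fderiv ℝ φ (τ, x) (0, v))
          (fderiv ℝ (fderiv ℝ φ) (t, x) (1, 0) (0, v)) t := by
        simpa using h1.clm_apply (hasDerivAt_const t ((0 : ℝ), v))
      convert h2 using 1
      rw [hsym.eq]
      have h3 : HasFDerivAt (fun q => fderiv ℝ φ q (1, 0))
          ((fderiv ℝ (fderiv ℝ φ) (t, x)).flip (1, 0)) (t, x) := by
        have := hdd.clm_apply (hasFDerivAt_const ((1 : ℝ), (0 : E)) (t, x))
        simpa using this
      have h4 : HasFDerivAt (fun q => X (φ q)) (fderiv ℝ X (φ (t, x)) ∘L fderiv ℝ φ (t, x)) (t, x) :=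
        ((hX.differentiable (by simp)) _).hasFDerivAt.comp (t, x) (hd1 _ hm)
      have h5 : (fun q => fderiv ℝ φ q (1, 0)) =ᶠ[𝓝 (t, x)] fun q => X (φ q) := by
        filter_upwards [(hball _ hm).1.1, (hball _ hm).1.2] with q hq1 hq2
        exact hvel q hq1 hq2
      have h6 := h3.unique (h4.congr_of_eventuallyEq h5)
      exact (congrArg (fun A : ℝ × E →L[ℝ] E => A (0, v)) h6).symm
    have := const_on_interval
      (f := fun t => ω (fderiv ℝ φ (t, x) (0, v)) (fderiv ℝ φ (t, x) (0, w))) hs (by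
      intro t ht
      have h1 := (ω.hasFDerivAt.comp_hasDerivAt t (hder t ht v)).clm_apply (hder t ht w)
      have h2 := hDXs (φ (t, x)) (fderiv ℝ φ (t, x) (0, v)) (fderiv ℝ φ (t, x) (0, w))
      exact h1.congr_deriv h2)
    simpa [h0'] using this

theorem straighten (ω : E →L[ℝ] E →L[ℝ] ℝ) (hω : ∀ v w, ω v w = - ω w v)
    (J : (E →L[ℝ] ℝ) →L[ℝ] E) (hJ : ∀ α y, ω (J α) y = - α y)
    (H : E → ℝ) (hH : ContDiff ℝ (⊤ : ℕ∞) H) (u e f : E) (hef : ω e f = 1)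
    (he : fderiv ℝ H u e ≠ 0) :
    ∃ Φ : E → E, Φ 0 = u ∧ ∀ᶠ x in 𝓝 (0 : E), ContDiffAt ℝ (⊤ : ℕ∞) Φ x ∧
      H (Φ x) = H u + ω x f ∧
      ∀ v w, ω (fderiv ℝ Φ x v) (fderiv ℝ Φ x w) = ω v w := by
  obtain ⟨φ, hφ, hφ0, hφe⟩ := flow_symplectic ω hω J hJ H hH u
  let F : E × ℝ → ℝ := fun q => H (u + q.1 - ω e q.1 • f + q.2 • e) - ω q.1 f
  have hF : ContDiff ℝ (⊤ : ℕ∞) F := by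
    have h1 : ContDiff ℝ (⊤ : ℕ∞) (fun q : E × ℝ => ω e q.1) :=
      (ω e).contDiff.comp contDiff_fst
    have h2 : ContDiff ℝ (⊤ : ℕ∞) (fun q : E × ℝ => ω q.1 f) :=
      (ω.flip f).contDiff.comp contDiff_fst
    exact (hH.comp (((contDiff_const.add contDiff_fst).sub (h1.smul contDiff_const)).add
      (contDiff_snd.smul contDiff_const))).sub h2
  have hF0 : F (0, 0) = H u := by simp [F]
  have hinv : (fderiv ℝ F (0, 0) ∘L .inr ℝ E ℝ).IsInvertible := by
    have h1 : HasFDerivAt (fun s : ℝ => F (0, s)) (fderiv ℝ F (0, 0) ∘L .inr ℝ E ℝ) 0 :=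
      HasFDerivAt.comp (0 : ℝ) ((hF.differentiable (by simp)) (0, 0)).hasFDerivAt
        (hasFDerivAt_prodMk_right (0 : E) (0 : ℝ))
    have h2 : HasDerivAt (fun s : ℝ => F (0, s)) (fderiv ℝ H u e) 0 := by
      have h3 : HasDerivAt (fun s : ℝ => u + s • e) e 0 := by
        simpa using ((hasDerivAt_id (0 : ℝ)).smul_const e).const_add u
      have h4 : HasFDerivAt H (fderiv ℝ H u) (u + (0 : ℝ) • e) := by
        simpa using ((hH.differentiable (by simp)) u).hasFDerivAt
      have h5 := h4.comp_hasDerivAt (0 : ℝ) h3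
      simpa [F, Function.comp_def] using h5
    have h6 := h1.unique h2.hasFDerivAt
    rw [h6]
    refine ⟨ContinuousLinearEquiv.unitsEquivAut ℝ (Units.mk0 _ he), ?_⟩
    ext
    simp
  have cdf : ContDiffAt ℝ (⊤ : ℕ∞) F (0, 0) := hF.contDiffAt
  have pn : ((⊤ : ℕ∞) : WithTop ℕ∞) ≠ 0 := by simp
  set h := cdf.implicitFunction pn hinv
  have hh0 : h 0 = 0 := cdf.implicitFunction_apply_self pn hinv
  have hhc : ∀ᶠ x in 𝓝 (0 : E), ContDiffAt ℝ (⊤ : ℕ∞) h x :=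
    eventually_contDiffAt_implicit hF cdf pn hinv
  have hhe : ∀ᶠ x in 𝓝 (0 : E), F (x, h x) = H u := by
    have := cdf.eventually_apply_implicitFunction pn hinv
    rwa [hF0] at this
  let σ : E → E := fun x => u + x - ω e x • f + h x • e
  have hσ0 : σ 0 = u := by simp [σ, hh0]
  have hσd : ∀ x, ContDiffAt ℝ (⊤ : ℕ∞) h x → ContDiffAt ℝ (⊤ : ℕ∞) σ x := by
    intro x hx
    exact (((contDiffAt_const.add contDiffAt_id).sub
      ((ω e).contDiff.contDiffAt.smul contDiffAt_const)).add (hx.smul contDiffAt_const))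
  have hσD : ∀ x, ContDiffAt ℝ (⊤ : ℕ∞) h x → ∀ v,
      fderiv ℝ σ x v = v - ω e v • f + fderiv ℝ h x v • e := by
    intro x hx v
    have h1 : HasFDerivAt σ (ContinuousLinearMap.id ℝ E - (ω e).smulRight f
        + (fderiv ℝ h x).smulRight e) x :=
      (((hasFDerivAt_id x).const_add u).sub ((ω e).hasFDerivAt.smul_const f)).add
        ((hx.differentiableAt (by simp)).hasFDerivAt.smul_const e)
    rw [h1.fderiv]; simp
  let P : E → ℝ × E := fun x => (ω e x, σ x)
  have hP0 : P 0 = (0, u) := by simp [P, hσ0]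
  have hPc : Tendsto P (𝓝 0) (𝓝 (0, u)) := by
    have : ContinuousAt P 0 :=
      (ω e).continuous.continuousAt.prodMk (hσd 0 hhc.self_of_nhds).continuousAt
    have h' := this.tendsto
    rwa [hP0] at h'
  refine ⟨fun x => φ (P x), by simp [hP0, hφ0], ?_⟩
  filter_upwards [hPc.eventually hφ, (hPc.eventually hφe).eventually_nhds, hhc.eventually_nhds,
    hhe.eventually_nhds] with x hx1 hx2' hx3 hx4
  have hx2 := hx2'.self_of_nhds
  have hcx := hx3.self_of_nhds
  have hσx := hσd x hcx
  have hPd : ContDiffAt ℝ (⊤ : ℕ∞) P x := (ω e).contDiff.contDiffAt.prodMk hσx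
  have hHσ : ∀ y, F (y, h y) = H u → H (σ y) = H u + ω y f := by
    intro y hy
    have : H (σ y) - ω y f = H u := hy
    linarith
  refine ⟨hx1.comp x hPd, ?_, ?_⟩
  · rw [hx2.1]; exact hHσ x hx4.self_of_nhds
  · have hDP : HasFDerivAt P ((ω e).prod (fderiv ℝ σ x)) x :=
      (ω e).hasFDerivAt.prodMk (hσx.differentiableAt (by simp)).hasFDerivAt
    have hDφ : HasFDerivAt φ (fderiv ℝ φ (P x)) (P x) :=
      (hx1.differentiableAt (by simp)).hasFDerivAt
    have hD : ∀ v, fderiv ℝ (fun x => φ (P x)) x v =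
        ω e v • J (fderiv ℝ H (φ (P x))) + fderiv ℝ φ (P x) (0, fderiv ℝ σ x v) := by
      intro v
      have h1 : HasFDerivAt (fun x => φ (P x)) (fderiv ℝ φ (P x) ∘L ((ω e).prod (fderiv ℝ σ x))) x :=
        hDφ.comp x hDP
      rw [h1.fderiv, ← hx2.2.1, ← map_smul, ← map_add]
      simp
    -- energy along `σ`
    have hHσD : ∀ w, fderiv ℝ H (φ (P x)) (fderiv ℝ φ (P x) (0, fderiv ℝ σ x w)) = ω w f := by
      intro w
      have h1 : HasFDerivAt (fun y => H (φ (P y))) (fderiv ℝ H (φ (P x)) ∘L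
          (fderiv ℝ φ (P x) ∘L ((ω e).prod (fderiv ℝ σ x)))) x :=
        HasFDerivAt.comp x ((hH.differentiable (by simp)) _).hasFDerivAt (hDφ.comp x hDP)
      have h2 : HasFDerivAt (fun y => H (φ (P y))) (ω.flip f) x := by
        refine ((ω.flip f).hasFDerivAt.const_add (H u)).congr_of_eventuallyEq ?_
        filter_upwards [hx2', hx4] with y hy1 hy2
        rw [hy1.1]
        exact hHσ y hy2
      have h3 := congrArg (fun A : E →L[ℝ] ℝ => A w) (h1.unique h2)
      simp only [ContinuousLinearMap.comp_apply, ContinuousLinearMap.prod_apply,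
        ContinuousLinearMap.flip_apply] at h3
      have h4 : fderiv ℝ φ (P x) (ω e w, fderiv ℝ σ x w) =
          ω e w • J (fderiv ℝ H (φ (P x))) + fderiv ℝ φ (P x) (0, fderiv ℝ σ x w) := by
        rw [← hx2.2.1, ← map_smul, ← map_add]
        simp
      have h5 : fderiv ℝ H (φ (P x)) (J (fderiv ℝ H (φ (P x)))) = 0 := by
        have a := hJ (fderiv ℝ H (φ (P x))) (J (fderiv ℝ H (φ (P x))))
        have b := hω (J (fderiv ℝ H (φ (P x)))) (J (fderiv ℝ H (φ (P x))))
        linarith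
      rw [h4, map_add, map_smul, h5] at h3
      simpa using h3
    intro v w
    have hJJ : ω (J (fderiv ℝ H (φ (P x)))) (J (fderiv ℝ H (φ (P x)))) = 0 := by
      have := hω (J (fderiv ℝ H (φ (P x)))) (J (fderiv ℝ H (φ (P x))))
      linarith
    have hff : ω f f = 0 := by have := hω f f; linarith
    have hee : ω e e = 0 := by have := hω e e; linarith
    rw [hD, hD]
    simp only [map_add, map_smul, _root_.add_apply, _root_.smul_apply,
      smul_eq_mul, hJJ, hJ, hHσD, hx2.2.2]
    rw [hω _ (J _), hJ, hHσD, hσD x hcx, hσD x hcx]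
    simp only [map_add, map_sub, map_smul, _root_.add_apply,
      _root_.sub_apply, _root_.smul_apply, smul_eq_mul, hff, hee, hef]
    rw [hω v e, hω f w, hω f e, hef]
    ring

end Straighten

section Matching

variable {E : Type} [NormedAddCommGroup E] [NormedSpace ℝ E] [FiniteDimensional ℝ E]

theorem exists_global_extension (H : E → ℝ) (U : Set E) (hU : IsOpen U)
    (hH : ContDiffOn ℝ (⊤ : ℕ∞) H U) (u : E) (hu : u ∈ U) :
    ∃ G : E → ℝ, ContDiff ℝ (⊤ : ℕ∞) G ∧ G =ᶠ[𝓝 u] H := by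
  obtain ⟨ε, hε, hb⟩ := Metric.nhds_basis_closedBall.mem_iff.1 (hU.mem_nhds hu)
  let χ : ContDiffBump u := ⟨ε / 2, ε, by positivity, by linarith⟩
  refine ⟨fun x => χ x * H x, ?_, ?_⟩
  · rw [contDiff_iff_contDiffAt]
    intro x
    by_cases hx : x ∈ U
    · exact χ.contDiffAt.mul (hH.contDiffAt (hU.mem_nhds hx))
    · have hx' : x ∉ tsupport χ := by
        rw [χ.tsupport_eq]
        exact fun h => hx (hb h)
      have h0 := notMem_tsupport_iff_eventuallyEq.1 hx'
      refine (contDiffAt_const (c := (0 : ℝ))).congr_of_eventuallyEq ?_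
      filter_upwards [h0] with y hy
      simp [hy]
  · filter_upwards [χ.eventuallyEq_one] with y hy
    simp [hy]

theorem symplectic_isInvertible (ω : E →L[ℝ] E →L[ℝ] ℝ) (J : (E →L[ℝ] ℝ) →L[ℝ] E)
    (hω : ∀ v w, ω v w = - ω w v) (hJ : ∀ α y, ω (J α) y = - α y) (A : E →L[ℝ] E)
    (hA : ∀ v w, ω (A v) (A w) = ω v w) : A.IsInvertible := by
  have hinj : Function.Injective (A : E →ₗ[ℝ] E) := by
    rw [injective_iff_map_eq_zero]
    intro v hv
    have hv' : A v = 0 := hv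
    have h1 : ∀ α : E →L[ℝ] ℝ, α v = 0 := by
      intro α
      have h2 := hA (J α) v
      rw [hJ, hv'] at h2
      simp at h2
      exact h2
    by_contra hne
    obtain ⟨g, _, hg⟩ := exists_dual_vector ℝ v (norm_ne_zero_iff.2 hne)
    rw [h1 g] at hg
    exact hne (by simpa using hg.symm)
  refine ⟨(LinearEquiv.ofInjectiveEndo (A : E →ₗ[ℝ] E) hinj).toContinuousLinearEquiv, ?_⟩
  ext v
  rfl

theorem exists_common {α β : E →L[ℝ] ℝ} (hα : α ≠ 0) (hβ : β ≠ 0) : ∃ e, α e ≠ 0 ∧ β e ≠ 0 := by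
  obtain ⟨a, ha⟩ : ∃ a, α a ≠ 0 := by
    by_contra h; push Not at h; exact hα (by ext v; simpa using h v)
  obtain ⟨b, hb⟩ : ∃ b, β b ≠ 0 := by
    by_contra h; push Not at h; exact hβ (by ext v; simpa using h v)
  by_cases h1 : β a = 0
  · by_cases h2 : α b = 0
    · exact ⟨a + b, by simpa [h2] using ha, by simpa [h1] using hb⟩
    · exact ⟨b, h2, hb⟩
  · exact ⟨a, ha, h1⟩

theorem straighten_local (ω : E →L[ℝ] E →L[ℝ] ℝ) (hω : ∀ v w, ω v w = - ω w v)
    (J : (E →L[ℝ] ℝ) →L[ℝ] E) (hJ : ∀ α y, ω (J α) y = - α y)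
    (H : E → ℝ) (U : Set E) (hU : IsOpen U) (hH : ContDiffOn ℝ (⊤ : ℕ∞) H U)
    (u e f : E) (hu : u ∈ U) (hef : ω e f = 1)
    (he : fderiv ℝ H u e ≠ 0) :
    ∃ Φ : E → E, Φ 0 = u ∧ ∀ᶠ x in 𝓝 (0 : E), ContDiffAt ℝ (⊤ : ℕ∞) Φ x ∧
      H (Φ x) = H u + ω x f ∧
      ∀ v w, ω (fderiv ℝ Φ x v) (fderiv ℝ Φ x w) = ω v w := by
  have : CompleteSpace E := FiniteDimensional.complete ℝ E
  obtain ⟨G, hG, hGH⟩ := exists_global_extension H U hU hH u hu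
  obtain ⟨Φ, h0, h1⟩ := straighten ω hω J hJ G hG u e f hef (by rwa [hGH.fderiv_eq])
  refine ⟨Φ, h0, ?_⟩
  have hc : Tendsto Φ (𝓝 0) (𝓝 u) := by
    have := h1.self_of_nhds.1.continuousAt.tendsto
    rwa [h0] at this
  filter_upwards [h1, hc.eventually hGH] with x hx hx2
  exact ⟨hx.1, by rw [← hx2, hx.2.1, hGH.self_of_nhds], hx.2.2⟩

theorem exists_matching (ω : E →L[ℝ] E →L[ℝ] ℝ) (hω : ∀ v w, ω v w = - ω w v)
    (J : (E →L[ℝ] ℝ) →L[ℝ] E) (hJ : ∀ α y, ω (J α) y = - α y)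
    (H H' : E → ℝ) (U U' : Set E) (hU : IsOpen U) (hU' : IsOpen U')
    (hH : ContDiffOn ℝ (⊤ : ℕ∞) H U) (hH' : ContDiffOn ℝ (⊤ : ℕ∞) H' U')
    (u u' : E) (hu : u ∈ U) (hu' : u' ∈ U')
    (hnd : fderiv ℝ H u ≠ 0) (hnd' : fderiv ℝ H' u' ≠ 0) :
    ∃ Θ : E → E, Θ u' = u ∧ ∀ᶠ x in 𝓝 u', ContDiffAt ℝ (⊤ : ℕ∞) Θ x ∧
      H (Θ x) = H u + (H' x - H' u') ∧
      ∀ v w, ω (fderiv ℝ Θ x v) (fderiv ℝ Θ x w) = ω v w := by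
  have : CompleteSpace E := FiniteDimensional.complete ℝ E
  obtain ⟨e, he, he'⟩ := exists_common hnd hnd'
  obtain ⟨f, hef⟩ : ∃ f, ω e f = 1 := by
    have h1 : ω (J (fderiv ℝ H u)) e ≠ 0 := by rw [hJ]; simpa using he
    refine ⟨(ω e (J (fderiv ℝ H u)))⁻¹ • J (fderiv ℝ H u), ?_⟩
    rw [map_smul, smul_eq_mul]
    refine inv_mul_cancel₀ ?_
    rw [hω]; simpa using h1
  obtain ⟨Φ, hΦ0, hΦ⟩ := straighten_local ω hω J hJ H U hU hH u e f hu hef he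
  obtain ⟨Ψ, hΨ0, hΨ⟩ := straighten_local ω hω J hJ H' U' hU' hH' u' e f hu' hef he'
  obtain ⟨A, hA⟩ := symplectic_isInvertible ω J hω hJ _ hΨ.self_of_nhds.2.2
  have hd0 : HasFDerivAt Ψ (A : E →L[ℝ] E) 0 := by
    rw [hA]; exact (hΨ.self_of_nhds.1.differentiableAt (by simp)).hasFDerivAt
  have pn : ((⊤ : ℕ∞) : WithTop ℕ∞) ≠ 0 := by simp
  have hcd0 := hΨ.self_of_nhds.1
  set T := hcd0.toOpenPartialHomeomorph Ψ hd0 pn with hT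
  have hTc : (T : E → E) = Ψ := rfl
  have hs0 : (0 : E) ∈ T.source := hcd0.mem_toOpenPartialHomeomorph_source hd0 pn
  have ht0 : u' ∈ T.target := by
    have := hcd0.image_mem_toOpenPartialHomeomorph_target hd0 pn
    rwa [hΨ0] at this
  have hsymm0 : T.symm u' = 0 := by
    have := T.left_inv hs0
    rwa [hTc, hΨ0] at this
  have hsc : Tendsto T.symm (𝓝 u') (𝓝 0) := by
    have := (T.continuousAt_symm ht0).tendsto
    rwa [hsymm0] at this
  refine ⟨fun x => Φ (T.symm x), by simp [hsymm0, hΦ0], ?_⟩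
  filter_upwards [hsc.eventually hΦ, hsc.eventually hΨ, T.open_target.mem_nhds ht0]
    with x hx1 hx2 hxt
  obtain ⟨B, hB⟩ := symplectic_isInvertible ω J hω hJ _ hx2.2.2
  have hdx : HasFDerivAt Ψ (fderiv ℝ Ψ (T.symm x)) (T.symm x) :=
    (hx2.1.differentiableAt (by simp)).hasFDerivAt
  have hcs : ContDiffAt ℝ (⊤ : ℕ∞) T.symm x :=
    T.contDiffAt_symm (f₀' := B) hxt (by rw [hB]; exact hdx) hx2.1
  have hds : HasFDerivAt T.symm (fderiv ℝ T.symm x) x :=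
    (hcs.differentiableAt (by simp)).hasFDerivAt
  have hright : Ψ (T.symm x) = x := T.right_inv hxt
  refine ⟨hx1.1.comp x hcs, ?_, ?_⟩
  · have h1 := hx2.2.1
    rw [hright] at h1
    rw [hx1.2.1, h1]; ring
  · intro v w
    have h1 : HasFDerivAt (fun x => Φ (T.symm x)) (fderiv ℝ Φ (T.symm x) ∘L fderiv ℝ T.symm x) x :=
      HasFDerivAt.comp x (hx1.1.differentiableAt (by simp)).hasFDerivAt hds
    have h2 : HasFDerivAt (fun x => Ψ (T.symm x)) (fderiv ℝ Ψ (T.symm x) ∘L fderiv ℝ T.symm x) x :=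
      HasFDerivAt.comp x hdx hds
    have h3 : HasFDerivAt (fun x => Ψ (T.symm x)) (ContinuousLinearMap.id ℝ E) x := by
      refine (hasFDerivAt_id x).congr_of_eventuallyEq ?_
      filter_upwards [T.open_target.mem_nhds hxt] with y hy
      exact T.right_inv hy
    have h4 : ∀ v, fderiv ℝ Ψ (T.symm x) (fderiv ℝ T.symm x v) = v := fun v =>
      congrArg (fun A : E →L[ℝ] E => A v) (h2.unique h3)
    rw [h1.fderiv]
    simp only [ContinuousLinearMap.comp_apply]
    rw [hx1.2.2, ← hx2.2.2, h4, h4]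

/-- Pullback of symplectic vector fields by symplectic maps. -/
theorem pullback_symplectic (ω : E →L[ℝ] E →L[ℝ] ℝ)
    (Θ Y Z : E → E) (w : E) (hΘ : ContDiffAt ℝ (⊤ : ℕ∞) Θ w)
    (hs : ∀ᶠ x in 𝓝 w, ∀ v v', ω (fderiv ℝ Θ x v) (fderiv ℝ Θ x v') = ω v v')
    (hY : DifferentiableAt ℝ Y (Θ w)) (hZ : DifferentiableAt ℝ Z w)
    (hYs : ∀ v v', ω (fderiv ℝ Y (Θ w) v) v' + ω v (fderiv ℝ Y (Θ w) v') = 0)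
    (hZY : ∀ᶠ x in 𝓝 w, fderiv ℝ Θ x (Z x) = Y (Θ x)) :
    ∀ v v', ω (fderiv ℝ Z w v) v' + ω v (fderiv ℝ Z w v') = 0 := by
  have hsym : IsSymmSndFDerivAt ℝ Θ w := hΘ.isSymmSndFDerivAt (by simpa using two_le_smooth)
  have hdd : HasFDerivAt (fderiv ℝ Θ) (fderiv ℝ (fderiv ℝ Θ) w) w :=
    ((hΘ.fderiv_right (m := (⊤ : ℕ∞)) (by simp)).differentiableAt (by simp)).hasFDerivAt
  have hd : HasFDerivAt Θ (fderiv ℝ Θ w) w := (hΘ.differentiableAt (by simp)).hasFDerivAt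
  have e1 : ∀ v, fderiv ℝ Θ w (fderiv ℝ Z w v) =
      fderiv ℝ Y (Θ w) (fderiv ℝ Θ w v) - fderiv ℝ (fderiv ℝ Θ) w (Z w) v := by
    intro v
    have h1 := hdd.clm_apply hZ.hasFDerivAt
    have h2 : HasFDerivAt (fun x => Y (Θ x)) (fderiv ℝ Y (Θ w) ∘L fderiv ℝ Θ w) w :=
      hY.hasFDerivAt.comp w hd
    have h3 := congrArg (fun A : E →L[ℝ] E => A v) (h1.unique (h2.congr_of_eventuallyEq hZY))
    simp at h3
    rw [hsym.eq (Z w) v, ← h3]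
    abel
  have e2 : ∀ z v v', ω (fderiv ℝ (fderiv ℝ Θ) w z v) (fderiv ℝ Θ w v') +
      ω (fderiv ℝ Θ w v) (fderiv ℝ (fderiv ℝ Θ) w z v') = 0 := by
    intro z v v'
    have h1 : ∀ v, HasFDerivAt (fun x => fderiv ℝ Θ x v)
        ((fderiv ℝ (fderiv ℝ Θ) w).flip v) w := by
      intro v
      simpa using hdd.clm_apply (hasFDerivAt_const v w)
    have h2 := (ω.hasFDerivAt.comp w (h1 v)).clm_apply (h1 v')
    have h3 : HasFDerivAt (fun x => ω (fderiv ℝ Θ x v) (fderiv ℝ Θ x v'))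
        (0 : E →L[ℝ] ℝ) w := by
      refine (hasFDerivAt_const (ω v v') w).congr_of_eventuallyEq ?_
      filter_upwards [hs] with x hx
      exact hx v v'
    have h4 := congrArg (fun A : E →L[ℝ] ℝ => A z) (h2.unique h3)
    simp at h4
    linarith
  intro v v'
  have hsw := hs.self_of_nhds
  rw [← hsw, ← hsw v, e1, e1]
  have a := hYs (fderiv ℝ Θ w v) (fderiv ℝ Θ w v')
  have b := e2 (Z w) v v'
  simp only [map_sub, _root_.sub_apply]
  linarith

end Matching

section Final

/-- The symplectic form as a continuous bilinear map. -/
def omegaL (n : ℕ) : Phase n →L[ℝ] Phase n →L[ℝ] ℝ :=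
  LinearMap.toContinuousLinearMap
    ((LinearMap.toContinuousLinearMap : (Phase n →ₗ[ℝ] ℝ) ≃ₗ[ℝ] (Phase n →L[ℝ] ℝ)).toLinearMap ∘ₗ
      (LinearMap.mk₂ ℝ (OmegaStd n)
        (by intro a b c; simp only [OmegaStd, ← Finset.sum_add_distrib]
            refine Finset.sum_congr rfl fun i _ => ?_
            simp; ring)
        (by intro a b c; simp only [OmegaStd, smul_eq_mul, Finset.mul_sum]
            refine Finset.sum_congr rfl fun i _ => ?_
            simp; ring)
        (by intro a b c; simp only [OmegaStd, ← Finset.sum_add_distrib]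
            refine Finset.sum_congr rfl fun i _ => ?_
            simp; ring)
        (by intro a b c; simp only [OmegaStd, smul_eq_mul, Finset.mul_sum]
            refine Finset.sum_congr rfl fun i _ => ?_
            simp; ring)))

theorem omegaL_apply (n : ℕ) (v w : Phase n) : omegaL n v w = OmegaStd n v w := rfl

theorem omegaL_skew (n : ℕ) (v w : Phase n) : omegaL n v w = - omegaL n w v := by
  simp only [omegaL_apply, OmegaStd, ← Finset.sum_neg_distrib]
  refine Finset.sum_congr rfl fun i _ => ?_
  ring

/-- The inverse of the symplectic form. -/
def symJ (n : ℕ) : (Phase n →L[ℝ] ℝ) →L[ℝ] Phase n :=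
  LinearMap.toContinuousLinearMap
    { toFun := fun α => (fun i => α (0, Pi.single i 1), fun i => - α (Pi.single i 1, 0))
      map_add' := by
        intro α β
        ext i <;> simp
        ring
      map_smul' := by
        intro c α
        ext i <;> simp }

theorem symJ_spec (n : ℕ) (α : Phase n →L[ℝ] ℝ) (y : Phase n) :
    omegaL n (symJ n α) y = - α y := by
  have hy : y = ∑ i, (y.1 i • ((Pi.single i 1, 0) : Phase n) +
      y.2 i • ((0, Pi.single i 1) : Phase n)) := by
    refine Prod.ext ?_ ?_
    · ext j
      simp [Prod.fst_sum, Finset.sum_apply, Pi.single_apply]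
    · ext j
      simp [Prod.snd_sum, Finset.sum_apply, Pi.single_apply]
  conv_rhs => rw [hy, map_sum, ← Finset.sum_neg_distrib]
  rw [omegaL_apply, OmegaStd]
  refine Finset.sum_congr rfl fun i _ => ?_
  simp only [symJ, map_add, map_smul, smul_eq_mul, LinearMap.coe_toContinuousLinearMap',
    LinearMap.coe_mk, AddHom.coe_mk]
  ring

/-- Pullback of germs of vector fields. -/
def germPullback {E : Type} [NormedAddCommGroup E] [NormedSpace ℝ E] {u u' : E} (Θ : E → E)
    (h : Tendsto Θ (𝓝 u') (𝓝 u)) : (𝓝 u).Germ E → (𝓝 u').Germ E :=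
  Quotient.map (fun Y => VectorField.pullback ℝ Θ Y) (by
    intro Y Y' hY
    have hY' : Y =ᶠ[𝓝 u] Y' := hY
    have h1 : ∀ᶠ x in 𝓝 u', Y (Θ x) = Y' (Θ x) := h.eventually hY'
    show VectorField.pullback ℝ Θ Y =ᶠ[𝓝 u'] VectorField.pullback ℝ Θ Y'
    filter_upwards [h1] with x hx
    simp [VectorField.pullback, hx])

theorem germPullback_coe {E : Type} [NormedAddCommGroup E] [NormedSpace ℝ E] {u u' : E} (Θ : E → E)
    (h : Tendsto Θ (𝓝 u') (𝓝 u)) (Y : E → E) :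
    germPullback Θ h (Y : (𝓝 u).Germ E) =
      ((VectorField.pullback ℝ Θ Y : E → E) : (𝓝 u').Germ E) := rfl

theorem germBracket_coe {E : Type} [NormedAddCommGroup E] [NormedSpace ℝ E] {u : E}
    (X Y : E → E) : germBracket (X : (𝓝 u).Germ E) (Y : (𝓝 u).Germ E) =
      ((VectorField.lieBracket ℝ X Y : E → E) : (𝓝 u).Germ E) := rfl

end Final

/-- Let `H`, `H′` be Hamiltonians with points of non-degeneracy `u`, `u′`.
Every Lie subalgebra `g ⊆ sp^H` (a subset closed under addition, scalar multiplication and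
Lie bracket) is isomorphic, as a real Lie algebra, to some Lie subalgebra `g′ ⊆ sp^{H′}`. -/
theorem stmt19 (n : ℕ)
    (U U' : Set (Phase n)) (hU : IsOpen U) (hU' : IsOpen U')
    (H H' : Phase n → ℝ) (hH : ContDiffOn ℝ (⊤ : ℕ∞) H U) (hH' : ContDiffOn ℝ (⊤ : ℕ∞) H' U')
    (u u' : Phase n) (hu : u ∈ U) (hu' : u' ∈ U')
    (hnd : fderiv ℝ H u ≠ 0) (hnd' : fderiv ℝ H' u' ≠ 0) :
    ∀ S : Set ((𝓝 u).Germ (Phase n)),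
      S ⊆ spH n H U u →
      (∀ g ∈ S, ∀ h ∈ S, g + h ∈ S) →
      (∀ c : ℝ, ∀ g ∈ S, c • g ∈ S) →
      (∀ g ∈ S, ∀ h ∈ S, germBracket g h ∈ S) →
      ∃ S' : Set ((𝓝 u').Germ (Phase n)),
        S' ⊆ spH n H' U' u' ∧
        (∀ g ∈ S', ∀ h ∈ S', g + h ∈ S') ∧
        (∀ c : ℝ, ∀ g ∈ S', c • g ∈ S') ∧
        (∀ g ∈ S', ∀ h ∈ S', germBracket g h ∈ S') ∧
        ∃ φ : (𝓝 u).Germ (Phase n) → (𝓝 u').Germ (Phase n),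
          Set.BijOn φ S S' ∧
          (∀ g ∈ S, ∀ h ∈ S, φ (g + h) = φ g + φ h) ∧
          (∀ c : ℝ, ∀ g ∈ S, φ (c • g) = c • φ g) ∧
          (∀ g ∈ S, ∀ h ∈ S, φ (germBracket g h) = germBracket (φ g) (φ h)) := by
  intro S hS hadd hsmul hbr
  obtain ⟨Θ, hΘ0, hΘ⟩ := exists_matching (omegaL n) (omegaL_skew n) (symJ n) (symJ_spec n)
    H H' U U' hU hU' hH hH' u u' hu hu' hnd hnd'
  have hΘc : Tendsto Θ (𝓝 u') (𝓝 u) := by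
    have := hΘ.self_of_nhds.1.continuousAt.tendsto
    rwa [hΘ0] at this
  have hinv : ∀ᶠ x in 𝓝 u', (fderiv ℝ Θ x).IsInvertible := by
    filter_upwards [hΘ] with x hx
    exact symplectic_isInvertible (omegaL n) (symJ n) (omegaL_skew n) (symJ_spec n) _ hx.2.2
  have hmap : Filter.map Θ (𝓝 u') = 𝓝 u := by
    obtain ⟨A, hA⟩ := hinv.self_of_nhds
    have h1 : HasStrictFDerivAt Θ (A : Phase n →L[ℝ] Phase n) u' := by
      rw [hA]; exact hΘ.self_of_nhds.1.hasStrictFDerivAt (by simp)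
    rw [h1.map_nhds_eq_of_equiv, hΘ0]
  set P := germPullback Θ hΘc with hP
  have Padd : ∀ g h, P (g + h) = P g + P h := by
    intro g h
    induction g using Filter.Germ.inductionOn with | _ X
    induction h using Filter.Germ.inductionOn with | _ Y
    rw [← Filter.Germ.coe_add, hP, germPullback_coe, germPullback_coe, germPullback_coe,
      ← Filter.Germ.coe_add]
    congr 1
    ext1 x
    simp [VectorField.pullback]
  have Psmul : ∀ (c : ℝ) g, P (c • g) = c • P g := by
    intro c g
    induction g using Filter.Germ.inductionOn with | _ X
    rw [← Filter.Germ.coe_smul, hP, germPullback_coe, germPullback_coe, ← Filter.Germ.coe_smul]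
    congr 1
    ext1 x
    simp [VectorField.pullback]
  have Pbr : ∀ g ∈ S, ∀ h ∈ S, P (germBracket g h) = germBracket (P g) (P h) := by
    intro g hg h hh
    obtain ⟨X, V, hV, huV, -, hX, -, -, rfl⟩ := hS hg
    obtain ⟨Y, W, hW, huW, -, hY, -, -, rfl⟩ := hS hh
    rw [germBracket_coe, hP, germPullback_coe, germPullback_coe, germPullback_coe,
      germBracket_coe]
    refine Filter.Germ.coe_eq.2 ?_
    filter_upwards [hΘ, hΘc.eventually (hV.mem_nhds huV), hΘc.eventually (hW.mem_nhds huW)]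
      with x hx hxV hxW
    exact VectorField.pullback_lieBracket (n := ((⊤ : ℕ∞) : WithTop ℕ∞))
      (by simpa using two_le_smooth) hx.1
      ((hX.contDiffAt (hV.mem_nhds hxV)).differentiableAt (by simp))
      ((hY.contDiffAt (hW.mem_nhds hxW)).differentiableAt (by simp))
  have Pinj : Function.Injective P := by
    intro g h hgh
    induction g using Filter.Germ.inductionOn with | _ X
    induction h using Filter.Germ.inductionOn with | _ Y
    rw [hP, germPullback_coe, germPullback_coe] at hgh
    have h1 := Filter.Germ.coe_eq.1 hgh
    refine Filter.Germ.coe_eq.2 ?_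
    have h2 : ∀ᶠ x in 𝓝 u', X (Θ x) = Y (Θ x) := by
      filter_upwards [h1, hinv] with x hx hx2
      rw [← VectorField.fderiv_pullback Θ X x hx2, hx, VectorField.fderiv_pullback Θ Y x hx2]
    have h3 : ∀ᶠ y in Filter.map Θ (𝓝 u'), X y = Y y := h2
    rwa [hmap] at h3
  have Pmem : ∀ g ∈ S, P g ∈ spH n H' U' u' := by
    intro g hg
    obtain ⟨Y, V, hV, huV, hVU, hY, hYs, hYH, rfl⟩ := hS hg
    have hev : ∀ᶠ x in 𝓝 u', x ∈ U' ∧ Θ x ∈ V ∧ (fderiv ℝ Θ x).IsInvertible ∧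
        ContDiffAt ℝ (⊤ : ℕ∞) Θ x ∧ H (Θ x) = H u + (H' x - H' u') ∧
        ∀ v w, omegaL n (fderiv ℝ Θ x v) (fderiv ℝ Θ x w) = omegaL n v w := by
      filter_upwards [hU'.mem_nhds hu', hΘc.eventually (hV.mem_nhds huV), hinv, hΘ]
        with x h1 h2 h3 h4
      exact ⟨h1, h2, h3, h4⟩
    obtain ⟨V', hV'ev, hV'o, hu'V'⟩ := eventually_nhds_iff.1 hev
    have hYd : ∀ x ∈ V', ContDiffAt ℝ (⊤ : ℕ∞) Y (Θ x) := fun x hx =>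
      hY.contDiffAt (hV.mem_nhds (hV'ev x hx).2.1)
    have hZd : ∀ x ∈ V', ContDiffAt ℝ (⊤ : ℕ∞) (VectorField.pullback ℝ Θ Y) x := by
      intro x hx
      obtain ⟨-, -, h3, h4, -⟩ := hV'ev x hx
      have h5 : ContDiffAt ℝ (⊤ : ℕ∞) (fun x => (fderiv ℝ Θ x).inverse) x := by
        have h6 : ContDiffAt ℝ (⊤ : ℕ∞) (fderiv ℝ Θ) x := h4.fderiv_right (by simp)
        exact ContDiffAt.comp x h3.contDiffAt_map_inverse h6
      exact h5.clm_apply ((hYd x hx).comp x h4)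
    refine ⟨VectorField.pullback ℝ Θ Y, V', hV'o, hu'V', fun x hx => (hV'ev x hx).1,
      fun x hx => (hZd x hx).contDiffWithinAt, ?_, ?_, ?_⟩
    · intro w hw
      obtain ⟨-, h2, h3, h4, -⟩ := hV'ev w hw
      have hVw := hV'o.mem_nhds hw
      refine pullback_symplectic (omegaL n) Θ Y _ w h4 ?_
        ((hYd w hw).differentiableAt (by simp)) ((hZd w hw).differentiableAt (by simp))
        (fun v v' => hYs _ h2 v v') ?_
      · filter_upwards [hVw] with x hx
        exact (hV'ev x hx).2.2.2.2.2
      · filter_upwards [hVw] with x hx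
        exact VectorField.fderiv_pullback Θ Y x (hV'ev x hx).2.2.1
    · intro w hw
      obtain ⟨h1, h2, h3, h4, -⟩ := hV'ev w hw
      have hVw := hV'o.mem_nhds hw
      have hHd : HasFDerivAt H (fderiv ℝ H (Θ w)) (Θ w) :=
        ((hH.contDiffAt (hU.mem_nhds (hVU h2))).differentiableAt (by simp)).hasFDerivAt
      have a1 : HasFDerivAt (fun x => H (Θ x)) (fderiv ℝ H (Θ w) ∘L fderiv ℝ Θ w) w :=
        hHd.comp w (h4.differentiableAt (by simp)).hasFDerivAt
      have a2 : HasFDerivAt (fun x => H u + (H' x - H' u')) (fderiv ℝ H' w) w :=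
        (((hH'.contDiffAt (hU'.mem_nhds h1)).differentiableAt
          (by simp)).hasFDerivAt.sub_const _).const_add _
      have a3 : (fun x => H (Θ x)) =ᶠ[𝓝 w] fun x => H u + (H' x - H' u') := by
        filter_upwards [hVw] with x hx
        exact (hV'ev x hx).2.2.2.2.1
      rw [← a1.unique (a2.congr_of_eventuallyEq a3), ContinuousLinearMap.comp_apply,
        VectorField.fderiv_pullback Θ Y w h3]
      exact hYH _ h2
    · rfl
  refine ⟨P '' S, ?_, ?_, ?_, ?_, P, ⟨mapsTo_image _ _, Pinj.injOn, surjOn_image _ _⟩,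
    fun g _ h _ => Padd g h, fun c g _ => Psmul c g, Pbr⟩
  · rintro _ ⟨g, hg, rfl⟩
    exact Pmem g hg
  · rintro _ ⟨g, hg, rfl⟩ _ ⟨h, hh, rfl⟩
    exact ⟨g + h, hadd g hg h hh, Padd g h⟩
  · rintro c _ ⟨g, hg, rfl⟩
    exact ⟨c • g, hsmul c g hg, Psmul c g⟩
  · rintro _ ⟨g, hg, rfl⟩ _ ⟨h, hh, rfl⟩
    exact ⟨_, hbr g hg h hh, Pbr g hg h hh⟩
end
end
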